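/- arXiv:math/0611083 — 2 statements merged into one kernel-verified Lean document; each statement's English description precedes it below -/
import Mathlib

section
/- Assume β̄ > 0. There exist constants c₈, c₉ > 0 independent of ε such that for every ε ∈ (0,1] with L/(2πε) a positive integer and every classical solution u^ε of the rough problem, the first-order full boundary-layer approximation satisfies ‖u^ε − u^{∞,1}_ε‖_{H¹(Ω^ε)} ≤ c₈ ε and ‖u^ε − u^{∞,1}_ε‖_{L²(Ω⁰)} ≤ c₉ ε^{3/2}. -/
open MeasureTheory Real Set

noncomputable section

/-- Partial derivative in the first variable. -/
def pd1 (u : ℝ → ℝ → ℝ) (x y : ℝ) : ℝ := deriv (fun t => u t y) x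

/-- Partial derivative in the second variable. -/
def pd2 (u : ℝ → ℝ → ℝ) (x y : ℝ) : ℝ := deriv (fun t => u x t) y

/-- Laplacian. -/
def lap (u : ℝ → ℝ → ℝ) (x y : ℝ) : ℝ := pd1 (pd1 u) x y + pd2 (pd2 u) x y

/-- Squared modulus of the gradient. -/
def gradSq (u : ℝ → ℝ → ℝ) (x y : ℝ) : ℝ := (pd1 u x y) ^ 2 + (pd2 u x y) ^ 2

/-- The rough domain Ω^ε. -/
def OmegaEps (f : ℝ → ℝ) (L ε : ℝ) : Set (ℝ × ℝ) :=
  {p | 0 < p.1 ∧ p.1 < L ∧ ε * f (p.1 / ε) < p.2 ∧ p.2 < 1}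

/-- The smooth domain Ω⁰. -/
def Omega0 (L : ℝ) : Set (ℝ × ℝ) := Ioo 0 L ×ˢ Ioo (0 : ℝ) 1

/-- The periodic rough strip. -/
def RoughStrip (f : ℝ → ℝ) (ε : ℝ) : Set (ℝ × ℝ) :=
  {p | ε * f (p.1 / ε) < p.2 ∧ p.2 < 1}

/-- A classical solution of the rough problem `-Δu = C` in `Ω^ε`, `u = 0` on `Γ^ε ∪ Γ¹`,
periodic in `x₁`, with finite Dirichlet energy. -/
structure RoughSolution (f : ℝ → ℝ) (L C ε : ℝ) (u : ℝ → ℝ → ℝ) : Prop where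
  cont : ContinuousOn (fun p : ℝ × ℝ => u p.1 p.2) (closure (OmegaEps f L ε))
  periodic : ∀ x y, u (x + L) y = u x y
  smooth : ContDiffOn ℝ 2 (fun p : ℝ × ℝ => u p.1 p.2) (RoughStrip f ε)
  eqn : ∀ p ∈ OmegaEps f L ε, -(lap u p.1 p.2) = C
  bc_rough : ∀ x, u x (ε * f (x / ε)) = 0
  bc_top : ∀ x, u x 1 = 0
  energy : IntegrableOn (fun p : ℝ × ℝ => gradSq u p.1 p.2) (OmegaEps f L ε)

/-- The zeroth order approximation `u^{0,1}`: Poiseuille profile, linearly extended below. -/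
def u01 (C : ℝ) (x y : ℝ) : ℝ := if 0 ≤ y then C / 2 * (1 - y) * y else C / 2 * y

/-- A classical solution of a cell problem: harmonic above the rough boundary
`{y₂ = f(y₁)}`, `2π`-periodic in `y₁`, with boundary value `g` on the rough boundary and
finite Dirichlet energy over one period. -/
structure CellSolution (f : ℝ → ℝ) (g : ℝ → ℝ) (β : ℝ → ℝ → ℝ) : Prop where
  cont : ContinuousOn (fun p : ℝ × ℝ => β p.1 p.2) {p : ℝ × ℝ | f p.1 ≤ p.2}
  periodic : ∀ y₁ y₂, β (y₁ + 2 * π) y₂ = β y₁ y₂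
  smooth : ContDiffOn ℝ 2 (fun p : ℝ × ℝ => β p.1 p.2) {p : ℝ × ℝ | f p.1 < p.2}
  harmonic : ∀ p : ℝ × ℝ, f p.1 < p.2 → lap β p.1 p.2 = 0
  bc : ∀ t, β t (f t) = g t
  energy : IntegrableOn (fun p : ℝ × ℝ => gradSq β p.1 p.2)
    {p : ℝ × ℝ | 0 < p.1 ∧ p.1 < 2 * π ∧ f p.1 < p.2}

/-- The average on the fictitious interface `Γ = {y₂ = 0}`. -/
def interfaceAvg (β : ℝ → ℝ → ℝ) : ℝ := (1 / (2 * π)) * ∫ t in (0 : ℝ)..(2 * π), β t 0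

/-- The first-order full boundary-layer approximation
`u^{∞,1}_ε = u^{0,1} + (ε/(1+εβ̄)) (C/2) (β(x/ε) − β̄ x₂)`. -/
def uFull1 (C ε βbar : ℝ) (β : ℝ → ℝ → ℝ) (x y : ℝ) : ℝ :=
  u01 C x y + (ε / (1 + ε * βbar)) * (C / 2) * (β (x / ε) (y / ε) - βbar * y)

section

open MeasureTheory Real Set Filter Topology

noncomputable section

/-! ### Calculus for partial derivatives -/

lemma fb_hasDerivAt1 {v : ℝ → ℝ → ℝ} {x y : ℝ}
    (h : DifferentiableAt ℝ (fun p : ℝ × ℝ => v p.1 p.2) (x, y)) :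
    HasDerivAt (fun t => v t y) (pd1 v x y) x := by
  have : DifferentiableAt ℝ (fun t => v t y) x :=
    DifferentiableAt.comp (f := fun t : ℝ => (t, y)) (g := fun p : ℝ × ℝ => v p.1 p.2) x h
      (by fun_prop)
  exact this.hasDerivAt

lemma fb_hasDerivAt2 {v : ℝ → ℝ → ℝ} {x y : ℝ}
    (h : DifferentiableAt ℝ (fun p : ℝ × ℝ => v p.1 p.2) (x, y)) :
    HasDerivAt (fun t => v x t) (pd2 v x y) y := by
  have : DifferentiableAt ℝ (fun t => v x t) y :=
    DifferentiableAt.comp (f := fun t : ℝ => (x, t)) (g := fun p : ℝ × ℝ => v p.1 p.2) y h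
      (by fun_prop)
  exact this.hasDerivAt

lemma fb_pd1_eq {v : ℝ → ℝ → ℝ} {p : ℝ × ℝ}
    (h : DifferentiableAt ℝ (fun p : ℝ × ℝ => v p.1 p.2) p) :
    pd1 v p.1 p.2 = fderiv ℝ (fun p : ℝ × ℝ => v p.1 p.2) p (1, 0) := by
  have h1 : HasDerivAt (fun t : ℝ => (t, p.2)) ((1 : ℝ), (0 : ℝ)) p.1 :=
    (hasDerivAt_id p.1).prodMk (hasDerivAt_const _ _)
  have h2 := HasFDerivAt.comp_hasDerivAt (f := fun t : ℝ => (t, p.2))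
    (l := fun p : ℝ × ℝ => v p.1 p.2) p.1 h.hasFDerivAt h1
  exact h2.deriv

lemma fb_pd2_eq {v : ℝ → ℝ → ℝ} {p : ℝ × ℝ}
    (h : DifferentiableAt ℝ (fun p : ℝ × ℝ => v p.1 p.2) p) :
    pd2 v p.1 p.2 = fderiv ℝ (fun p : ℝ × ℝ => v p.1 p.2) p (0, 1) := by
  have h1 : HasDerivAt (fun t : ℝ => (p.1, t)) ((0 : ℝ), (1 : ℝ)) p.2 :=
    (hasDerivAt_const _ _).prodMk (hasDerivAt_id p.2)
  have h2 := HasFDerivAt.comp_hasDerivAt (f := fun t : ℝ => (p.1, t))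
    (l := fun p : ℝ × ℝ => v p.1 p.2) p.2 h.hasFDerivAt h1
  exact h2.deriv

lemma fb_cd1 {v : ℝ → ℝ → ℝ} {U : Set (ℝ × ℝ)} (hU : IsOpen U)
    (h : ContDiffOn ℝ 2 (fun p : ℝ × ℝ => v p.1 p.2) U) :
    ContDiffOn ℝ 1 (fun p : ℝ × ℝ => pd1 v p.1 p.2) U := by
  have h1 : ContDiffOn ℝ 1 (fderiv ℝ (fun p : ℝ × ℝ => v p.1 p.2)) U :=
    h.fderiv_of_isOpen hU (by norm_num)
  refine (h1.clm_apply (contDiffOn_const (c := ((1 : ℝ), (0 : ℝ))))).congr fun p hp => ?_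
  exact fb_pd1_eq ((h.differentiableOn (by norm_num)).differentiableAt (hU.mem_nhds hp))

lemma fb_cd2 {v : ℝ → ℝ → ℝ} {U : Set (ℝ × ℝ)} (hU : IsOpen U)
    (h : ContDiffOn ℝ 2 (fun p : ℝ × ℝ => v p.1 p.2) U) :
    ContDiffOn ℝ 1 (fun p : ℝ × ℝ => pd2 v p.1 p.2) U := by
  have h1 : ContDiffOn ℝ 1 (fderiv ℝ (fun p : ℝ × ℝ => v p.1 p.2)) U :=
    h.fderiv_of_isOpen hU (by norm_num)
  refine (h1.clm_apply (contDiffOn_const (c := ((0 : ℝ), (1 : ℝ))))).congr fun p hp => ?_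
  exact fb_pd2_eq ((h.differentiableOn (by norm_num)).differentiableAt (hU.mem_nhds hp))

lemma fb_cont1 {v : ℝ → ℝ → ℝ} {U : Set (ℝ × ℝ)} (hU : IsOpen U)
    (h : ContDiffOn ℝ 1 (fun p : ℝ × ℝ => v p.1 p.2) U) :
    ContinuousOn (fun p : ℝ × ℝ => pd1 v p.1 p.2) U := by
  have h1 : ContDiffOn ℝ 0 (fderiv ℝ (fun p : ℝ × ℝ => v p.1 p.2)) U :=
    h.fderiv_of_isOpen hU (by norm_num)
  refine ContinuousOn.congr
    (h1.clm_apply (contDiffOn_const (c := ((1 : ℝ), (0 : ℝ))))).continuousOn fun p hp => ?_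
  exact fb_pd1_eq ((h.differentiableOn (by norm_num)).differentiableAt (hU.mem_nhds hp))

lemma fb_cont2 {v : ℝ → ℝ → ℝ} {U : Set (ℝ × ℝ)} (hU : IsOpen U)
    (h : ContDiffOn ℝ 1 (fun p : ℝ × ℝ => v p.1 p.2) U) :
    ContinuousOn (fun p : ℝ × ℝ => pd2 v p.1 p.2) U := by
  have h1 : ContDiffOn ℝ 0 (fderiv ℝ (fun p : ℝ × ℝ => v p.1 p.2)) U :=
    h.fderiv_of_isOpen hU (by norm_num)
  refine ContinuousOn.congr
    (h1.clm_apply (contDiffOn_const (c := ((0 : ℝ), (1 : ℝ))))).continuousOn fun p hp => ?_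
  exact fb_pd2_eq ((h.differentiableOn (by norm_num)).differentiableAt (hU.mem_nhds hp))

lemma fb_diffAt {v : ℝ → ℝ → ℝ} {U : Set (ℝ × ℝ)} (hU : IsOpen U) {n : WithTop ℕ∞} (hn : n ≠ 0)
    (h : ContDiffOn ℝ n (fun p : ℝ × ℝ => v p.1 p.2) U) {x y : ℝ} (hp : (x, y) ∈ U) :
    DifferentiableAt ℝ (fun p : ℝ × ℝ => v p.1 p.2) (x, y) :=
  (h.differentiableOn hn).differentiableAt (hU.mem_nhds hp)

lemma fb_lap_cont {v : ℝ → ℝ → ℝ} {U : Set (ℝ × ℝ)} (hU : IsOpen U)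
    (h : ContDiffOn ℝ 2 (fun p : ℝ × ℝ => v p.1 p.2) U) :
    ContinuousOn (fun p : ℝ × ℝ => lap v p.1 p.2) U :=
  (fb_cont1 hU (fb_cd1 hU h)).add (fb_cont2 hU (fb_cd2 hU h))

lemma fb_gradSq_cont {v : ℝ → ℝ → ℝ} {U : Set (ℝ × ℝ)} (hU : IsOpen U)
    (h : ContDiffOn ℝ 2 (fun p : ℝ × ℝ => v p.1 p.2) U) :
    ContinuousOn (fun p : ℝ × ℝ => gradSq v p.1 p.2) U :=
  ((fb_cd1 hU h).continuousOn.pow 2).add ((fb_cd2 hU h).continuousOn.pow 2)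

lemma fb_slice1 {U : Set (ℝ × ℝ)} (hU : IsOpen U) {x y : ℝ} (hp : (x, y) ∈ U) :
    ∀ᶠ t in 𝓝 x, (t, y) ∈ U :=
  (Continuous.tendsto (f := fun t : ℝ => (t, y)) (by fun_prop) x).eventually (hU.mem_nhds hp)

lemma fb_slice2 {U : Set (ℝ × ℝ)} (hU : IsOpen U) {x y : ℝ} (hp : (x, y) ∈ U) :
    ∀ᶠ t in 𝓝 y, (x, t) ∈ U :=
  (Continuous.tendsto (f := fun t : ℝ => (x, t)) (by fun_prop) y).eventually (hU.mem_nhds hp)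

/-- `u - a b - (p₀ + p₁ y + p₂ y²)`. -/
def fbComb (u b : ℝ → ℝ → ℝ) (a p0 p1 p2 : ℝ) (x y : ℝ) : ℝ :=
  u x y - a * b x y - (p0 + p1 * y + p2 * y ^ 2)

section comb
variable {u b : ℝ → ℝ → ℝ} {U : Set (ℝ × ℝ)} (a p0 p1 p2 : ℝ)

lemma fb_comb_cd (hu : ContDiffOn ℝ 2 (fun p : ℝ × ℝ => u p.1 p.2) U)
    (hb : ContDiffOn ℝ 2 (fun p : ℝ × ℝ => b p.1 p.2) U) :
    ContDiffOn ℝ 2 (fun p : ℝ × ℝ => fbComb u b a p0 p1 p2 p.1 p.2) U := by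
  unfold fbComb
  have h3 : ContDiffOn ℝ 2 (fun p : ℝ × ℝ => p0 + p1 * p.2 + p2 * p.2 ^ 2) U := by fun_prop
  exact (hu.sub (contDiffOn_const.mul hb)).sub h3

lemma fb_comb_cont {S : Set (ℝ × ℝ)} (hu : ContinuousOn (fun p : ℝ × ℝ => u p.1 p.2) S)
    (hb : ContinuousOn (fun p : ℝ × ℝ => b p.1 p.2) S) :
    ContinuousOn (fun p : ℝ × ℝ => fbComb u b a p0 p1 p2 p.1 p.2) S := by
  unfold fbComb
  have h3 : ContinuousOn (fun p : ℝ × ℝ => p0 + p1 * p.2 + p2 * p.2 ^ 2) S := by fun_prop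
  exact (hu.sub (continuousOn_const.mul hb)).sub h3

lemma fb_comb_pd1 (hU : IsOpen U) (hu : ContDiffOn ℝ 2 (fun p : ℝ × ℝ => u p.1 p.2) U)
    (hb : ContDiffOn ℝ 2 (fun p : ℝ × ℝ => b p.1 p.2) U) {x y : ℝ} (hp : (x, y) ∈ U) :
    pd1 (fbComb u b a p0 p1 p2) x y = pd1 u x y - a * pd1 b x y := by
  have h1 := fb_hasDerivAt1 (fb_diffAt hU (by norm_num) hu hp)
  have h2 := fb_hasDerivAt1 (fb_diffAt hU (by norm_num) hb hp)
  exact ((h1.sub (h2.const_mul a)).sub_const _).deriv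

lemma fb_comb_pd2 (hU : IsOpen U) (hu : ContDiffOn ℝ 2 (fun p : ℝ × ℝ => u p.1 p.2) U)
    (hb : ContDiffOn ℝ 2 (fun p : ℝ × ℝ => b p.1 p.2) U) {x y : ℝ} (hp : (x, y) ∈ U) :
    pd2 (fbComb u b a p0 p1 p2) x y = pd2 u x y - a * pd2 b x y - (p1 + p2 * (2 * y)) := by
  have h1 := fb_hasDerivAt2 (fb_diffAt hU (by norm_num) hu hp)
  have h2 := fb_hasDerivAt2 (fb_diffAt hU (by norm_num) hb hp)
  have h3 : HasDerivAt (fun t : ℝ => p0 + p1 * t + p2 * t ^ 2) (p1 + p2 * (2 * y)) y := by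
    have := (((hasDerivAt_id y).const_mul p1).const_add p0).add
      (((hasDerivAt_id y).pow 2).const_mul p2)
    refine HasDerivAt.congr_deriv this ?_
    simp
  exact ((h1.sub (h2.const_mul a)).sub h3).deriv

lemma fb_comb_lap (hU : IsOpen U) (hu : ContDiffOn ℝ 2 (fun p : ℝ × ℝ => u p.1 p.2) U)
    (hb : ContDiffOn ℝ 2 (fun p : ℝ × ℝ => b p.1 p.2) U) {x y : ℝ} (hp : (x, y) ∈ U) :
    lap (fbComb u b a p0 p1 p2) x y = lap u x y - a * lap b x y - 2 * p2 := by
  have e1 : (fun t => pd1 (fbComb u b a p0 p1 p2) t y) =ᶠ[𝓝 x]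
      fun t => pd1 u t y - a * pd1 b t y := by
    filter_upwards [fb_slice1 hU hp] with t ht using fb_comb_pd1 a p0 p1 p2 hU hu hb ht
  have e2 : (fun t => pd2 (fbComb u b a p0 p1 p2) x t) =ᶠ[𝓝 y]
      fun t => pd2 u x t - a * pd2 b x t - (p1 + p2 * (2 * t)) := by
    filter_upwards [fb_slice2 hU hp] with t ht using fb_comb_pd2 a p0 p1 p2 hU hu hb ht
  have h1 := fb_hasDerivAt1 (fb_diffAt hU (by norm_num) (fb_cd1 hU hu) hp)
  have h2 := fb_hasDerivAt1 (fb_diffAt hU (by norm_num) (fb_cd1 hU hb) hp)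
  have h3 := fb_hasDerivAt2 (fb_diffAt hU (by norm_num) (fb_cd2 hU hu) hp)
  have h4 := fb_hasDerivAt2 (fb_diffAt hU (by norm_num) (fb_cd2 hU hb) hp)
  have h5 : HasDerivAt (fun t : ℝ => p1 + p2 * (2 * t)) (2 * p2) y := by
    have := (((hasDerivAt_id y).const_mul 2).const_mul p2).const_add p1
    refine HasDerivAt.congr_deriv this ?_
    ring
  have k1 : pd1 (pd1 (fbComb u b a p0 p1 p2)) x y = _ :=
    e1.deriv_eq.trans (h1.sub (h2.const_mul a)).deriv
  have k2 : pd2 (pd2 (fbComb u b a p0 p1 p2)) x y = _ :=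
    e2.deriv_eq.trans ((h3.sub (h4.const_mul a)).sub h5).deriv
  unfold lap
  rw [k1, k2]
  ring

end comb

/-! ### Maximum principle -/

lemma fb_closed_and {α : Type*} [TopologicalSpace α] {p q : α → Prop} (h1 : IsClosed {x | p x})
    (h2 : IsClosed {x | q x}) : IsClosed {x | p x ∧ q x} := h1.inter h2

lemma fb_second_deriv_nonpos {g : ℝ → ℝ} {x : ℝ} (hm : IsLocalMax g x) (hc : ContinuousAt g x) :
    deriv (deriv g) x ≤ 0 := by
  by_contra! h
  have h0 : deriv g x = 0 := hm.deriv_eq_zero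
  have hmin := isLocalMin_of_deriv_deriv_pos h h0 hc
  have heq : g =ᶠ[𝓝 x] fun _ => g x := by
    filter_upwards [hm, hmin] with t h1 h2 using le_antisymm h1 h2
  have : deriv (deriv g) x = 0 := by
    rw [heq.deriv.deriv_eq]; simp
  linarith

lemma fb_maxp {h : ℝ → ℝ → ℝ} {P T M : ℝ} {g : ℝ → ℝ} (hP : 0 < P) (hg : Continuous g)
    (hgp : ∀ x, g (x + P) = g x) (hhp : ∀ x y, h (x + P) y = h x y)
    (hc : ContinuousOn (fun p : ℝ × ℝ => h p.1 p.2) {p : ℝ × ℝ | g p.1 ≤ p.2 ∧ p.2 ≤ T})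
    (hs : ContDiffOn ℝ 2 (fun p : ℝ × ℝ => h p.1 p.2) {p : ℝ × ℝ | g p.1 < p.2 ∧ p.2 < T})
    (hl : ∀ x y, g x < y → y < T → lap h x y = 0)
    (hb : ∀ x, h x (g x) ≤ M) (ht : ∀ x, h x T ≤ M) :
    ∀ x y, g x ≤ y → y ≤ T → h x y ≤ M := by
  set S := {p : ℝ × ℝ | g p.1 ≤ p.2 ∧ p.2 ≤ T} with hS
  set U := {p : ℝ × ℝ | g p.1 < p.2 ∧ p.2 < T} with hUd
  have hU : IsOpen U := by
    refine IsOpen.and (isOpen_lt ?_ ?_) (isOpen_lt ?_ ?_) <;> fun_prop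
  have hSc : IsClosed S := by
    refine fb_closed_and (isClosed_le ?_ ?_) (isClosed_le ?_ ?_) <;> fun_prop
  -- lower bound for g
  have hgP : Function.Periodic g P := hgp
  obtain ⟨m, hm⟩ : ∃ m, ∀ x, m ≤ g x := by
    obtain ⟨m, hm⟩ := (isCompact_Icc (a := (0 : ℝ)) (b := P)).bddBelow_image hg.continuousOn
    refine ⟨m, fun x => ?_⟩
    obtain ⟨y, hy, hxy⟩ := hgP.exists_mem_Ico₀ hP x
    rw [hxy]
    exact hm ⟨y, ⟨hy.1, hy.2.le⟩, rfl⟩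
  set B := m ^ 2 + T ^ 2 with hB
  have hyB : ∀ y, m ≤ y → y ≤ T → y ^ 2 ≤ B := by
    intro y h1 h2
    have : y ^ 2 ≤ max (m ^ 2) (T ^ 2) := by
      rcases le_total 0 y with h | h
      · exact le_max_of_le_right (by nlinarith)
      · exact le_max_of_le_left (by nlinarith)
    exact this.trans (max_le (by rw [hB]; nlinarith [sq_nonneg T]) (by rw [hB]; nlinarith [sq_nonneg m]))
  intro x0 y0 hxy0 hyT0
  suffices H : ∀ κ > 0, h x0 y0 ≤ M + κ * B by
    refine le_of_forall_pos_le_add fun e he => ?_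
    have hB0 : 0 ≤ B := by positivity
    have := H (e / (B + 1)) (by positivity)
    have h2 : e / (B + 1) * B ≤ e := by
      rw [div_mul_eq_mul_div, div_le_iff₀ (by positivity)]; nlinarith
    linarith
  intro κ hκ
  -- compact period piece
  set K := S ∩ {p : ℝ × ℝ | 0 ≤ p.1 ∧ p.1 ≤ P} with hK
  have hKc : IsCompact K := by
    refine (isCompact_Icc (a := ((0 : ℝ), m)) (b := (P, T))).of_isClosed_subset ?_ ?_
    · refine hSc.inter (fb_closed_and (isClosed_le ?_ ?_) (isClosed_le ?_ ?_)) <;> fun_prop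
    · rintro ⟨x, y⟩ ⟨⟨h1, h2⟩, h3, h4⟩
      exact ⟨⟨h3, (hm x).trans h1⟩, ⟨h4, h2⟩⟩
  set F : ℝ × ℝ → ℝ := fun p => h p.1 p.2 + κ * p.2 ^ 2 with hF
  have hFc : ContinuousOn F S := hc.add (by fun_prop)
  have hred : ∀ p ∈ S, ∃ q ∈ K, F p = F q := by
    rintro ⟨x, y⟩ ⟨h1, h2⟩
    obtain ⟨x', hx', hxx⟩ := Function.Periodic.exists_mem_Ico₀
      (f := fun t => (g t, h t y)) (c := P) (fun t => by simp [hgp, hhp]) hP x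
    simp only [Prod.mk.injEq] at hxx
    refine ⟨(x', y), ⟨⟨?_, h2⟩, hx'.1, hx'.2.le⟩, ?_⟩
    · simpa [← hxx.1] using h1
    · simp [hF, hxx.2]
  obtain ⟨q0, hq0, hFq0⟩ := hred (x0, y0) ⟨hxy0, hyT0⟩
  obtain ⟨q, hqK, hqmax⟩ := hKc.exists_isMaxOn ⟨q0, hq0⟩ (hFc.mono inter_subset_left)
  have hmax : ∀ p ∈ S, F p ≤ F q := fun p hp => by
    obtain ⟨r, hr, hpr⟩ := hred p hp
    rw [hpr]; exact hqmax hr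
  have hval : F q ≤ M + κ * B := by
    obtain ⟨x, y⟩ := q
    obtain ⟨⟨h1, h2⟩, h3, h4⟩ := hqK
    simp only at h1 h2 h3 h4
    have hyb := mul_le_mul_of_nonneg_left (hyB y ((hm x).trans h1) h2) hκ.le
    rcases h1.eq_or_lt with e | h1
    · have := hb x; rw [e] at this; simp only [hF]; linarith
    rcases h2.eq_or_lt with e | h2
    · have := ht x; rw [← e] at this; simp only [hF]; linarith
    exfalso
    have hpU : (x, y) ∈ U := ⟨h1, h2⟩
    have hUS : U ⊆ S := fun p hp => ⟨hp.1.le, hp.2.le⟩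
    have hd := fb_diffAt hU (by norm_num) hs hpU
    have c1 : deriv (deriv (fun t => h t y)) x ≤ 0 := by
      refine fb_second_deriv_nonpos ?_ (fb_hasDerivAt1 hd).continuousAt
      filter_upwards [fb_slice1 hU hpU] with t ht
      have := hmax _ (hUS ht)
      simpa [hF] using this
    have c2 : deriv (deriv (fun t => h x t + κ * t ^ 2)) y ≤ 0 := by
      refine fb_second_deriv_nonpos ?_ ?_
      · filter_upwards [fb_slice2 hU hpU] with t ht
        exact hmax _ (hUS ht)
      · exact (fb_hasDerivAt2 hd).continuousAt.add (by fun_prop)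
    have c3 : deriv (deriv (fun t => h x t + κ * t ^ 2)) y = pd2 (pd2 h) x y + 2 * κ := by
      have e : deriv (fun t => h x t + κ * t ^ 2) =ᶠ[𝓝 y] fun t => pd2 h x t + κ * (2 * t) := by
        filter_upwards [fb_slice2 hU hpU] with t ht
        have := (fb_hasDerivAt2 (fb_diffAt hU (by norm_num) hs ht)).add
          (((hasDerivAt_id t).pow 2).const_mul κ)
        refine this.deriv.trans ?_
        simp
      rw [e.deriv_eq]
      have := (fb_hasDerivAt2 (fb_diffAt hU (by norm_num) (fb_cd2 hU hs) hpU)).add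
          (((hasDerivAt_id y).const_mul 2).const_mul κ)
      refine this.deriv.trans ?_
      ring
    have c4 := hl x y h1 h2
    have c5 : pd1 (pd1 h) x y ≤ 0 := c1
    unfold lap at c4
    linarith
  have : F (x0, y0) ≤ M + κ * B := (hmax _ ⟨hxy0, hyT0⟩).trans hval
  have h0 : 0 ≤ κ * y0 ^ 2 := by positivity
  simp only [hF] at this
  linarith

lemma fb_pd1_neg (h : ℝ → ℝ → ℝ) : pd1 (fun x y => -h x y) = fun x y => -pd1 h x y := by
  funext x y; unfold pd1; simp

lemma fb_pd2_neg (h : ℝ → ℝ → ℝ) : pd2 (fun x y => -h x y) = fun x y => -pd2 h x y := by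
  funext x y; unfold pd2; simp

lemma fb_maxp_abs {h : ℝ → ℝ → ℝ} {P T M : ℝ} {g : ℝ → ℝ} (hP : 0 < P) (hg : Continuous g)
    (hgp : ∀ x, g (x + P) = g x) (hhp : ∀ x y, h (x + P) y = h x y)
    (hc : ContinuousOn (fun p : ℝ × ℝ => h p.1 p.2) {p : ℝ × ℝ | g p.1 ≤ p.2 ∧ p.2 ≤ T})
    (hs : ContDiffOn ℝ 2 (fun p : ℝ × ℝ => h p.1 p.2) {p : ℝ × ℝ | g p.1 < p.2 ∧ p.2 < T})
    (hl : ∀ x y, g x < y → y < T → lap h x y = 0)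
    (hb : ∀ x, |h x (g x)| ≤ M) (ht : ∀ x, |h x T| ≤ M) :
    ∀ x y, g x ≤ y → y ≤ T → |h x y| ≤ M := by
  intro x y h1 h2
  refine abs_le'.2 ⟨fb_maxp hP hg hgp hhp hc hs hl (fun x => (le_abs_self _).trans (hb x))
    (fun x => (le_abs_self _).trans (ht x)) x y h1 h2, ?_⟩
  refine fb_maxp (h := fun x y => -h x y) hP hg hgp (by simp [hhp]) hc.neg hs.neg ?_
    (fun x => (neg_le_abs _).trans (hb x))
    (fun x => (neg_le_abs _).trans (ht x)) x y h1 h2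
  intro x y h1 h2
  have := hl x y h1 h2
  unfold lap at *
  rw [fb_pd1_neg, fb_pd2_neg, fb_pd1_neg, fb_pd2_neg]
  linarith

end

end

section

open MeasureTheory Real Set Filter Topology

noncomputable section

/-! ### Cutoffs and the Caccioppoli inequality -/

lemma fb_countable_simple_zeros (g : ℝ → ℝ) :
    {t : ℝ | g t = 0 ∧ ∃ c, c ≠ 0 ∧ HasDerivAt g c t}.Countable := by
  set s := {t : ℝ | g t = 0 ∧ ∃ c, c ≠ 0 ∧ HasDerivAt g c t} with hs
  refine (countable_setOfPred_isolated_right_within (s := s)).mono ?_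
  intro t ht
  refine ⟨ht, ?_⟩
  obtain ⟨h0, c, hc, hd⟩ := ht
  have h1 : ∀ᶠ z in 𝓝[≠] t, g z ≠ 0 := hd.eventually_ne hc
  have h2 : ∀ᶠ z in 𝓝[s ∩ Ioi t] t, g z ≠ 0 :=
    h1.filter_mono (nhdsWithin_mono _ fun z hz => (ne_of_gt hz.2 : z ≠ t))
  have h3 : ∀ᶠ z in 𝓝[s ∩ Ioi t] t, g z = 0 := by
    filter_upwards [self_mem_nhdsWithin] with z hz using hz.1.1
  have h4 : ∀ᶠ z in 𝓝[s ∩ Ioi t] t, False := by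
    filter_upwards [h2, h3] with z a b using a b
  exact eventually_false_iff_eq_bot.1 h4

lemma fb_meas_zero_set {V G : ℝ × ℝ → ℝ} {U : Set (ℝ × ℝ)} (hU : IsOpen U)
    (hV : ContinuousOn V U) (hG : ContinuousOn G U) :
    MeasurableSet {p | p ∈ U ∧ V p = 0 ∧ G p ≠ 0} := by
  have h1 : IsOpen (U ∩ G ⁻¹' {0}ᶜ) := hG.isOpen_inter_preimage hU isOpen_compl_singleton
  have h2 : IsOpen (U ∩ V ⁻¹' {0}ᶜ) := hV.isOpen_inter_preimage hU isOpen_compl_singleton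
  have : {p | p ∈ U ∧ V p = 0 ∧ G p ≠ 0} = (U ∩ G ⁻¹' {0}ᶜ) \ (U ∩ V ⁻¹' {0}ᶜ) := by
    ext p; simp; tauto
  rw [this]
  exact h1.measurableSet.diff h2.measurableSet

lemma fb_null {v : ℝ → ℝ → ℝ} {U : Set (ℝ × ℝ)} (hU : IsOpen U)
    (h : ContDiffOn ℝ 2 (fun p : ℝ × ℝ => v p.1 p.2) U) :
    ∀ᵐ p : ℝ × ℝ, p ∈ U → v p.1 p.2 = 0 → gradSq v p.1 p.2 = 0 := by
  have m1 := fb_meas_zero_set hU h.continuousOn (fb_cd1 hU h).continuousOn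
  have m2 := fb_meas_zero_set hU h.continuousOn (fb_cd2 hU h).continuousOn
  have n1 : (volume : Measure (ℝ × ℝ)) {p | p ∈ U ∧ v p.1 p.2 = 0 ∧ pd1 v p.1 p.2 ≠ 0} = 0 := by
    rw [Measure.volume_eq_prod, Measure.prod_apply_symm m1]
    refine (lintegral_congr fun y => ?_).trans lintegral_zero
    refine Set.Countable.measure_zero ?_ _
    refine (fb_countable_simple_zeros (fun t => v t y)).mono ?_
    rintro x ⟨hx, h0, hn⟩
    exact ⟨h0, _, hn, fb_hasDerivAt1 (fb_diffAt hU (by norm_num) h hx)⟩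
  have n2 : (volume : Measure (ℝ × ℝ)) {p | p ∈ U ∧ v p.1 p.2 = 0 ∧ pd2 v p.1 p.2 ≠ 0} = 0 := by
    rw [Measure.volume_eq_prod, Measure.prod_apply m2]
    refine (lintegral_congr fun x => ?_).trans lintegral_zero
    refine Set.Countable.measure_zero ?_ _
    refine (fb_countable_simple_zeros (fun t => v x t)).mono ?_
    rintro y ⟨hx, h0, hn⟩
    exact ⟨h0, _, hn, fb_hasDerivAt2 (fb_diffAt hU (by norm_num) h hx)⟩
  filter_upwards [measure_eq_zero_iff_ae_notMem.1 n1, measure_eq_zero_iff_ae_notMem.1 n2]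
    with p h1 h2 hp h0
  have e1 : pd1 v p.1 p.2 = 0 := by by_contra hn; exact h1 ⟨hp, h0, hn⟩
  have e2 : pd2 v p.1 p.2 = 0 := by by_contra hn; exact h2 ⟨hp, h0, hn⟩
  simp [gradSq, e1, e2]

lemma fb_ext_zero {U A : Set (ℝ × ℝ)} (hA : IsClosed A) (hAU : A ⊆ U) {G : ℝ × ℝ → ℝ}
    (h0 : ∀ p ∈ U, p ∉ A → G p = 0) {p : ℝ × ℝ} (hp : p ∉ U) :
    U.indicator G =ᶠ[𝓝 p] fun _ => 0 := by
  filter_upwards [hA.isOpen_compl.mem_nhds (fun h => hp (hAU h) : p ∈ Aᶜ)] with q hq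
  by_cases h : q ∈ U
  · rw [indicator_of_mem h, h0 q h hq]
  · rw [indicator_of_notMem h]

lemma fb_ext_eq {U : Set (ℝ × ℝ)} (hU : IsOpen U) {G : ℝ × ℝ → ℝ} {p : ℝ × ℝ} (hp : p ∈ U) :
    U.indicator G =ᶠ[𝓝 p] G := by
  filter_upwards [hU.mem_nhds hp] with q hq using indicator_of_mem hq G

lemma fb_ext_contDiff {U A : Set (ℝ × ℝ)} (hU : IsOpen U) (hA : IsClosed A) (hAU : A ⊆ U)
    {G : ℝ × ℝ → ℝ} (h0 : ∀ p ∈ U, p ∉ A → G p = 0) {n : WithTop ℕ∞} (hG : ContDiffOn ℝ n G U) :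
    ContDiff ℝ n (U.indicator G) := by
  refine contDiff_iff_contDiffAt.2 fun p => ?_
  by_cases hp : p ∈ U
  · exact (hG.contDiffAt (hU.mem_nhds hp)).congr_of_eventuallyEq (fb_ext_eq hU hp)
  · exact contDiffAt_const.congr_of_eventuallyEq (fb_ext_zero hA hAU h0 hp)

lemma fb_trans_deriv_bound : ∃ D > 0, ∀ t, deriv smoothTransition t ≤ D := by
  have hc : Continuous (deriv smoothTransition) :=
    (smoothTransition.contDiff (n := 1)).continuous_deriv (by norm_num)
  obtain ⟨D, hD⟩ := (isCompact_Icc (a := (0 : ℝ)) (b := 1)).bddAbove_image hc.continuousOn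
  refine ⟨max D 1, by positivity, fun t => ?_⟩
  by_cases h0 : t < 0
  · have : smoothTransition =ᶠ[𝓝 t] fun _ => 0 := by
      filter_upwards [gt_mem_nhds h0] with s hs using smoothTransition.zero_of_nonpos hs.le
    rw [this.deriv_eq]; simp
  by_cases h1 : 1 < t
  · have : smoothTransition =ᶠ[𝓝 t] fun _ => 1 := by
      filter_upwards [lt_mem_nhds h1] with s hs using smoothTransition.one_of_one_le hs.le
    rw [this.deriv_eq]; simp
  · exact (hD ⟨t, ⟨not_lt.1 h0, not_lt.1 h1⟩, rfl⟩).trans (le_max_left _ _)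

/-- The cutoff in the vertical variable. -/
lemma fb_cutoff : ∃ D > 0, ∀ a b c d : ℝ, a < b → b ≤ c → c < d →
    ∃ χ ρ : ℝ → ℝ, ContDiff ℝ 2 χ ∧ Continuous ρ ∧ (∀ y, 0 ≤ χ y) ∧ (∀ y, χ y ≤ 1) ∧
      (∀ y, b ≤ y → y ≤ c → χ y = 1) ∧ (∀ y, y ≤ a → χ y = 0) ∧ (∀ y, d ≤ y → χ y = 0) ∧
      (∀ y, (deriv χ y) ^ 2 ≤ ρ y) ∧
      ∫ y in a..d, ρ y = D * (1 / (b - a) + 1 / (d - c)) := by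
  obtain ⟨D, hD0, hD⟩ := fb_trans_deriv_bound
  have hτ : ContDiff ℝ 2 smoothTransition := smoothTransition.contDiff (n := 2)
  have hτd : Differentiable ℝ smoothTransition := hτ.differentiable (by norm_num)
  have hτc : Continuous (deriv smoothTransition) := hτ.continuous_deriv (by norm_num)
  have hτn : ∀ t, 0 ≤ deriv smoothTransition t := fun t => smoothTransition.monotone.deriv_nonneg
  refine ⟨2 * D, by positivity, fun a b c d hab hbc hcd => ?_⟩
  have h1 : 0 < b - a := by linarith
  have h2 : 0 < d - c := by linarith
  set l1 : ℝ → ℝ := fun y => (y - a) / (b - a) with hl1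
  set l2 : ℝ → ℝ := fun y => (d - y) / (d - c) with hl2
  have hl1d : ∀ y, HasDerivAt (fun y => smoothTransition (l1 y))
      (deriv smoothTransition (l1 y) * (1 / (b - a))) y := fun y =>
    (hτd (l1 y)).hasDerivAt.comp y (((hasDerivAt_id y).sub_const a).div_const (b - a))
  have hl2d : ∀ y, HasDerivAt (fun y => smoothTransition (l2 y))
      (deriv smoothTransition (l2 y) * (-1 / (d - c))) y := fun y =>
    (hτd (l2 y)).hasDerivAt.comp y (((hasDerivAt_id y).const_sub d).div_const (d - c))
  have hχd : ∀ y, HasDerivAt (fun y => smoothTransition (l1 y) * smoothTransition (l2 y))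
      (deriv smoothTransition (l1 y) * (1 / (b - a)) * smoothTransition (l2 y)
        + smoothTransition (l1 y) * (deriv smoothTransition (l2 y) * (-1 / (d - c)))) y :=
    fun y => (hl1d y).mul (hl2d y)
  set ρ : ℝ → ℝ := fun y => 2 * D * (deriv smoothTransition (l1 y) * (1 / (b - a)) * (1 / (b - a))
    - deriv smoothTransition (l2 y) * (-1 / (d - c)) * (1 / (d - c))) with hρ
  have hl1c : Continuous l1 := by rw [hl1]; fun_prop
  have hl2c : Continuous l2 := by rw [hl2]; fun_prop
  have hρc : Continuous ρ := by
    rw [hρ]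
    have := hτc.comp hl1c
    have := hτc.comp hl2c
    fun_prop
  refine ⟨fun y => smoothTransition (l1 y) * smoothTransition (l2 y), ρ, ?_, hρc, ?_, ?_, ?_, ?_,
    ?_, ?_, ?_⟩
  · have e1 : ContDiff ℝ 2 l1 := by rw [hl1]; fun_prop
    have e2 : ContDiff ℝ 2 l2 := by rw [hl2]; fun_prop
    exact (hτ.comp e1).mul (hτ.comp e2)
  · exact fun y => mul_nonneg (smoothTransition.nonneg _) (smoothTransition.nonneg _)
  · exact fun y => mul_le_one₀ (smoothTransition.le_one _) (smoothTransition.nonneg _)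
      (smoothTransition.le_one _)
  · intro y hb hc
    have k1 : 1 ≤ l1 y := by rw [hl1]; simp only; rw [le_div_iff₀ h1]; linarith
    have k2 : 1 ≤ l2 y := by rw [hl2]; simp only; rw [le_div_iff₀ h2]; linarith
    simp [smoothTransition.one_of_one_le k1, smoothTransition.one_of_one_le k2]
  · intro y hy
    have k1 : l1 y ≤ 0 := div_nonpos_of_nonpos_of_nonneg (by linarith) h1.le
    simp [smoothTransition.zero_of_nonpos k1]
  · intro y hy
    have k1 : l2 y ≤ 0 := div_nonpos_of_nonpos_of_nonneg (by linarith) h2.le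
    simp [smoothTransition.zero_of_nonpos k1]
  · intro y
    rw [(hχd y).deriv, hρ]
    simp only
    have p1 := hτn (l1 y)
    have p2 := hτn (l2 y)
    have q1 := hD (l1 y)
    have q2 := hD (l2 y)
    have t1 := smoothTransition.nonneg (l1 y)
    have t2 := smoothTransition.nonneg (l2 y)
    have s1 := smoothTransition.le_one (l1 y)
    have s2 := smoothTransition.le_one (l2 y)
    generalize deriv smoothTransition (l1 y) = A at *
    generalize deriv smoothTransition (l2 y) = B at *
    generalize smoothTransition (l1 y) = X at *
    generalize smoothTransition (l2 y) = Y at *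
    have i1 : 0 < 1 / (b - a) := by positivity
    have i2 : 0 < 1 / (d - c) := by positivity
    have e : -1 / (d - c) = - (1 / (d - c)) := by ring
    rw [e]
    generalize 1 / (b - a) = r at *
    generalize 1 / (d - c) = w at *
    have z1 : (A * r * Y) ^ 2 ≤ D * (A * r * r) := by
      have y2 : Y ^ 2 ≤ 1 := by nlinarith
      have a2 : A ^ 2 ≤ D * A := by nlinarith
      calc (A * r * Y) ^ 2 = A ^ 2 * r ^ 2 * Y ^ 2 := by ring
        _ ≤ A ^ 2 * r ^ 2 * 1 := by gcongr
        _ ≤ D * A * r ^ 2 * 1 := by gcongr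
        _ = _ := by ring
    have z2 : (B * w * X) ^ 2 ≤ D * (B * w * w) := by
      have y2 : X ^ 2 ≤ 1 := by nlinarith
      have a2 : B ^ 2 ≤ D * B := by nlinarith
      calc (B * w * X) ^ 2 = B ^ 2 * w ^ 2 * X ^ 2 := by ring
        _ ≤ B ^ 2 * w ^ 2 * 1 := by gcongr
        _ ≤ D * B * w ^ 2 * 1 := by gcongr
        _ = _ := by ring
    nlinarith [sq_nonneg (A * r * Y + B * w * X)]
  · have hR : ∀ y, HasDerivAt (fun y => 2 * D * (smoothTransition (l1 y) * (1 / (b - a))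
        - smoothTransition (l2 y) * (1 / (d - c)))) (ρ y) y := fun y =>
      (((hl1d y).mul_const _).sub ((hl2d y).mul_const _)).const_mul _
    rw [intervalIntegral.integral_eq_sub_of_hasDerivAt (fun y _ => hR y)
      (hρc.intervalIntegrable _ _)]
    have k1 : 1 ≤ l1 d := by rw [hl1]; simp only; rw [le_div_iff₀ h1]; linarith
    have k2 : 1 ≤ l2 a := by rw [hl2]; simp only; rw [le_div_iff₀ h2]; linarith
    have k3 : l1 a ≤ 0 := by simp [hl1]
    have k4 : l2 d ≤ 0 := by simp [hl2]
    rw [smoothTransition.one_of_one_le k1, smoothTransition.one_of_one_le k2,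
      smoothTransition.zero_of_nonpos k3, smoothTransition.zero_of_nonpos k4]
    ring

/-- The truncated identity. -/
lemma fb_trunc (η : ℝ) (hη : 0 < η) : ∃ φ τ : ℝ → ℝ, ContDiff ℝ 2 φ ∧ Continuous τ ∧
    (∀ s, φ s = s * τ s) ∧ (∀ s, 0 ≤ τ s) ∧ (∀ s, τ s ≤ 1) ∧ (∀ s, τ s ≤ deriv φ s) ∧
    (∀ s, |s| < η → τ s = 0) ∧ (∀ s, 2 * η ≤ |s| → τ s = 1) := by
  have hT : ContDiff ℝ 2 smoothTransition := smoothTransition.contDiff (n := 2)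
  have hTd : Differentiable ℝ smoothTransition := hT.differentiable (by norm_num)
  set l : ℝ → ℝ := fun s => s ^ 2 / η ^ 2 - 1 with hl
  have hlc : ContDiff ℝ 2 l := by rw [hl]; fun_prop
  have hld : ∀ s, HasDerivAt l (2 * s / η ^ 2) s := fun s => by
    have := (((hasDerivAt_id s).pow 2).div_const (η ^ 2)).sub_const 1
    refine HasDerivAt.congr_deriv this ?_
    simp
  refine ⟨fun s => s * smoothTransition (l s), fun s => smoothTransition (l s),
    contDiff_id.mul (hT.comp hlc), (hT.comp hlc).continuous, fun s => rfl,
    fun s => smoothTransition.nonneg _, fun s => smoothTransition.le_one _, ?_, ?_, ?_⟩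
  · intro s
    have h1 := (hasDerivAt_id s).mul ((hTd (l s)).hasDerivAt.comp s (hld s))
    have h2 : deriv (fun s => s * smoothTransition (l s)) s = _ := h1.deriv
    rw [h2]
    have h3 : 0 ≤ deriv smoothTransition (l s) := smoothTransition.monotone.deriv_nonneg
    have h4 : 0 ≤ deriv smoothTransition (l s) * (2 * s ^ 2 / η ^ 2) := by positivity
    have : id s * (deriv smoothTransition (l s) * (2 * s / η ^ 2))
      = deriv smoothTransition (l s) * (2 * s ^ 2 / η ^ 2) := by simp only [id]; ring
    rw [this]
    simp only [one_mul, Function.comp]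
    linarith
  · intro s hs
    refine smoothTransition.zero_of_nonpos ?_
    have : s ^ 2 ≤ η ^ 2 := sq_le_sq' (by linarith [(abs_lt.1 hs).1]) (abs_lt.1 hs).2.le
    rw [hl]; simp only
    have : s ^ 2 / η ^ 2 ≤ 1 := (div_le_one (by positivity)).2 this
    linarith
  · intro s hs
    refine smoothTransition.one_of_one_le ?_
    have : (2 * η) ^ 2 ≤ s ^ 2 := by rw [← sq_abs s]; gcongr
    rw [hl]; simp only
    have : 2 ≤ s ^ 2 / η ^ 2 := by rw [le_div_iff₀ (by positivity)]; nlinarith [sq_nonneg η]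
    linarith

end

end

section

open MeasureTheory Real Set Filter Topology

noncomputable section

lemma fb_box_meas (P b c : ℝ) :
    MeasurableSet {p : ℝ × ℝ | 0 < p.1 ∧ p.1 < P ∧ b ≤ p.2 ∧ p.2 ≤ c} := by
  have h1 : MeasurableSet {p : ℝ × ℝ | 0 < p.1} := measurableSet_lt (by fun_prop) (by fun_prop)
  have h2 : MeasurableSet {p : ℝ × ℝ | p.1 < P} := measurableSet_lt (by fun_prop) (by fun_prop)
  have h3 : MeasurableSet {p : ℝ × ℝ | b ≤ p.2} := measurableSet_le (by fun_prop) (by fun_prop)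
  have h4 : MeasurableSet {p : ℝ × ℝ | p.2 ≤ c} := measurableSet_le (by fun_prop) (by fun_prop)
  exact h1.inter (h2.inter (h3.inter h4))

lemma fb_integral_strip {P a d : ℝ} (hP : 0 < P) (had : a ≤ d) {r : ℝ → ℝ} :
    ∫ p in Icc ((0 : ℝ), a) (P, d), r p.2 = P * ∫ y in a..d, r y := by
  rw [← Icc_prod_Icc, Measure.volume_eq_prod]
  have := setIntegral_prod_mul (μ := (volume : Measure ℝ)) (ν := (volume : Measure ℝ))
    (fun _ : ℝ => (1 : ℝ)) r (Icc 0 P) (Icc a d)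
  simp only [one_mul] at this
  rw [this, intervalIntegral.integral_of_le had, integral_Icc_eq_integral_Ioc (f := r)]
  simp [hP.le]

set_option maxHeartbeats 1000000 in
/-- One-step Caccioppoli inequality with truncation. -/
lemma fb_cacc_eta : ∃ κ > 0, ∀ (v : ℝ → ℝ → ℝ) (U S : Set (ℝ × ℝ)) (P a b c d s M : ℝ), 0 < P →
    IsOpen U → IsClosed S → U ⊆ S →
    ContinuousOn (fun p : ℝ × ℝ => v p.1 p.2) S → ContDiffOn ℝ 2 (fun p : ℝ × ℝ => v p.1 p.2) U →
    (∀ x y, v (x + P) y = v x y) → (∀ x y, (x + P, y) ∈ U ↔ (x, y) ∈ U) →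
    (∀ x y, (x, y) ∈ U → lap v x y = -s) →
    (∀ x y, (x, y) ∈ S → (x, y) ∉ U → a ≤ y → y ≤ d → v x y = 0) →
    a < b → b ≤ c → c < d →
    (∀ x y, (x, y) ∈ U → a ≤ y → y ≤ d → |v x y| ≤ M) → 0 ≤ M → ∀ η > 0,
    ∃ τ : ℝ → ℝ, Continuous τ ∧ (∀ s, 0 ≤ τ s) ∧ (∀ s, 2 * η ≤ |s| → τ s = 1) ∧
    ∫⁻ p in U ∩ {p : ℝ × ℝ | 0 < p.1 ∧ p.1 < P ∧ b ≤ p.2 ∧ p.2 ≤ c},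
        ENNReal.ofReal (τ (v p.1 p.2) * gradSq v p.1 p.2)
      ≤ ENNReal.ofReal
        (P * (2 * |s| * M * (d - a) + κ * M ^ 2 * (1 / (b - a) + 1 / (d - c)))) := by
  obtain ⟨D, hD0, hD⟩ := fb_cutoff
  refine ⟨4 * D, by positivity, ?_⟩
  intro v U S P a b c d s M hP hU hS hUS hvS hv hvp hUp hlap hbd hab hbc hcd hM hM0 η hη
  obtain ⟨χ, ρ, hχ, hρ, hχ0, hχ1, hχbc, hχa, hχd, hχρ, hρi⟩ := hD a b c d hab hbc hcd
  obtain ⟨φ, τ, hφ, hτ, hφτ, hτ0, hτ1, hτφ, hτs, hτl⟩ := fb_trunc η hη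
  refine ⟨τ, hτ, hτ0, hτl, ?_⟩
  set V : ℝ × ℝ → ℝ := fun p => v p.1 p.2 with hV
  have had : a < d := by linarith
  -- the closed set
  set A : Set (ℝ × ℝ) := S ∩ {p : ℝ × ℝ | a ≤ p.2 ∧ p.2 ≤ d} ∩ V ⁻¹' {t | η ≤ |t|} with hAdef
  have hA : IsClosed A := by
    have h1 : IsClosed (S ∩ {p : ℝ × ℝ | a ≤ p.2 ∧ p.2 ≤ d}) := by
      refine hS.inter (fb_closed_and (isClosed_le ?_ ?_) (isClosed_le ?_ ?_)) <;> fun_prop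
    refine (hvS.mono inter_subset_left).preimage_isClosed_of_isClosed h1 ?_
    exact isClosed_le (by fun_prop) (by fun_prop)
  have hAU : A ⊆ U := by
    rintro ⟨x, y⟩ ⟨⟨h1, h2, h3⟩, h4⟩
    by_contra hn
    have := hbd x y h1 hn h2 h3
    simp only [hV, mem_preimage, mem_ofPred_eq, this, abs_zero] at h4
    linarith
  have hzero : ∀ p ∈ U, p ∉ A → χ p.2 = 0 ∨ τ (V p) = 0 := by
    intro p hp hpA
    by_cases h1 : a ≤ p.2
    · by_cases h2 : p.2 ≤ d
      · right
        refine hτs _ ?_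
        by_contra! hn
        exact hpA ⟨⟨hUS hp, h1, h2⟩, hn⟩
      · left; exact hχd _ (not_le.1 h2).le
    · left; exact hχa _ (not_le.1 h1).le
  -- the fields
  set G1 : ℝ × ℝ → ℝ := fun p => χ p.2 ^ 2 * φ (V p) * pd1 v p.1 p.2 with hG1
  set G2 : ℝ × ℝ → ℝ := fun p => χ p.2 ^ 2 * φ (V p) * pd2 v p.1 p.2 with hG2
  set Q : ℝ × ℝ → ℝ := fun p => χ p.2 ^ 2 * τ (V p) * gradSq v p.1 p.2 with hQ
  have z1 : ∀ p ∈ U, p ∉ A → G1 p = 0 := fun p hp hpA => by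
    rcases hzero p hp hpA with h | h <;> simp [hG1, hφτ, h]
  have z2 : ∀ p ∈ U, p ∉ A → G2 p = 0 := fun p hp hpA => by
    rcases hzero p hp hpA with h | h <;> simp [hG2, hφτ, h]
  have zQ : ∀ p ∈ U, p ∉ A → Q p = 0 := fun p hp hpA => by
    rcases hzero p hp hpA with h | h <;> simp [hQ, h]
  have hχ2 : ContDiffOn ℝ 1 (fun p : ℝ × ℝ => χ p.2 ^ 2) U :=
    (((hχ.of_le (by norm_num)).comp contDiff_snd).pow 2).contDiffOn
  have hφV : ContDiffOn ℝ 1 (fun p : ℝ × ℝ => φ (V p)) U :=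
    (hφ.of_le (by norm_num)).comp_contDiffOn (hv.of_le (by norm_num))
  have cG1 : ContDiffOn ℝ 1 G1 U := (hχ2.mul hφV).mul (fb_cd1 hU hv)
  have cG2 : ContDiffOn ℝ 1 G2 U := (hχ2.mul hφV).mul (fb_cd2 hU hv)
  have cQ : ContinuousOn Q U :=
    (hχ2.continuousOn.mul (hτ.comp_continuousOn hv.continuousOn)).mul (fb_gradSq_cont hU hv)
  set F1 : ℝ × ℝ → ℝ := U.indicator G1 with hF1
  set F2 : ℝ × ℝ → ℝ := U.indicator G2 with hF2
  set FQ : ℝ × ℝ → ℝ := U.indicator Q with hFQ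
  have dF1 : ContDiff ℝ 1 F1 := fb_ext_contDiff hU hA hAU z1 cG1
  have dF2 : ContDiff ℝ 1 F2 := fb_ext_contDiff hU hA hAU z2 cG2
  have dFQ : Continuous FQ :=
    (fb_ext_contDiff hU hA hAU zQ (n := 0) (contDiffOn_zero.2 cQ)).continuous
  have hpd1p : ∀ y, pd1 v P y = pd1 v 0 y := by
    intro y
    unfold pd1
    have := deriv_comp_add_const (fun t => v t y) P 0
    simp only [hvp, zero_add] at this
    exact this.symm
  have hdiv := integral_divergence_prod_Icc_of_hasFDerivAt_of_le F1 F2 (fderiv ℝ F1) (fderiv ℝ F2)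
    (0, a) (P, d) ⟨hP.le, had.le⟩ dF1.continuous.continuousOn dF2.continuous.continuousOn
    (fun x _ => (dF1.differentiable (by norm_num) x).hasFDerivAt)
    (fun x _ => (dF2.differentiable (by norm_num) x).hasFDerivAt)
    (by
      refine Continuous.integrableOn_Icc ?_
      have e1 := dF1.continuous_fderiv (by norm_num)
      have e2 := dF2.continuous_fderiv (by norm_num)
      fun_prop)
  have b1 : ∀ x, F2 (x, d) = 0 := fun x => by
    by_cases h : (x, d) ∈ U
    · rw [hF2, indicator_of_mem h, hG2]; simp [hχd d le_rfl]
    · rw [hF2, indicator_of_notMem h]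
  have b2 : ∀ x, F2 (x, a) = 0 := fun x => by
    by_cases h : (x, a) ∈ U
    · rw [hF2, indicator_of_mem h, hG2]; simp [hχa a le_rfl]
    · rw [hF2, indicator_of_notMem h]
  have b3 : ∀ y, F1 (P, y) = F1 (0, y) := fun y => by
    have hm : (P, y) ∈ U ↔ ((0 : ℝ), y) ∈ U := by simpa using hUp 0 y
    have hvv : v P y = v 0 y := by simpa using hvp 0 y
    by_cases h : ((0 : ℝ), y) ∈ U
    · rw [hF1, indicator_of_mem h, indicator_of_mem (hm.2 h), hG1]
      simp only [hV, hvv, hpd1p]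
    · rw [hF1, indicator_of_notMem h, indicator_of_notMem (fun h' => h (hm.1 h'))]
  have hdiv0 : ∫ x in Icc ((0 : ℝ), a) (P, d), (fderiv ℝ F1 x (1, 0) + fderiv ℝ F2 x (0, 1)) = 0 := by
    rw [hdiv]; simp [b1, b2, b3]
  -- pointwise inequality
  have hpt : ∀ p ∈ Icc ((0 : ℝ), a) (P, d),
      FQ p ≤ 2 * (fderiv ℝ F1 p (1, 0) + fderiv ℝ F2 p (0, 1))
        + (2 * |s| * M + 4 * M ^ 2 * ρ p.2) := by
    intro p hp
    have hy1 : a ≤ p.2 := hp.1.2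
    have hy2 : p.2 ≤ d := hp.2.2
    have hρ0 : 0 ≤ ρ p.2 := (sq_nonneg _).trans (hχρ _)
    by_cases hpU : p ∈ U
    · obtain ⟨x, y⟩ := p
      simp only at hy1 hy2 hρ0
      have f1 := fb_pd1_eq (v := fun x y => F1 (x, y)) (p := (x, y))
        (dF1.differentiable (by norm_num) (x, y))
      have f2 := fb_pd2_eq (v := fun x y => F2 (x, y)) (p := (x, y))
        (dF2.differentiable (by norm_num) (x, y))
      simp only [Prod.mk.eta] at f1 f2
      change _ = fderiv ℝ F1 (x, y) (1, 0) at f1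
      change _ = fderiv ℝ F2 (x, y) (0, 1) at f2
      have hv1 := fb_hasDerivAt1 (fb_diffAt hU (by norm_num) hv hpU)
      have hv2 := fb_hasDerivAt2 (fb_diffAt hU (by norm_num) hv hpU)
      have hv11 := fb_hasDerivAt1 (fb_diffAt hU (by norm_num) (fb_cd1 hU hv) hpU)
      have hv22 := fb_hasDerivAt2 (fb_diffAt hU (by norm_num) (fb_cd2 hU hv) hpU)
      have hφd := (hφ.differentiable (by norm_num) (v x y)).hasDerivAt
      have hχdd := (hχ.differentiable (by norm_num) y).hasDerivAt
      have g1 : HasDerivAt (fun t => G1 (t, y)) _ x :=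
        ((hφd.comp x hv1).const_mul (χ y ^ 2)).mul hv11
      have g2 : HasDerivAt (fun t => G2 (x, t)) _ y :=
        ((hχdd.pow 2).mul (hφd.comp y hv2)).mul hv22
      have e1 : (fun t => F1 (t, y)) =ᶠ[𝓝 x] fun t => G1 (t, y) := by
        filter_upwards [fb_slice1 hU hpU] with t ht using indicator_of_mem ht _
      have e2 : (fun t => F2 (x, t)) =ᶠ[𝓝 y] fun t => G2 (x, t) := by
        filter_upwards [fb_slice2 hU hpU] with t ht using indicator_of_mem ht _
      have k1 : fderiv ℝ F1 (x, y) (1, 0) = _ := f1.symm.trans (e1.deriv_eq.trans g1.deriv)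
      have k2 : fderiv ℝ F2 (x, y) (0, 1) = _ := f2.symm.trans (e2.deriv_eq.trans g2.deriv)
      rw [k1, k2, hFQ, indicator_of_mem hpU, hQ]
      simp only [Function.comp, hφτ, hV, gradSq, Pi.pow_apply, Pi.mul_apply]
      have hl := hlap x y hpU
      unfold lap at hl
      have hMv := hM x y hpU hy1 hy2
      have hχρy := hχρ y
      have c0 := hχ0 y
      have c1 := hχ1 y
      have t0 := hτ0 (v x y)
      have t1 := hτ1 (v x y)
      have tφ := hτφ (v x y)
      generalize pd1 (pd1 v) x y = v11 at *
      generalize pd2 (pd2 v) x y = v22 at *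
      generalize pd1 v x y = v1 at *
      generalize pd2 v x y = v2 at *
      generalize deriv φ (v x y) = dφ at *
      generalize deriv χ y = dχ at *
      generalize χ y = X at *
      generalize ρ y = r at *
      generalize τ (v x y) = t at *
      generalize v x y = w at *
      have hv22' : v22 = -s - v11 := by linarith
      subst hv22'
      have i1 : 0 ≤ X ^ 2 * (dφ - t) * (v1 ^ 2 + v2 ^ 2) := by
        have : 0 ≤ dφ - t := by linarith
        positivity
      have i2 : 0 ≤ t * (X * v2 + 2 * dχ * w) ^ 2 := by positivity
      have i3 : X ^ 2 * (w * t) * s ≤ |s| * M := by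
        have : |X ^ 2 * (w * t) * s| ≤ 1 * (M * 1) * |s| := by
          rw [abs_mul, abs_mul, abs_mul, abs_of_nonneg (sq_nonneg X), abs_of_nonneg t0]
          gcongr
          nlinarith
        have := (le_abs_self _).trans this
        linarith
      have hw2 : w ^ 2 ≤ M ^ 2 := by rw [← sq_abs w]; gcongr
      have i4 : t * dχ ^ 2 * w ^ 2 ≤ M ^ 2 * r := by
        calc t * dχ ^ 2 * w ^ 2 ≤ 1 * r * M ^ 2 := by gcongr
          _ = _ := by ring
      have i5 : 0 ≤ t * X ^ 2 * v1 ^ 2 := by positivity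
      have hp1 : X ^ (2 - 1) = X := by norm_num
      rw [hp1]
      push_cast
      linarith [i1, i2, i3, i4, i5]
    · have f1 : fderiv ℝ F1 p = 0 := by
        rw [(fb_ext_zero hA hAU z1 hpU).fderiv_eq]; simp
      have f2 : fderiv ℝ F2 p = 0 := by
        rw [(fb_ext_zero hA hAU z2 hpU).fderiv_eq]; simp
      rw [f1, f2, hFQ, indicator_of_notMem hpU]
      simp only [_root_.zero_apply]
      positivity
  have hdc : Continuous fun p : ℝ × ℝ => fderiv ℝ F1 p (1, 0) + fderiv ℝ F2 p (0, 1) := by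
    have e1 := dF1.continuous_fderiv (by norm_num)
    have e2 := dF2.continuous_fderiv (by norm_num)
    fun_prop
  have hrc : Continuous fun p : ℝ × ℝ => 2 * |s| * M + 4 * M ^ 2 * ρ p.2 := by fun_prop
  have hFQint : ∫ p in Icc ((0 : ℝ), a) (P, d), FQ p ≤
      P * (2 * |s| * M * (d - a) + 4 * D * M ^ 2 * (1 / (b - a) + 1 / (d - c))) := by
    calc ∫ p in Icc ((0 : ℝ), a) (P, d), FQ p
        ≤ ∫ p in Icc ((0 : ℝ), a) (P, d), (2 * (fderiv ℝ F1 p (1, 0) + fderiv ℝ F2 p (0, 1))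
        + (2 * |s| * M + 4 * M ^ 2 * ρ p.2)) :=
          setIntegral_mono_on dFQ.integrableOn_Icc
            ((hdc.const_mul 2).add hrc).integrableOn_Icc measurableSet_Icc hpt
      _ = P * ∫ y in a..d, (2 * |s| * M + 4 * M ^ 2 * ρ y) := by
          rw [integral_add (hdc.const_mul 2).integrableOn_Icc hrc.integrableOn_Icc,
            integral_const_mul, hdiv0, mul_zero, zero_add,
            fb_integral_strip hP had.le (r := fun y => 2 * |s| * M + 4 * M ^ 2 * ρ y)]
      _ = _ := by
          rw [intervalIntegral.integral_add (by simp)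
            ((hρ.const_mul _).intervalIntegrable _ _), intervalIntegral.integral_const_mul (4 * M ^ 2) ρ, hρi]
          simp only [intervalIntegral.integral_const, smul_eq_mul]
          ring
  have hFQ0 : ∀ p, 0 ≤ FQ p := fun p => indicator_nonneg (fun q _ => by
    have := hτ0 (V q)
    simp only [hQ, gradSq]; positivity) p
  calc _ ≤ ∫⁻ p in Icc ((0 : ℝ), a) (P, d), ENNReal.ofReal (FQ p) := by
        refine (setLIntegral_mono' ?_ ?_).trans (lintegral_mono_set ?_)
        · exact hU.measurableSet.inter (fb_box_meas P b c)
        · rintro p ⟨hpU, h1, h2, h3, h4⟩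
          rw [hFQ, indicator_of_mem hpU, hQ]
          simp only [hχbc _ h3 h4, hV]
          refine ENNReal.ofReal_le_ofReal (le_of_eq ?_)
          ring
        · rintro p ⟨hpU, h1, h2, h3, h4⟩
          exact ⟨⟨h1.le, hab.le.trans h3⟩, ⟨h2.le, h4.trans hcd.le⟩⟩
    _ = ENNReal.ofReal (∫ p in Icc ((0 : ℝ), a) (P, d), FQ p) := by
        rw [ofReal_integral_eq_lintegral_ofReal dFQ.integrableOn_Icc
          (Eventually.of_forall hFQ0)]
    _ ≤ _ := ENNReal.ofReal_le_ofReal hFQint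

lemma fb_cacc : ∃ κ > 0, ∀ (v : ℝ → ℝ → ℝ) (U S : Set (ℝ × ℝ)) (P a b c d s M : ℝ), 0 < P →
    IsOpen U → IsClosed S → U ⊆ S →
    ContinuousOn (fun p : ℝ × ℝ => v p.1 p.2) S → ContDiffOn ℝ 2 (fun p : ℝ × ℝ => v p.1 p.2) U →
    (∀ x y, v (x + P) y = v x y) → (∀ x y, (x + P, y) ∈ U ↔ (x, y) ∈ U) →
    (∀ x y, (x, y) ∈ U → lap v x y = -s) →
    (∀ x y, (x, y) ∈ S → (x, y) ∉ U → a ≤ y → y ≤ d → v x y = 0) →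
    a < b → b ≤ c → c < d →
    (∀ x y, (x, y) ∈ U → a ≤ y → y ≤ d → |v x y| ≤ M) → 0 ≤ M →
    ∫⁻ p in U ∩ {p : ℝ × ℝ | 0 < p.1 ∧ p.1 < P ∧ b ≤ p.2 ∧ p.2 ≤ c},
        ENNReal.ofReal (gradSq v p.1 p.2)
      ≤ ENNReal.ofReal
        (P * (2 * |s| * M * (d - a) + κ * M ^ 2 * (1 / (b - a) + 1 / (d - c)))) := by
  obtain ⟨κ, hκ, H⟩ := fb_cacc_eta
  refine ⟨κ, hκ, ?_⟩
  intro v U S P a b c d s M hP hU hS hUS hvS hv hvp hUp hlap hbd hab hbc hcd hM hM0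
  have H' := fun n : ℕ => H v U S P a b c d s M hP hU hS hUS hvS hv hvp hUp hlap hbd hab hbc hcd
    hM hM0 (1 / ((n : ℝ) + 1)) (by positivity)
  choose τ hτ hτ0 hτ1 hI using H'
  set B := U ∩ {p : ℝ × ℝ | 0 < p.1 ∧ p.1 < P ∧ b ≤ p.2 ∧ p.2 ≤ c} with hB
  have hBm : MeasurableSet B := hU.measurableSet.inter (fb_box_meas P b c)
  have hmeas : ∀ n, AEMeasurable
      (fun p : ℝ × ℝ => ENNReal.ofReal (τ n (v p.1 p.2) * gradSq v p.1 p.2))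
      (volume.restrict B) := by
    intro n
    refine AEMeasurable.ennreal_ofReal ?_
    refine ContinuousOn.aemeasurable ?_ hBm
    exact (((hτ n).comp_continuousOn hv.continuousOn).mul (fb_gradSq_cont hU hv)).mono
      inter_subset_left
  calc ∫⁻ p in B, ENNReal.ofReal (gradSq v p.1 p.2)
      ≤ ∫⁻ p in B, liminf (fun n : ℕ =>
          ENNReal.ofReal (τ n (v p.1 p.2) * gradSq v p.1 p.2)) atTop := by
        refine lintegral_mono_ae ?_
        filter_upwards [ae_restrict_of_ae (fb_null hU hv), ae_restrict_mem hBm] with p hp hpB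
        by_cases h0 : v p.1 p.2 = 0
        · rw [hp hpB.1 h0]; simp
        · refine le_of_eq (Tendsto.liminf_eq ?_).symm
          refine tendsto_const_nhds.congr' ?_
          have hpos : 0 < |v p.1 p.2| / 2 := by positivity
          filter_upwards [(tendsto_one_div_add_atTop_nhds_zero_nat (𝕜 := ℝ)).eventually
            (gt_mem_nhds hpos)] with n hn
          rw [hτ1 n _ (by linarith), one_mul]
    _ ≤ liminf (fun n : ℕ => ∫⁻ p in B,
          ENNReal.ofReal (τ n (v p.1 p.2) * gradSq v p.1 p.2)) atTop := lintegral_liminf_le' hmeas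
    _ ≤ _ := by
        refine liminf_le_of_frequently_le' ?_
        exact (Eventually.of_forall hI).frequently

end

end

section

open MeasureTheory Real Set Filter Topology

noncomputable section

lemma fb_pd1_per {h : ℝ → ℝ → ℝ} {P : ℝ} (hp : ∀ x y, h (x + P) y = h x y) (x y : ℝ) :
    pd1 h (x + P) y = pd1 h x y := by
  unfold pd1
  rw [← deriv_comp_add_const]
  simp only [hp]

lemma fb_pd2_per {h : ℝ → ℝ → ℝ} {P : ℝ} (hp : ∀ x y, h (x + P) y = h x y) (x y : ℝ) :
    pd2 h (x + P) y = pd2 h x y := by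
  unfold pd2
  simp only [hp]

/-- Moment identities for a periodic harmonic function in a half plane. -/
lemma fb_mean {h : ℝ → ℝ → ℝ} {P : ℝ} {U : Set (ℝ × ℝ)} (hP : 0 < P) (hU : IsOpen U)
    (hUy : ∀ x y, 0 ≤ y → (x, y) ∈ U) (hs : ContDiffOn ℝ 2 (fun p : ℝ × ℝ => h p.1 p.2) U)
    (hp : ∀ x y, h (x + P) y = h x y) (hl : ∀ x y, 0 ≤ y → lap h x y = 0) {b : ℝ} (hb : 0 ≤ b) :
    (∫ t in (0:ℝ)..P, h t b) = (∫ t in (0:ℝ)..P, h t 0) + b * ∫ t in (0:ℝ)..P, pd2 h t b ∧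
    (∫ t in (0:ℝ)..P, pd2 h t b) = (∫ t in (0:ℝ)..P, pd2 h t 0) ∧
    ∫ p in Icc ((0:ℝ), (0:ℝ)) (P, b), pd2 h p.1 p.2 =
      (∫ t in (0:ℝ)..P, h t b) - ∫ t in (0:ℝ)..P, h t 0 := by
  have hsub : Icc ((0:ℝ), (0:ℝ)) (P, b) ⊆ U := fun p hp => hUy p.1 p.2 hp.1.2
  have hle : ((0:ℝ), (0:ℝ)) ≤ (P, b) := ⟨hP.le, hb⟩
  have hsub2 : ∀ p ∈ Ioo (0:ℝ) P ×ˢ Ioo (0:ℝ) b, p ∈ U := fun p hp => hUy p.1 p.2 hp.2.1.le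
  have c0 := hs.continuousOn
  have s1 := fb_cd1 hU hs
  have s2 := fb_cd2 hU hs
  have c1 := s1.continuousOn
  have c2 := s2.continuousOn
  have c11 := fb_cont1 hU s1
  have c22 := fb_cont2 hU s2
  have d0 : ∀ p ∈ U, HasFDerivAt (fun p : ℝ × ℝ => h p.1 p.2)
      (fderiv ℝ (fun p : ℝ × ℝ => h p.1 p.2) p) p := fun p hp =>
    (fb_diffAt hU (by norm_num) hs (x := p.1) (y := p.2) hp).hasFDerivAt
  have d1 : ∀ p ∈ U, HasFDerivAt (fun p : ℝ × ℝ => pd1 h p.1 p.2)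
      (fderiv ℝ (fun p : ℝ × ℝ => pd1 h p.1 p.2) p) p := fun p hp =>
    (fb_diffAt hU (by norm_num) s1 (x := p.1) (y := p.2) hp).hasFDerivAt
  have d2 : ∀ p ∈ U, HasFDerivAt (fun p : ℝ × ℝ => pd2 h p.1 p.2)
      (fderiv ℝ (fun p : ℝ × ℝ => pd2 h p.1 p.2) p) p := fun p hp =>
    (fb_diffAt hU (by norm_num) s2 (x := p.1) (y := p.2) hp).hasFDerivAt
  have e02 : ∀ p ∈ U, fderiv ℝ (fun p : ℝ × ℝ => h p.1 p.2) p (0, 1) = pd2 h p.1 p.2 :=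
    fun p hp => (fb_pd2_eq (d0 p hp).differentiableAt).symm
  have e11 : ∀ p ∈ U, fderiv ℝ (fun p : ℝ × ℝ => pd1 h p.1 p.2) p (1, 0) = pd1 (pd1 h) p.1 p.2 :=
    fun p hp => (fb_pd1_eq (d1 p hp).differentiableAt).symm
  have e22 : ∀ p ∈ U, fderiv ℝ (fun p : ℝ × ℝ => pd2 h p.1 p.2) p (0, 1) = pd2 (pd2 h) p.1 p.2 :=
    fun p hp => (fb_pd2_eq (d2 p hp).differentiableAt).symm
  have hp1 : ∀ y, pd1 h P y = pd1 h 0 y := fun y => by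
    have := fb_pd1_per hp 0 y
    rwa [zero_add] at this
  -- flux
  have F2 : (∫ t in (0:ℝ)..P, pd2 h t b) = (∫ t in (0:ℝ)..P, pd2 h t 0) := by
    have h0 : ∀ p ∈ Icc ((0:ℝ), (0:ℝ)) (P, b),
        fderiv ℝ (fun p : ℝ × ℝ => pd1 h p.1 p.2) p (1, 0) +
        fderiv ℝ (fun p : ℝ × ℝ => pd2 h p.1 p.2) p (0, 1) = 0 := fun p hp => by
      rw [e11 p (hsub hp), e22 p (hsub hp)]
      exact hl p.1 p.2 hp.1.2
    have := integral_divergence_prod_Icc_of_hasFDerivAt_of_le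
      (fun p : ℝ × ℝ => pd1 h p.1 p.2) (fun p : ℝ × ℝ => pd2 h p.1 p.2) _ _ ((0:ℝ), (0:ℝ)) (P, b) hle
      (c1.mono hsub) (c2.mono hsub) (fun p hp => d1 p (hsub2 p hp)) (fun p hp => d2 p (hsub2 p hp))
      (integrableOn_zero.congr_fun (fun p hp => (h0 p hp).symm) measurableSet_Icc)
    rw [setIntegral_congr_fun measurableSet_Icc h0] at this
    simp only [integral_zero, hp1] at this
    linarith
  have F3 : ∫ p in Icc ((0:ℝ), (0:ℝ)) (P, b), pd2 h p.1 p.2 =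
      (∫ t in (0:ℝ)..P, h t b) - ∫ t in (0:ℝ)..P, h t 0 := by
    have h0 : ∀ p ∈ Icc ((0:ℝ), (0:ℝ)) (P, b),
        (0 : ℝ × ℝ →L[ℝ] ℝ) (1, 0) +
        fderiv ℝ (fun p : ℝ × ℝ => h p.1 p.2) p (0, 1) = pd2 h p.1 p.2 := fun p hp => by
      rw [e02 p (hsub hp)]; simp
    have := integral_divergence_prod_Icc_of_hasFDerivAt_of_le
      (fun p : ℝ × ℝ => (0:ℝ)) (fun p : ℝ × ℝ => h p.1 p.2) (fun _ => 0) _ ((0:ℝ), (0:ℝ)) (P, b) hle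
      continuousOn_const (c0.mono hsub) (fun p hp => hasFDerivAt_const _ _)
      (fun p hp => d0 p (hsub2 p hp))
      (((c2.mono hsub).integrableOn_compact isCompact_Icc).congr_fun
        (fun p hp => (h0 p hp).symm) measurableSet_Icc)
    rw [setIntegral_congr_fun measurableSet_Icc h0] at this
    simp only [intervalIntegral.integral_zero] at this
    linarith
  have ci : ∀ y, 0 ≤ y → Continuous fun t => h t y := fun y hy => by
    refine continuous_iff_continuousAt.2 fun t => ?_
    have : ContinuousAt (fun p : ℝ × ℝ => h p.1 p.2) (t, y) := (d0 _ (hUy t y hy)).continuousAt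
    exact ContinuousAt.comp (f := fun t : ℝ => (t, y)) this (by fun_prop)
  have ci2 : ∀ y, 0 ≤ y → Continuous fun t => pd2 h t y := fun y hy => by
    refine continuous_iff_continuousAt.2 fun t => ?_
    have : ContinuousAt (fun p : ℝ × ℝ => pd2 h p.1 p.2) (t, y) := (d2 _ (hUy t y hy)).continuousAt
    exact ContinuousAt.comp (f := fun t : ℝ => (t, y)) this (by fun_prop)
  have F1 : (∫ t in (0:ℝ)..P, h t b) = (∫ t in (0:ℝ)..P, h t 0) + b * ∫ t in (0:ℝ)..P, pd2 h t b := by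
    have dy : ∀ p : ℝ × ℝ, HasFDerivAt (fun p : ℝ × ℝ => p.2) (ContinuousLinearMap.snd ℝ ℝ ℝ) p :=
      fun p => hasFDerivAt_snd
    have h0 : ∀ p ∈ Icc ((0:ℝ), (0:ℝ)) (P, b),
        (p.2 • fderiv ℝ (fun p : ℝ × ℝ => pd1 h p.1 p.2) p +
          pd1 h p.1 p.2 • ContinuousLinearMap.snd ℝ ℝ ℝ) (1, 0) +
        ((p.2 • fderiv ℝ (fun p : ℝ × ℝ => pd2 h p.1 p.2) p +
          pd2 h p.1 p.2 • ContinuousLinearMap.snd ℝ ℝ ℝ) -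
          fderiv ℝ (fun p : ℝ × ℝ => h p.1 p.2) p) (0, 1) = 0 := fun p hp => by
      have := hl p.1 p.2 hp.1.2
      unfold lap at this
      simp [e11 p (hsub hp), e22 p (hsub hp), e02 p (hsub hp)]
      rw [← mul_add, this, mul_zero]
    have := integral_divergence_prod_Icc_of_hasFDerivAt_of_le
      (fun p : ℝ × ℝ => p.2 * pd1 h p.1 p.2) (fun p : ℝ × ℝ => p.2 * pd2 h p.1 p.2 - h p.1 p.2)
      _ _ ((0:ℝ), (0:ℝ)) (P, b) hle
      (continuousOn_snd.mul (c1.mono hsub)) ((continuousOn_snd.mul (c2.mono hsub)).sub (c0.mono hsub))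
      (fun p hp => (dy p).mul (d1 p (hsub2 p hp)))
      (fun p hp => ((dy p).mul (d2 p (hsub2 p hp))).sub (d0 p (hsub2 p hp)))
      (integrableOn_zero.congr_fun (fun p hp => (h0 p hp).symm) measurableSet_Icc)
    rw [setIntegral_congr_fun measurableSet_Icc h0] at this
    simp only [integral_zero, hp1, zero_mul, zero_sub] at this
    rw [intervalIntegral.integral_sub (((ci2 b hb).const_mul b).intervalIntegrable _ _)
      ((ci b hb).intervalIntegrable _ _), intervalIntegral.integral_const_mul,
      intervalIntegral.integral_neg] at this
    linarith
  exact ⟨F1, F2, F3⟩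

lemma fb_mean_const {h : ℝ → ℝ → ℝ} {P E : ℝ} {U : Set (ℝ × ℝ)} (hP : 0 < P) (hU : IsOpen U)
    (hUy : ∀ x y, 0 ≤ y → (x, y) ∈ U) (hs : ContDiffOn ℝ 2 (fun p : ℝ × ℝ => h p.1 p.2) U)
    (hp : ∀ x y, h (x + P) y = h x y) (hl : ∀ x y, 0 ≤ y → lap h x y = 0)
    (hE : ∀ a b, 0 ≤ a → a ≤ b → ∫ p in Icc ((0:ℝ), a) (P, b), gradSq h p.1 p.2 ≤ E)
    {b : ℝ} (hb : 0 ≤ b) :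
    (∫ t in (0:ℝ)..P, h t b) = ∫ t in (0:ℝ)..P, h t 0 := by
  set k := ∫ t in (0:ℝ)..P, pd2 h t 0 with hk
  have key : ∀ R, 0 ≤ R → k ^ 2 * R ≤ P * E := by
    intro R hR
    obtain ⟨h1, h2, h3⟩ := fb_mean hP hU hUy hs hp hl hR
    have hsub : Icc ((0:ℝ), (0:ℝ)) (P, R) ⊆ U := fun p hp => hUy p.1 p.2 hp.1.2
    have c2 := ((fb_cd2 hU hs).continuousOn).mono hsub
    have cg := (fb_gradSq_cont hU hs).mono hsub
    have i2 := c2.integrableOn_compact (μ := volume) isCompact_Icc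
    have ig := cg.integrableOn_compact (μ := volume) isCompact_Icc
    have vol : (volume : Measure (ℝ × ℝ)).real (Icc ((0:ℝ), (0:ℝ)) (P, R)) = P * R := by
      rw [← Icc_prod_Icc, Measure.volume_eq_prod, Measure.real, Measure.prod_prod]
      simp [hP.le, hR]
    have hle : ∫ p in Icc ((0:ℝ), (0:ℝ)) (P, R), (2 * (k / P) * pd2 h p.1 p.2 - (k / P) ^ 2) ≤
        ∫ p in Icc ((0:ℝ), (0:ℝ)) (P, R), gradSq h p.1 p.2 := by
      refine setIntegral_mono_on ((i2.const_mul _).sub ?_) ig measurableSet_Icc ?_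
      · exact integrableOn_const (by exact (isCompact_Icc.measure_lt_top).ne)
      · intro p _
        unfold gradSq
        nlinarith [sq_nonneg (pd1 h p.1 p.2), sq_nonneg (pd2 h p.1 p.2 - k / P)]
    rw [integral_sub (i2.const_mul _) (integrableOn_const (by exact (isCompact_Icc.measure_lt_top).ne)),
      integral_const_mul, h3, h1, h2, setIntegral_const, vol] at hle
    have := hle.trans (hE 0 R le_rfl hR)
    have e : 2 * (k / P) * ((∫ t in (0:ℝ)..P, h t 0) + R * k - ∫ t in (0:ℝ)..P, h t 0) -
      (P * R) • (k / P) ^ 2 = k ^ 2 * R / P := by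
      simp only [smul_eq_mul]; field_simp; ring
    rw [← hk, e, div_le_iff₀ hP] at this
    linarith
  have hk0 : k = 0 := by
    by_contra hne
    have hk2 : 0 < k ^ 2 := by positivity
    have h0 := key 0 le_rfl
    have := key (P * E / k ^ 2 + 1) (by rw [mul_zero] at h0; positivity)
    rw [mul_add, mul_div_cancel₀ _ hk2.ne'] at this
    linarith
  obtain ⟨h1, h2, h3⟩ := fb_mean hP hU hUy hs hp hl hb
  rw [h1, h2, ← hk, hk0]; ring

end

end

section

open MeasureTheory Real Set Filter Topology

noncomputable section

/-- Existence of heights where the function is close to its mean. -/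
lemma fb_good_height {h : ℝ → ℝ → ℝ} {P E : ℝ} {U : Set (ℝ × ℝ)} (hP : 0 < P) (hU : IsOpen U)
    (hUy : ∀ x y, 0 ≤ y → (x, y) ∈ U) (hs : ContDiffOn ℝ 2 (fun p : ℝ × ℝ => h p.1 p.2) U)
    (hp : ∀ x y, h (x + P) y = h x y) (hl : ∀ x y, 0 ≤ y → lap h x y = 0)
    (hE : ∀ a b, 0 ≤ a → a ≤ b → ∫ p in Icc ((0:ℝ), a) (P, b), gradSq h p.1 p.2 ≤ E)
    {R Y : ℝ} (hR : 0 ≤ R) (hY : 0 < Y) :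
    ∃ y, R ≤ y ∧ y ≤ R + Y ∧
      ∀ x, |h x y - (1 / P) * ∫ t in (0:ℝ)..P, h t 0| ≤ (E + P) / (2 * √Y) := by
  set c := (1 / P) * ∫ t in (0:ℝ)..P, h t 0 with hc
  have hsub : Icc ((0:ℝ), R) (P, R + Y) ⊆ U := fun p hp => hUy p.1 p.2 (hR.trans hp.1.2)
  have s1 := fb_cd1 hU hs
  have cc1 : ContinuousOn (fun p : ℝ × ℝ => (pd1 h p.1 p.2) ^ 2) (Icc ((0:ℝ), R) (P, R + Y)) :=
    (s1.continuousOn.mono hsub).pow 2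
  have i1 := cc1.integrableOn_compact (μ := volume) isCompact_Icc
  have ig := ((fb_gradSq_cont hU hs).mono hsub).integrableOn_compact (μ := volume) isCompact_Icc
  have hle : ∫ p in Icc ((0:ℝ), R) (P, R + Y), (pd1 h p.1 p.2) ^ 2 ≤ E := by
    refine (setIntegral_mono_on i1 ig measurableSet_Icc ?_).trans (hE R (R + Y) hR (by linarith))
    intro p _
    unfold gradSq
    nlinarith [sq_nonneg (pd2 h p.1 p.2)]
  have ip : Integrable (fun p : ℝ × ℝ => (pd1 h p.1 p.2) ^ 2)
      ((volume.restrict (Icc 0 P)).prod (volume.restrict (Icc R (R + Y)))) := by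
    rw [Measure.prod_restrict, Icc_prod_Icc, ← Measure.volume_eq_prod]
    exact i1
  have eI : ∫ p in Icc ((0:ℝ), R) (P, R + Y), (pd1 h p.1 p.2) ^ 2 =
      ∫ y in Icc R (R + Y), ∫ t in Icc 0 P, (pd1 h t y) ^ 2 := by
    rw [← Icc_prod_Icc, Measure.volume_eq_prod, ← Measure.prod_restrict, integral_prod_symm _ ip]
  have hv : (volume : Measure ℝ) (Icc R (R + Y)) ≠ 0 := by
    simp [hY]
  obtain ⟨y, hy, hG⟩ := exists_le_setAverage (μ := (volume : Measure ℝ)) hv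
    (isCompact_Icc.measure_lt_top.ne) ip.integral_prod_right
  have hG' : ∫ t in Icc 0 P, (pd1 h t y) ^ 2 ≤ E / Y := by
    refine hG.trans ?_
    rw [setAverage_eq, ← eI]
    simp only [measureReal_def, Real.volume_Icc, add_sub_cancel_left, ENNReal.toReal_ofReal hY.le,
      smul_eq_mul]
    rw [inv_mul_eq_div]
    gcongr
  have hy0 : 0 ≤ y := hR.trans hy.1
  refine ⟨y, hy.1, hy.2, ?_⟩
  have dA : ∀ t, HasDerivAt (fun t => h t y) (pd1 h t y) t := fun t =>
    fb_hasDerivAt1 (fb_diffAt hU (by norm_num) hs (hUy t y hy0))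
  have ch : Continuous fun t => h t y := continuous_iff_continuousAt.2 fun t => (dA t).continuousAt
  have ci : Continuous fun t => pd1 h t y := by
    refine continuous_iff_continuousAt.2 fun t => ?_
    have : ContinuousAt (fun p : ℝ × ℝ => pd1 h p.1 p.2) (t, y) :=
      s1.continuousOn.continuousAt (hU.mem_nhds (hUy t y hy0))
    exact ContinuousAt.comp (f := fun t : ℝ => (t, y)) this (by fun_prop)
  have hsY : 0 < √Y := Real.sqrt_pos.2 hY
  -- the oscillation
  have osc : ∀ s t, s ∈ Icc 0 P → t ∈ Icc 0 P → |h t y - h s y| ≤ (E + P) / (2 * √Y) := by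
    intro s t hs' ht'
    have e := intervalIntegral.integral_eq_sub_of_hasDerivAt (fun x _ => dA x)
      (ci.intervalIntegrable s t)
    rw [← e]
    have j1 : |∫ x in s..t, pd1 h x y| ≤ ∫ x in Icc 0 P, |pd1 h x y| := by
      refine (intervalIntegral.norm_integral_le_integral_norm_uIoc (f := fun x => pd1 h x y) (a := s)
        (b := t) (μ := volume)).trans ?_
      refine setIntegral_mono_set (ci.abs.integrableOn_Icc)
        (Eventually.of_forall fun x => abs_nonneg _) ?_
      refine LE.le.eventuallyLE ?_
      refine uIoc_subset_uIcc.trans ?_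
      exact uIcc_subset_Icc hs' ht'
    have j2 : ∫ x in Icc 0 P, |pd1 h x y| ≤
        ∫ x in Icc 0 P, (√Y / 2 * (pd1 h x y) ^ 2 + 1 / (2 * √Y)) := by
      refine setIntegral_mono_on ci.abs.integrableOn_Icc
        (Continuous.integrableOn_Icc (by fun_prop)) measurableSet_Icc ?_
      intro x _
      rw [← sq_abs (pd1 h x y)]
      have e2 : √Y / 2 * |pd1 h x y| ^ 2 + 1 / (2 * √Y) - |pd1 h x y| =
        (√Y * |pd1 h x y| - 1) ^ 2 / (2 * √Y) := by field_simp; ring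
      have : 0 ≤ (√Y * |pd1 h x y| - 1) ^ 2 / (2 * √Y) := by positivity
      linarith
    refine j1.trans (j2.trans ?_)
    rw [integral_add (Continuous.integrableOn_Icc (by fun_prop))
      (Continuous.integrableOn_Icc (by fun_prop)), integral_const_mul, setIntegral_const]
    simp only [measureReal_def, Real.volume_Icc, sub_zero, ENNReal.toReal_ofReal hP.le, smul_eq_mul]
    have : √Y / 2 * ∫ x in Icc 0 P, (pd1 h x y) ^ 2 ≤ √Y / 2 * (E / Y) := by gcongr
    have e3 : √Y / 2 * (E / Y) = E / (2 * √Y) := by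
      nth_rewrite 2 [← Real.mul_self_sqrt hY.le]
      field_simp
    rw [e3] at this
    calc _ ≤ E / (2 * √Y) + P * (1 / (2 * √Y)) := by linarith
      _ = _ := by ring
  have hmean : ∫ t in Icc 0 P, h t y = P * c := by
    rw [integral_Icc_eq_integral_Ioc, ← intervalIntegral.integral_of_le hP.le,
      fb_mean_const hP hU hUy hs hp hl hE hy0, hc]
    field_simp
  have hvP : (volume : Measure ℝ) (Icc 0 P) ≠ 0 := by simp [hP]
  have havg : (⨍ t in Icc 0 P, h t y) = c := by
    rw [setAverage_eq, hmean]
    simp only [measureReal_def, Real.volume_Icc, sub_zero, ENNReal.toReal_ofReal hP.le, smul_eq_mul]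
    field_simp
  obtain ⟨t1, ht1, hc1⟩ := exists_le_setAverage (μ := (volume : Measure ℝ)) hvP
    (isCompact_Icc.measure_lt_top.ne) ch.integrableOn_Icc
  obtain ⟨t2, ht2, hc2⟩ := exists_setAverage_le (μ := (volume : Measure ℝ)) hvP
    (isCompact_Icc.measure_lt_top.ne) ch.integrableOn_Icc
  rw [havg] at hc1 hc2
  intro x
  have hper : Function.Periodic (fun t => h t y) P := fun t => hp t y
  obtain ⟨x', hx', e⟩ := hper.exists_mem_Ico₀ hP x
  rw [show h x y = h x' y from e]
  have o1 := (abs_le.1 (osc t1 x' ht1 ⟨hx'.1, hx'.2.le⟩)).2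
  have o2 := (abs_le.1 (osc t2 x' ht2 ⟨hx'.1, hx'.2.le⟩)).1
  rw [abs_le]
  constructor <;> linarith

/-- Bounds for the cell solution. -/
lemma fb_cell {f : ℝ → ℝ} {δ : ℝ} {β : ℝ → ℝ → ℝ} (hfc : Continuous f)
    (hper : Function.Periodic f (2 * π)) (hδ0 : 0 < δ) (hfb : ∀ t, -1 ≤ f t ∧ f t ≤ -δ)
    (hβ : CellSolution f (fun t => -f t) β) :
    ∃ B > 0, (∀ x y, f x ≤ y → |β x y| ≤ B) ∧
      ∀ x y, 0 < y → |β x y - interfaceAvg β| ≤ B / √y := by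
  have hP : 0 < 2 * π := by positivity
  have hU : IsOpen {p : ℝ × ℝ | f p.1 < p.2} := isOpen_lt (by fun_prop) (by fun_prop)
  have hUy : ∀ x y : ℝ, 0 ≤ y → (x, y) ∈ {p : ℝ × ℝ | f p.1 < p.2} := fun x y hy => by
    have := (hfb x).2
    show f x < y
    linarith
  have hl : ∀ x y, 0 ≤ y → lap β x y = 0 := fun x y hy => hβ.harmonic (x, y) (hUy x y hy)
  set E := ∫ p in {p : ℝ × ℝ | 0 < p.1 ∧ p.1 < 2 * π ∧ f p.1 < p.2}, gradSq β p.1 p.2 with hEdef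
  have hg0 : ∀ p : ℝ × ℝ, 0 ≤ gradSq β p.1 p.2 := fun p => by unfold gradSq; positivity
  have hE0 : 0 ≤ E := integral_nonneg hg0
  have hE : ∀ a b, 0 ≤ a → a ≤ b →
      ∫ p in Icc ((0:ℝ), a) (2 * π, b), gradSq β p.1 p.2 ≤ E := by
    intro a b ha hab
    have : ∫ p in Icc ((0:ℝ), a) (2 * π, b), gradSq β p.1 p.2 =
        ∫ p in Ioo (0:ℝ) (2 * π) ×ˢ Ioo a b, gradSq β p.1 p.2 := by
      refine setIntegral_congr_set ?_
      rw [← Icc_prod_Icc, Measure.volume_eq_prod]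
      exact (Measure.set_prod_ae_eq Ioo_ae_eq_Icc Ioo_ae_eq_Icc).symm
    rw [this]
    refine setIntegral_mono_set hβ.energy (Eventually.of_forall hg0) ?_
    refine LE.le.eventuallyLE ?_
    rintro p ⟨h1, h2⟩
    exact ⟨h1.1, h1.2, hUy p.1 p.2 (ha.trans h2.1.le)⟩
  have good := fun (R Y : ℝ) (hR : 0 ≤ R) (hY : 0 < Y) =>
    fb_good_height hP hU hUy hβ.smooth hβ.periodic hl hE hR hY
  change ∀ (R Y : ℝ) (hR : 0 ≤ R) (hY : 0 < Y), ∃ y, R ≤ y ∧ y ≤ R + Y ∧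
      ∀ x, |β x y - interfaceAvg β| ≤ (E + 2 * π) / (2 * √Y) at good
  set c := interfaceAvg β with hc
  set A := (E + 2 * π) / 2 with hA
  have hA0 : 0 < A := by positivity
  have eA : ∀ s : ℝ, (E + 2 * π) / (2 * s) = A / s := fun s => by rw [hA, div_div]
  simp only [eA] at good
  have decay : ∀ x y, 0 < y → |β x y - c| ≤ A / √y := by
    intro x y hy
    obtain ⟨Y1, a1, a2, a3⟩ := good 0 y le_rfl hy
    obtain ⟨Y2, b1, b2, b3⟩ := good y y hy.le hy
    have hcs := fb_comb_cd (u := β) (b := fun _ _ => 0) 0 c 0 0 hβ.smooth contDiffOn_const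
    have hlap : ∀ x y, 0 ≤ y → lap (fbComb β (fun _ _ => 0) 0 c 0 0) x y = 0 := fun x y hy => by
      rw [fb_comb_lap 0 c 0 0 hU hβ.smooth contDiffOn_const (hUy x y hy), hl x y hy]; ring
    have := fb_maxp_abs (h := fbComb β (fun _ _ => 0) 0 c 0 0) (P := 2 * π) (T := Y2)
      (M := A / √y) (g := fun _ => Y1) hP continuous_const (fun _ => rfl)
      (fun x y => by simp only [fbComb, hβ.periodic])
      (hcs.continuousOn.mono fun p hp => hUy p.1 p.2 (a1.trans hp.1))
      (hcs.mono fun p hp => hUy p.1 p.2 (a1.trans hp.1.le))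
      (fun x y h1 _ => hlap x y (a1.trans h1.le))
      (fun x => by simpa [fbComb] using a3 x) (fun x => by simpa [fbComb] using b3 x)
      x y (by linarith) (by linarith)
    simpa [fbComb] using this
  refine ⟨1 + |c| + A, by positivity, ?_, ?_⟩
  · intro x y hxy
    have tri : ∀ x y, |β x y - c| ≤ A → |β x y| ≤ 1 + |c| + A := fun x y h => by
      have := abs_add_le (β x y - c) c
      rw [sub_add_cancel] at this
      linarith
    rcases le_or_gt y 1 with h1 | h1
    · obtain ⟨Y, a1, a2, a3⟩ := good 1 1 zero_le_one one_pos
      refine fb_maxp_abs (h := β) (P := 2 * π) (T := Y) (g := f) hP hfc hper hβ.periodic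
        (hβ.cont.mono fun p hp => hp.1) (hβ.smooth.mono fun p hp => hp.1)
        (fun x y h1 _ => hβ.harmonic (x, y) h1) ?_ ?_ x y hxy (by linarith)
      · intro x
        rw [hβ.bc, abs_neg, abs_le]
        have := hfb x
        have := abs_nonneg c
        constructor <;> linarith
      · intro x
        refine tri _ _ ((a3 x).trans ?_)
        simp
    · refine tri _ _ ((decay x y (by linarith)).trans ?_)
      refine div_le_self hA0.le ?_
      rw [Real.one_le_sqrt]; exact h1.le
  · intro x y hy
    refine (decay x y hy).trans ?_
    gcongr
    have := abs_nonneg c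
    linarith

end

end

section

open MeasureTheory Real Set Filter Topology

noncomputable section

lemma fb_g_per {f : ℝ → ℝ} {L ε : ℝ} (hper : Function.Periodic f (2 * π)) (hε : 0 < ε)
    {N : ℕ} (hN : L = 2 * π * ε * N) (x : ℝ) : f ((x + L) / ε) = f (x / ε) := by
  have : (x + L) / ε = x / ε + N * (2 * π) := by
    rw [hN]; field_simp
  rw [this, hper.nat_mul N]

lemma fb_closure {f : ℝ → ℝ} {L ε : ℝ} (hfc : Continuous f) (hL : 0 < L)
    (hg1 : ∀ x, ε * f (x / ε) < 1) {x y : ℝ} (hx0 : 0 ≤ x) (hxL : x ≤ L)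
    (hy : ε * f (x / ε) ≤ y) (hy1 : y ≤ 1) : (x, y) ∈ closure (OmegaEps f L ε) := by
  set g : ℝ → ℝ := fun x => ε * f (x / ε) with hg
  have hgc : Continuous g := by fun_prop
  let X : ℝ → ℝ := fun s => x + s * (L / 2 - x)
  let Y : ℝ → ℝ := fun s => (1 - s) * max y (g (X s)) + s * ((g (X s) + 1) / 2)
  have hX : Continuous X := by fun_prop
  have hY : Continuous Y := by fun_prop
  have h0 : (X 0, Y 0) = (x, y) := by
    have : X 0 = x := by simp [X]
    simp only [Y, this]
    simp [max_eq_left hy, hg]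
  have ht : Tendsto (fun s => (X s, Y s)) (𝓝[>] 0) (𝓝 (x, y)) := by
    rw [← h0]
    exact (hX.prodMk hY).continuousAt.tendsto.mono_left nhdsWithin_le_nhds
  refine mem_closure_of_tendsto ht ?_
  filter_upwards [Ioo_mem_nhdsGT (zero_lt_one' ℝ)] with s hs
  have hs0 := hs.1
  have hs1 : 0 < 1 - s := by linarith [hs.2]
  have gX := hg1 (X s)
  change g (X s) < 1 at gX
  have m1 : g (X s) ≤ max y (g (X s)) := le_max_right _ _
  have m2 : max y (g (X s)) ≤ 1 := max_le hy1 gX.le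
  refine ⟨?_, ?_, ?_, ?_⟩
  · show 0 < x + s * (L / 2 - x)
    nlinarith
  · show x + s * (L / 2 - x) < L
    nlinarith
  · show g (X s) < (1 - s) * max y (g (X s)) + s * ((g (X s) + 1) / 2)
    nlinarith
  · show (1 - s) * max y (g (X s)) + s * ((g (X s) + 1) / 2) < 1
    nlinarith

lemma fb_per_int {h : ℝ → ℝ → ℝ} {L : ℝ} (hp : ∀ x y, h (x + L) y = h x y) (k : ℤ) (x y : ℝ) :
    h (x - k * L) y = h x y := by
  have : Function.Periodic (fun t => h t y) L := fun t => hp t y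
  exact this.sub_int_mul_eq k

lemma fb_u_cont {f : ℝ → ℝ} {L C ε : ℝ} {u : ℝ → ℝ → ℝ} (hfc : Continuous f) (hL : 0 < L)
    (hg1 : ∀ x, ε * f (x / ε) < 1) (hgp : ∀ x, f ((x + L) / ε) = f (x / ε))
    (hu : RoughSolution f L C ε u) :
    ContinuousOn (fun p : ℝ × ℝ => u p.1 p.2) {p : ℝ × ℝ | ε * f (p.1 / ε) ≤ p.2 ∧ p.2 ≤ 1} := by
  let S : ℤ → Set (ℝ × ℝ) := fun k =>
    {p | (k * L ≤ p.1 ∧ p.1 ≤ (k + 1) * L) ∧ (ε * f (p.1 / ε) ≤ p.2 ∧ p.2 ≤ 1)}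
  have hgpk : ∀ (k : ℤ) x, f ((x - k * L) / ε) = f (x / ε) := fun k x =>
    fb_per_int (h := fun x _ => f (x / ε)) (fun x _ => hgp x) k x 0
  have hcl : ∀ k, IsClosed (S k) := fun k =>
    fb_closed_and (fb_closed_and (isClosed_le (by fun_prop) (by fun_prop))
      (isClosed_le (by fun_prop) (by fun_prop)))
      (fb_closed_and (isClosed_le (by fun_prop) (by fun_prop))
      (isClosed_le (by fun_prop) (by fun_prop)))
  have hlf : LocallyFinite S := by
    intro q
    refine ⟨{p | q.1 - 1 < p.1 ∧ p.1 < q.1 + 1}, ?_, ?_⟩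
    · refine IsOpen.mem_nhds ?_ (by simp)
      have o1 : IsOpen {p : ℝ × ℝ | q.1 - 1 < p.1} := isOpen_lt (by fun_prop) (by fun_prop)
      have o2 : IsOpen {p : ℝ × ℝ | p.1 < q.1 + 1} := isOpen_lt (by fun_prop) (by fun_prop)
      exact o1.inter o2
    · refine (Set.finite_Icc ⌊(q.1 - 1) / L - 1⌋ ⌈(q.1 + 1) / L⌉).subset ?_
      rintro k ⟨p, ⟨⟨h1, h2⟩, -⟩, h3, h4⟩
      constructor
      · have : (q.1 - 1) / L - 1 ≤ k := by
          rw [sub_le_iff_le_add, div_le_iff₀ hL]; linarith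
        have h5 := (Int.floor_le ((q.1 - 1) / L - 1)).trans this
        exact_mod_cast h5
      · have : (k : ℝ) ≤ (q.1 + 1) / L := by
          rw [le_div_iff₀ hL]; linarith
        have h5 := this.trans (Int.le_ceil ((q.1 + 1) / L))
        exact_mod_cast h5
  have hc : ∀ k, ContinuousOn (fun p : ℝ × ℝ => u p.1 p.2) (S k) := by
    intro k
    have e : (fun p : ℝ × ℝ => u p.1 p.2) =
        (fun p : ℝ × ℝ => u p.1 p.2) ∘ (fun p : ℝ × ℝ => (p.1 - k * L, p.2)) := by
      funext p
      exact (fb_per_int hu.periodic k p.1 p.2).symm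
    rw [e]
    refine hu.cont.comp (by fun_prop) ?_
    rintro p ⟨⟨h1, h2⟩, h3, h4⟩
    refine fb_closure hfc hL hg1 (by linarith) (by linarith) ?_ h4
    rw [hgpk]; exact h3
  refine (hlf.continuousOn_iUnion hcl hc).mono ?_
  rintro p ⟨h1, h2⟩
  refine mem_iUnion.2 ⟨⌊p.1 / L⌋, ⟨?_, ?_⟩, h1, h2⟩
  · have := Int.floor_le (p.1 / L)
    rwa [le_div_iff₀ hL] at this
  · have := (Int.lt_floor_add_one (p.1 / L)).le
    rwa [div_le_iff₀ hL] at this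

lemma fb_strip_open {f : ℝ → ℝ} (hfc : Continuous f) (ε : ℝ) : IsOpen (RoughStrip f ε) := by
  have o1 : IsOpen {p : ℝ × ℝ | ε * f (p.1 / ε) < p.2} := isOpen_lt (by fun_prop) (by fun_prop)
  have o2 : IsOpen {p : ℝ × ℝ | p.2 < 1} := isOpen_lt (by fun_prop) (by fun_prop)
  exact o1.inter o2

lemma fb_u_lap {f : ℝ → ℝ} {L C ε : ℝ} {u : ℝ → ℝ → ℝ} (hfc : Continuous f) (hL : 0 < L)
    (hgp : ∀ x, f ((x + L) / ε) = f (x / ε)) (hu : RoughSolution f L C ε u) (x y : ℝ)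
    (hxy : (x, y) ∈ RoughStrip f ε) : lap u x y = -C := by
  have hU := fb_strip_open hfc ε
  have hper : ∀ x y, lap u (x + L) y = lap u x y := fun x y => by
    unfold lap
    rw [fb_pd1_per (fb_pd1_per hu.periodic), fb_pd2_per (fb_pd2_per hu.periodic)]
  have key : ∀ x, (x, y) ∈ RoughStrip f ε → 0 ≤ x → x < L → lap u x y = -C := by
    intro x hx h0 h1
    rcases h0.eq_or_lt with h | h
    · subst h
      have hc : ContinuousAt (fun p : ℝ × ℝ => lap u p.1 p.2) (0, y) :=
        (fb_lap_cont hU hu.smooth).continuousAt (hU.mem_nhds hx)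
      have hc2 : ContinuousAt (fun t : ℝ => lap u t y) 0 :=
        ContinuousAt.comp (f := fun t : ℝ => (t, y)) hc (by fun_prop)
      have t1 : Tendsto (fun t : ℝ => lap u t y) (𝓝[>] 0) (𝓝 (lap u 0 y)) :=
        hc2.tendsto.mono_left nhdsWithin_le_nhds
      have t2 : Tendsto (fun t : ℝ => lap u t y) (𝓝[>] 0) (𝓝 (-C)) := by
        refine tendsto_const_nhds.congr' ?_
        filter_upwards [Ioo_mem_nhdsGT hL, nhdsWithin_le_nhds (fb_slice1 hU hx)] with t ht ht2
        have := hu.eqn (t, y) ⟨ht.1, ht.2, ht2.1, ht2.2⟩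
        linarith
      exact tendsto_nhds_unique t1 t2
    · have := hu.eqn (x, y) ⟨h, h1, hx.1, hx.2⟩
      linarith
  set k := ⌊x / L⌋
  have e := fb_per_int hper k x y
  rw [← e]
  have h1 := Int.floor_le (x / L)
  have h2 := Int.lt_floor_add_one (x / L)
  rw [le_div_iff₀ hL] at h1
  rw [div_lt_iff₀ hL] at h2
  refine key _ ?_ (by linarith) (by linarith)
  have : f ((x - k * L) / ε) = f (x / ε) :=
    fb_per_int (h := fun x _ => f (x / ε)) (fun x _ => hgp x) k x 0
  refine ⟨?_, hxy.2⟩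
  show ε * f ((x - k * L) / ε) < y
  rw [this]; exact hxy.1

/-- The rescaled cell function. -/
def fbScale (β : ℝ → ℝ → ℝ) (ε : ℝ) (x y : ℝ) : ℝ := β (x / ε) (y / ε)

lemma fb_scale_lap (β : ℝ → ℝ → ℝ) (ε x y : ℝ) :
    lap (fbScale β ε) x y = ε⁻¹ * (ε⁻¹ * lap β (x / ε) (y / ε)) := by
  have h1 : ∀ (h : ℝ → ℝ → ℝ) (x y : ℝ), pd1 (fun x y => h (x / ε) (y / ε)) x y =
      ε⁻¹ * pd1 h (x / ε) (y / ε) := by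
    intro h x y
    have := deriv_comp_mul_left ε⁻¹ (fun t => h t (y / ε)) x
    unfold pd1
    simp only [div_eq_inv_mul] at this ⊢
    simpa using this
  have h2 : ∀ (h : ℝ → ℝ → ℝ) (x y : ℝ), pd2 (fun x y => h (x / ε) (y / ε)) x y =
      ε⁻¹ * pd2 h (x / ε) (y / ε) := by
    intro h x y
    have := deriv_comp_mul_left ε⁻¹ (fun t => h (x / ε) t) y
    unfold pd2
    simp only [div_eq_inv_mul] at this ⊢
    simpa using this
  have e1 : pd1 (fbScale β ε) = fun x y => (fun x' y' => ε⁻¹ * pd1 β x' y') (x / ε) (y / ε) := by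
    funext x y; exact h1 β x y
  have e2 : pd2 (fbScale β ε) = fun x y => (fun x' y' => ε⁻¹ * pd2 β x' y') (x / ε) (y / ε) := by
    funext x y; exact h2 β x y
  have c1 : ∀ x y, pd1 (fun x' y' => ε⁻¹ * pd1 β x' y') x y = ε⁻¹ * pd1 (pd1 β) x y := fun x y => by
    unfold pd1; rw [deriv_const_mul_field]
  have c2 : ∀ x y, pd2 (fun x' y' => ε⁻¹ * pd2 β x' y') x y = ε⁻¹ * pd2 (pd2 β) x y := fun x y => by
    unfold pd2; rw [deriv_const_mul_field]
  unfold lap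
  rw [e1, e2, h1 (fun x' y' => ε⁻¹ * pd1 β x' y'), h2 (fun x' y' => ε⁻¹ * pd2 β x' y'), c1, c2]; ring

lemma fb_scale_cd {β : ℝ → ℝ → ℝ} {V U : Set (ℝ × ℝ)} {ε : ℝ}
    (hβ : ContDiffOn ℝ 2 (fun p : ℝ × ℝ => β p.1 p.2) V)
    (hV : ∀ p ∈ U, (p.1 / ε, p.2 / ε) ∈ V) :
    ContDiffOn ℝ 2 (fun p : ℝ × ℝ => fbScale β ε p.1 p.2) U := by
  have : ContDiffOn ℝ 2 (fun p : ℝ × ℝ => (p.1 / ε, p.2 / ε)) U := by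
    simp only [div_eq_mul_inv]; fun_prop
  exact hβ.comp this hV

lemma fb_scale_cont {β : ℝ → ℝ → ℝ} {V U : Set (ℝ × ℝ)} {ε : ℝ}
    (hβ : ContinuousOn (fun p : ℝ × ℝ => β p.1 p.2) V)
    (hV : ∀ p ∈ U, (p.1 / ε, p.2 / ε) ∈ V) :
    ContinuousOn (fun p : ℝ × ℝ => fbScale β ε p.1 p.2) U := by
  have : ContinuousOn (fun p : ℝ × ℝ => (p.1 / ε, p.2 / ε)) U := by
    simp only [div_eq_mul_inv]; fun_prop
  exact hβ.comp this hV

lemma fb_integral_le {A : Set (ℝ × ℝ)} {F : ℝ × ℝ → ℝ} {R : ℝ} (hF : ∀ p, 0 ≤ F p) (hR : 0 ≤ R)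
    (h : ∫⁻ p in A, ENNReal.ofReal (F p) ≤ ENNReal.ofReal R) : ∫ p in A, F p ≤ R := by
  by_cases hi : IntegrableOn F A
  · rw [integral_eq_lintegral_of_nonneg_ae (Eventually.of_forall hF) hi.aestronglyMeasurable]
    exact ENNReal.toReal_le_of_le_ofReal hR h
  · rw [integral_undef hi]; exact hR

lemma fb_piece {A : Set (ℝ × ℝ)} {F H : ℝ × ℝ → ℝ} {k V r : ℝ} (hk : 0 ≤ k) (hV : 0 ≤ V)
    (hr : 0 ≤ r) (hH : ∀ p, 0 ≤ H p)
    (hF : ∀ᵐ p ∂(volume.restrict A), F p ≤ k + H p)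
    (hA : volume A ≤ ENNReal.ofReal V)
    (hHi : ∫⁻ p in A, ENNReal.ofReal (H p) ≤ ENNReal.ofReal r) :
    ∫⁻ p in A, ENNReal.ofReal (F p) ≤ ENNReal.ofReal (k * V + r) := by
  calc ∫⁻ p in A, ENNReal.ofReal (F p) ≤
      ∫⁻ p in A, (ENNReal.ofReal k + ENNReal.ofReal (H p)) := by
        refine lintegral_mono_ae ?_
        filter_upwards [hF] with p hp
        rw [← ENNReal.ofReal_add hk (hH p)]
        exact ENNReal.ofReal_le_ofReal hp
    _ = ENNReal.ofReal k * volume A + ∫⁻ p in A, ENNReal.ofReal (H p) := by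
        rw [lintegral_add_left measurable_const, setLIntegral_const]
    _ ≤ ENNReal.ofReal k * ENNReal.ofReal V + ENNReal.ofReal r := by gcongr
    _ = _ := by rw [← ENNReal.ofReal_mul hk, ← ENNReal.ofReal_add (by positivity) hr]

lemma fb_lint_mul {A : Set (ℝ × ℝ)} {G : ℝ × ℝ → ℝ} {c r : ℝ} (hc : 0 ≤ c)
    (h : ∫⁻ p in A, ENNReal.ofReal (G p) ≤ ENNReal.ofReal r) :
    ∫⁻ p in A, ENNReal.ofReal (c * G p) ≤ ENNReal.ofReal (c * r) := by
  simp only [ENNReal.ofReal_mul hc]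
  rw [lintegral_const_mul' _ _ ENNReal.ofReal_ne_top]
  gcongr

lemma fb_lint_add {A : Set (ℝ × ℝ)} {G H : ℝ × ℝ → ℝ} {r s : ℝ} (hA : MeasurableSet A)
    (hG : ∀ p, 0 ≤ G p) (hH : ∀ p, 0 ≤ H p) (hr : 0 ≤ r) (hs : 0 ≤ s) (hGc : ContinuousOn G A)
    (h1 : ∫⁻ p in A, ENNReal.ofReal (G p) ≤ ENNReal.ofReal r)
    (h2 : ∫⁻ p in A, ENNReal.ofReal (H p) ≤ ENNReal.ofReal s) :
    ∫⁻ p in A, ENNReal.ofReal (G p + H p) ≤ ENNReal.ofReal (r + s) := by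
  simp only [ENNReal.ofReal_add (hG _) (hH _)]
  rw [lintegral_add_left' (hGc.aemeasurable hA).ennreal_ofReal, ENNReal.ofReal_add hr hs]
  gcongr

end

end

section

open MeasureTheory Real Set Filter Topology

noncomputable section

lemma fb_ae_ne : ∀ᵐ p : ℝ × ℝ, p.2 ≠ 0 := by
  have h : ∀ᵐ y : ℝ, y ≠ 0 := compl_mem_ae_iff.2 (measure_singleton 0)
  have := (Measure.quasiMeasurePreserving_snd (μ := (volume : Measure ℝ))
    (ν := (volume : Measure ℝ))).ae h
  rwa [← Measure.volume_eq_prod] at this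

lemma fb_sqrt_le {ε B y : ℝ} (hε : 0 < ε) (hB : 0 < B) (hy : 1 / 4 ≤ y) :
    B / √(y / ε) ≤ 2 * B * √ε := by
  have hs : 0 < √ε := Real.sqrt_pos.2 hε
  have h1 : 1 / (2 * √ε) ≤ √(y / ε) := by
    refine Real.le_sqrt_of_sq_le ?_
    rw [div_pow, mul_pow, Real.sq_sqrt hε.le, le_div_iff₀ hε]
    field_simp
    linarith
  calc B / √(y / ε) ≤ B / (1 / (2 * √ε)) := by gcongr
    _ = _ := by field_simp

lemma fb_gradSq_nonneg (h : ℝ → ℝ → ℝ) (p : ℝ × ℝ) : 0 ≤ gradSq h p.1 p.2 := by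
  unfold gradSq; positivity

set_option maxHeartbeats 1000000 in
lemma fb_main {κ : ℝ} (hκ : 0 < κ)
    (cacc : ∀ (v : ℝ → ℝ → ℝ) (U S : Set (ℝ × ℝ)) (P a b c d s M : ℝ), 0 < P →
    IsOpen U → IsClosed S → U ⊆ S →
    ContinuousOn (fun p : ℝ × ℝ => v p.1 p.2) S → ContDiffOn ℝ 2 (fun p : ℝ × ℝ => v p.1 p.2) U →
    (∀ x y, v (x + P) y = v x y) → (∀ x y, (x + P, y) ∈ U ↔ (x, y) ∈ U) →
    (∀ x y, (x, y) ∈ U → lap v x y = -s) →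
    (∀ x y, (x, y) ∈ S → (x, y) ∉ U → a ≤ y → y ≤ d → v x y = 0) →
    a < b → b ≤ c → c < d →
    (∀ x y, (x, y) ∈ U → a ≤ y → y ≤ d → |v x y| ≤ M) → 0 ≤ M →
    ∫⁻ p in U ∩ {p : ℝ × ℝ | 0 < p.1 ∧ p.1 < P ∧ b ≤ p.2 ∧ p.2 ≤ c},
        ENNReal.ofReal (gradSq v p.1 p.2)
      ≤ ENNReal.ofReal
        (P * (2 * |s| * M * (d - a) + κ * M ^ 2 * (1 / (b - a) + 1 / (d - c)))))
    {f : ℝ → ℝ} {δ L C B c ε : ℝ} (hfc : Continuous f)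
    (hper : Function.Periodic f (2 * π)) (hδ0 : 0 < δ) (hfb : ∀ t, -1 ≤ f t ∧ f t ≤ -δ)
    (hL : 0 < L) (hC : 0 < C) {β : ℝ → ℝ → ℝ} (hβ : CellSolution f (fun t => -f t) β)
    (hc : 0 < c) (hB : 0 < B) 
    (hdec : ∀ x y, 0 < y → |β x y - c| ≤ B / √y)
    (hε : 0 < ε) (hε1 : ε ≤ 1) {N : ℕ} (hN : L = 2 * π * ε * N)
    {u : ℝ → ℝ → ℝ} (hu : RoughSolution f L C ε u) :
    (∫ p in OmegaEps f L ε,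
            ((u p.1 p.2 - uFull1 C ε c β p.1 p.2) ^ 2
              + gradSq (fun x y => u x y - uFull1 C ε c β x y) p.1 p.2)) ≤
      (6 * L * ((C / 2 * (1 + 2 * B) + C / 2) ^ 2 + 2 * C ^ 2) +
        2 * L * (7 * C * (C / 2 * (1 + 2 * B) + C / 2) + 5 * κ * (C / 2 * (1 + 2 * B) + C / 2) ^ 2)
        + 52 * L * κ * (C / 2 * (1 + 2 * B)) ^ 2 + 16 * L * κ * B ^ 2 * C ^ 2) * ε ^ 2 ∧
    (∫ p in Omega0 L, (u p.1 p.2 - uFull1 C ε c β p.1 p.2) ^ 2) ≤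
      L * (C / 2 * (1 + 2 * B) * (ε * √ε)) ^ 2 := by
  set s := √ε with hs
  have hs0 : 0 < s := Real.sqrt_pos.2 hε
  have hs1 : s ≤ 1 := Real.sqrt_le_iff.2 ⟨zero_le_one, by linarith⟩
  have hss : s ^ 2 = ε := Real.sq_sqrt hε.le
  have hεs : ε ≤ s := by rw [← hss]; nlinarith
  set M1 := C / 2 * (1 + 2 * B) with hM1
  have hM10 : 0 < M1 := by positivity
  set m := M1 + C / 2 with hm
  have hm0 : 0 < m := by positivity
  have hgp : ∀ x, f ((x + L) / ε) = f (x / ε) := fb_g_per hper hε hN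
  have hg0 : ∀ x, ε * f (x / ε) < 0 := fun x => by
    have := (hfb (x / ε)).2
    exact mul_neg_of_pos_of_neg hε (by linarith)
  have hg1 : ∀ x, ε * f (x / ε) < 1 := fun x => (hg0 x).trans one_pos
  have hgl : ∀ x, -ε ≤ ε * f (x / ε) := fun x => by
    have := (hfb (x / ε)).1
    nlinarith
  have hU := fb_strip_open hfc ε
  have huc := fb_u_cont hfc hL hg1 hgp hu
  have hul := fb_u_lap hfc hL hgp hu
  set b := fbScale β ε with hb
  set S : Set (ℝ × ℝ) := {p : ℝ × ℝ | ε * f (p.1 / ε) ≤ p.2 ∧ p.2 ≤ 1} with hS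
  have hScl : IsClosed S := fb_closed_and (isClosed_le (by fun_prop) (by fun_prop))
      (isClosed_le (by fun_prop) (by fun_prop))
  have hUS : RoughStrip f ε ⊆ S := fun p hp => ⟨hp.1.le, hp.2.le⟩
  have hbper : ∀ x y, b (x + L) y = b x y := by
    intro x y
    have : (x + L) / ε = x / ε + N * (2 * π) := by rw [hN]; field_simp
    simp only [hb, fbScale]
    rw [this]
    have hp : Function.Periodic (fun t => β t (y / ε)) (2 * π) := fun t => hβ.periodic t _
    exact hp.nat_mul N (x / ε)
  have hbc : ContinuousOn (fun p : ℝ × ℝ => b p.1 p.2) S :=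
    fb_scale_cont hβ.cont fun p hp => by
      show f (p.1 / ε) ≤ p.2 / ε
      rw [le_div_iff₀ hε, mul_comm]; exact hp.1
  have hbU : ContDiffOn ℝ 2 (fun p : ℝ × ℝ => b p.1 p.2) (RoughStrip f ε) :=
    fb_scale_cd hβ.smooth fun p hp => by
      show f (p.1 / ε) < p.2 / ε
      rw [lt_div_iff₀ hε, mul_comm]; exact hp.1
  have hbl : ∀ x y, ε * f (x / ε) < y → lap b x y = 0 := fun x y hxy => by
    rw [hb, fb_scale_lap, hβ.harmonic (x / ε, y / ε) (by
      show f (x / ε) < y / ε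
      rw [lt_div_iff₀ hε, mul_comm]; exact hxy)]
    ring
  have hbb : ∀ x, b x (ε * f (x / ε)) = -f (x / ε) := fun x => by
    simp only [hb, fbScale]
    rw [mul_div_cancel_left₀ _ hε.ne', hβ.bc]
  have hbd : ∀ x y, 1 / 4 ≤ y → |b x y - c| ≤ 2 * B * s := fun x y hy =>
    (hdec (x / ε) (y / ε) (by positivity)).trans (fb_sqrt_le hε hB hy)
  -- the coefficient
  set a := ε / (1 + ε * c) * (C / 2) with ha
  have ha0 : 0 < a := by positivity
  have haε : a * (1 + ε * c) = ε * (C / 2) := by rw [ha]; field_simp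
  have hale : a ≤ C / 2 * ε := by
    have : 0 ≤ a * (ε * c) := by positivity
    nlinarith
  have hUper : ∀ x y, (x + L, y) ∈ RoughStrip f ε ↔ (x, y) ∈ RoughStrip f ε := fun x y => by
    simp only [RoughStrip, mem_ofPred_eq, hgp]
  -- the function W
  set W := fbComb u b a 0 (C / 2 - a * c) (-(C / 2)) with hW
  have hWc : ContinuousOn (fun p : ℝ × ℝ => W p.1 p.2) S := fb_comb_cont _ _ _ _ huc hbc
  have hWs : ContDiffOn ℝ 2 (fun p : ℝ × ℝ => W p.1 p.2) (RoughStrip f ε) :=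
    fb_comb_cd _ _ _ _ hu.smooth hbU
  have hWl : ∀ x y, (x, y) ∈ RoughStrip f ε → lap W x y = 0 := fun x y hp => by
    rw [hW, fb_comb_lap _ _ _ _ hU hu.smooth hbU hp, hul x y hp, hbl x y hp.1]; ring
  have hcombper : ∀ a p0 p1 p2 x y, fbComb u b a p0 p1 p2 (x + L) y = fbComb u b a p0 p1 p2 x y :=
    fun a p0 p1 p2 x y => by simp only [fbComb, hu.periodic, hbper]
  have hWbd : ∀ x y, ε * f (x / ε) ≤ y → y ≤ 1 → |W x y| ≤ M1 * (ε * s) := by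
    refine fb_maxp_abs (h := W) (P := L) (g := fun x => ε * f (x / ε)) hL (by fun_prop)
      (fun x => by simp only [hgp]) (hcombper _ _ _ _) hWc hWs (fun x y h1 h2 => hWl x y ⟨h1, h2⟩)
      ?_ ?_
    · intro x
      have e : W x (ε * f (x / ε)) = C / 2 * (ε ^ 2 * f (x / ε) ^ 2) := by
        simp only [hW, fbComb, hu.bc_rough, hbb]
        linear_combination f (x / ε) * haε
      rw [e, abs_of_nonneg (by positivity)]
      have h1 : f (x / ε) ^ 2 ≤ 1 := by
        have := hfb (x / ε); nlinarith
      have h2 : ε ^ 2 * f (x / ε) ^ 2 ≤ ε * s := by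
        calc _ ≤ ε ^ 2 * 1 := by gcongr
          _ ≤ ε * s := by nlinarith
      calc C / 2 * (ε ^ 2 * f (x / ε) ^ 2) ≤ C / 2 * (ε * s) := by gcongr
        _ ≤ M1 * (ε * s) := by
          gcongr
          rw [hM1]; nlinarith
    · intro x
      have e : W x 1 = -(a * (b x 1 - c)) := by
        simp only [hW, fbComb, hu.bc_top]; ring
      rw [e, abs_neg, abs_mul, abs_of_pos ha0]
      have := hbd x 1 (by norm_num)
      calc a * |b x 1 - c| ≤ (C / 2 * ε) * (2 * B * s) := by gcongr
        _ ≤ M1 * (ε * s) := by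
          have : 0 < C * (ε * s) := by positivity
          rw [hM1]; nlinarith
  -- the function v
  set v := fbComb u b a 0 (C / 2 - a * c) 0 with hv
  have hWv : ∀ x y, W x y = v x y + C / 2 * y ^ 2 := fun x y => by
    simp only [hW, hv, fbComb]; ring
  have hvbd : ∀ x y, ε * f (x / ε) ≤ y → y ≤ ε → |v x y| ≤ m * (ε * s) := by
    intro x y h1 h2
    have e : v x y = W x y - C / 2 * y ^ 2 := by rw [hWv]; ring
    have h3 := hWbd x y h1 (h2.trans hε1)
    have h4 : y ^ 2 ≤ ε * s := by
      have := hgl x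
      have : y ^ 2 ≤ ε ^ 2 := by nlinarith
      nlinarith
    rw [e]
    calc _ ≤ |W x y| + |C / 2 * y ^ 2| := abs_sub _ _
      _ ≤ M1 * (ε * s) + C / 2 * (ε * s) := by
        rw [abs_of_nonneg (by positivity : 0 ≤ C / 2 * y ^ 2)]
        gcongr
      _ = _ := by rw [hm]; ring
  have e1 : ∫⁻ p in RoughStrip f ε ∩ {p : ℝ × ℝ | 0 < p.1 ∧ p.1 < L ∧ -2 * ε ≤ p.2 ∧ p.2 ≤ ε / 4},
      ENNReal.ofReal (gradSq v p.1 p.2) ≤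
      ENNReal.ofReal (L * (7 * C * m + 5 * κ * m ^ 2) * ε ^ 2) := by
    refine (cacc v (RoughStrip f ε) S L (-3 * ε) (-2 * ε) (ε / 4) (ε / 2) C (m * (ε * s)) hL hU hScl
      hUS (fb_comb_cont _ _ _ _ huc hbc) (fb_comb_cd _ _ _ _ hu.smooth hbU) (hcombper _ _ _ _)
      hUper ?_ ?_ (by linarith) (by linarith) (by linarith) ?_ (by positivity)).trans ?_
    · intro x y hp
      rw [hv, fb_comb_lap _ _ _ _ hU hu.smooth hbU hp, hul x y hp, hbl x y hp.1]; ring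
    · intro x y h1 h2 _ h4
      have : y = ε * f (x / ε) := by
        by_contra hne
        exact h2 ⟨lt_of_le_of_ne h1.1 (Ne.symm hne), by linarith⟩
      rw [this]
      simp only [hv, fbComb, hu.bc_rough, hbb]
      linear_combination f (x / ε) * haε
    · intro x y h1 _ h4
      exact hvbd x y h1.1.le (by linarith)
    · refine ENNReal.ofReal_le_ofReal ?_
      rw [abs_of_pos hC, mul_assoc L]
      refine mul_le_mul_of_nonneg_left ?_ hL.le
      have q1 : 2 * C * (m * (ε * s)) * (ε / 2 - -3 * ε) ≤ 7 * C * m * ε ^ 2 := by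
        calc _ = 7 * C * m * ε ^ 2 * s := by ring
          _ ≤ 7 * C * m * ε ^ 2 * 1 := by gcongr
          _ = _ := by ring
      have q2 : κ * (m * (ε * s)) ^ 2 * (1 / (-2 * ε - -3 * ε) + 1 / (ε / 2 - ε / 4)) =
          5 * κ * m ^ 2 * ε ^ 2 := by
        rw [show -2 * ε - -3 * ε = ε by ring, show ε / 2 - ε / 4 = ε / 4 by ring, mul_pow, mul_pow,
          hss]
        field_simp
        ring
      rw [q2]
      linarith
  have e2 : ∫⁻ p in RoughStrip f ε ∩ {p : ℝ × ℝ | 0 < p.1 ∧ p.1 < L ∧ ε / 4 ≤ p.2 ∧ p.2 ≤ 1 / 2},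
      ENNReal.ofReal (gradSq W p.1 p.2) ≤
      ENNReal.ofReal (12 * L * κ * M1 ^ 2 * ε ^ 2) := by
    refine (cacc W (RoughStrip f ε) S L (ε / 8) (ε / 4) (1 / 2) (3 / 4) 0 (M1 * (ε * s)) hL hU hScl
      hUS hWc hWs (hcombper _ _ _ _) hUper ?_ ?_ (by linarith) (by linarith) (by norm_num) ?_
      (by positivity)).trans ?_
    · intro x y hp
      rw [hWl x y hp, neg_zero]
    · intro x y h1 h2 h3 h4
      exact absurd ⟨(hg0 x).trans_le (by linarith), by show y < 1; linarith⟩ h2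
    · intro x y h1 _ h4
      exact hWbd x y h1.1.le (by linarith)
    · refine ENNReal.ofReal_le_ofReal ?_
      have q2 : κ * (M1 * (ε * s)) ^ 2 * (1 / (ε / 4 - ε / 8) + 1 / (3 / 4 - 1 / 2)) =
          κ * M1 ^ 2 * ε ^ 2 * (8 + 4 * ε) := by
        rw [show ε / 4 - ε / 8 = ε / 8 by ring, mul_pow M1 (ε * s), mul_pow ε s, hss]
        field_simp
        ring
      rw [q2]
      have : 0 ≤ κ * M1 ^ 2 * ε ^ 2 * (1 - ε) := by
        have : 0 ≤ 1 - ε := by linarith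
        positivity
      simp only [abs_zero, mul_zero, zero_mul, zero_add]
      nlinarith
  -- the function z
  set z := fbComb u b 0 (a * c) (C / 2 - a * c) (-(C / 2)) with hz
  have hWz : ∀ x y, z x y = W x y + a * (b x y - c) := fun x y => by
    simp only [hW, hz, fbComb]; ring
  have hzs : ContDiffOn ℝ 2 (fun p : ℝ × ℝ => z p.1 p.2) (RoughStrip f ε) :=
    fb_comb_cd _ _ _ _ hu.smooth hbU
  have e3 : ∫⁻ p in RoughStrip f ε ∩ {p : ℝ × ℝ | 0 < p.1 ∧ p.1 < L ∧ 1 / 2 ≤ p.2 ∧ p.2 ≤ 2},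
      ENNReal.ofReal (gradSq z p.1 p.2) ≤
      ENNReal.ofReal (20 * L * κ * M1 ^ 2 * ε ^ 2) := by
    refine (cacc z (RoughStrip f ε) S L (1 / 4) (1 / 2) 2 3 0 (2 * M1 * (ε * s)) hL hU hScl
      hUS (fb_comb_cont _ _ _ _ huc hbc) hzs (hcombper _ _ _ _) hUper ?_ ?_
      (by norm_num) (by norm_num) (by norm_num) ?_ (by positivity)).trans ?_
    · intro x y hp
      rw [hz, fb_comb_lap _ _ _ _ hU hu.smooth hbU hp, hul x y hp, hbl x y hp.1]; ring
    · intro x y h1 h2 h3 h4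
      have : y = 1 := by
        by_contra hne
        exact h2 ⟨(hg0 x).trans_le (by linarith), lt_of_le_of_ne h1.2 hne⟩
      rw [this]
      simp only [hz, fbComb, hu.bc_top]
      ring
    · intro x y h1 h3 h4
      rw [hWz]
      have i1 := hWbd x y h1.1.le h1.2.le
      have i2 := hbd x y h3
      have i3 : |a * (b x y - c)| ≤ M1 * (ε * s) := by
        rw [abs_mul, abs_of_pos ha0]
        calc a * |b x y - c| ≤ (C / 2 * ε) * (2 * B * s) := by gcongr
          _ ≤ M1 * (ε * s) := by
            have : 0 < C * (ε * s) := by positivity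
            rw [hM1]; nlinarith
      refine (abs_add_le _ _).trans ?_
      linarith
    · refine ENNReal.ofReal_le_ofReal ?_
      have q2 : κ * (2 * M1 * (ε * s)) ^ 2 * (1 / (1 / 2 - 1 / 4) + 1 / (3 - 2)) =
          κ * M1 ^ 2 * ε ^ 2 * (20 * ε) := by
        rw [mul_pow (2 * M1) (ε * s), mul_pow 2 M1, mul_pow ε s, hss]
        norm_num
        ring
      rw [q2]
      have : 0 ≤ κ * M1 ^ 2 * ε ^ 2 * (1 - ε) := by
        have : 0 ≤ 1 - ε := by linarith
        positivity
      simp only [abs_zero, mul_zero, zero_mul, zero_add]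
      nlinarith
  -- the boundary layer
  have hU0 : IsOpen {p : ℝ × ℝ | 0 < p.2} := isOpen_lt (by fun_prop) (by fun_prop)
  have hb0 : ContDiffOn ℝ 2 (fun p : ℝ × ℝ => b p.1 p.2) {p : ℝ × ℝ | 0 < p.2} :=
    fb_scale_cd hβ.smooth fun p hp => by
      show f (p.1 / ε) < p.2 / ε
      rw [lt_div_iff₀ hε, mul_comm]; exact (hg0 p.1).trans hp
  have hb0c : ContinuousOn (fun p : ℝ × ℝ => b p.1 p.2) {p : ℝ × ℝ | 0 ≤ p.2} :=
    fb_scale_cont hβ.cont fun p hp => by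
      show f (p.1 / ε) ≤ p.2 / ε
      rw [le_div_iff₀ hε, mul_comm]; exact (hg0 p.1).le.trans hp
  set q := fbComb b b 0 c 0 0 with hq
  have hqb : ∀ p : ℝ × ℝ, 0 < p.2 → gradSq q p.1 p.2 = gradSq b p.1 p.2 := fun p hp => by
    unfold gradSq
    rw [hq, fb_comb_pd1 0 c 0 0 hU0 hb0 hb0 (x := p.1) (y := p.2) hp,
      fb_comb_pd2 0 c 0 0 hU0 hb0 hb0 (x := p.1) (y := p.2) hp]
    ring
  have e4 : ∫⁻ p in {p : ℝ × ℝ | 0 < p.2} ∩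
      {p : ℝ × ℝ | 0 < p.1 ∧ p.1 < L ∧ 1 / 2 ≤ p.2 ∧ p.2 ≤ 1},
      ENNReal.ofReal (gradSq q p.1 p.2) ≤
      ENNReal.ofReal (32 * L * κ * B ^ 2) := by
    refine (cacc q {p : ℝ × ℝ | 0 < p.2} {p : ℝ × ℝ | 0 ≤ p.2} L (1 / 4) (1 / 2) 1 (5 / 4) 0
      (2 * B * s) hL hU0 (isClosed_le (by fun_prop) (by fun_prop)) (fun p (hp : 0 < p.2) => hp.le)
      (fb_comb_cont _ _ _ _ hb0c hb0c) (fb_comb_cd _ _ _ _ hb0 hb0)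
      (fun x y => by simp only [hq, fbComb, hbper]) (fun x y => Iff.rfl) ?_ ?_
      (by norm_num) (by norm_num) (by norm_num) ?_ (by positivity)).trans ?_
    · intro x y hp
      rw [hq, fb_comb_lap _ _ _ _ hU0 hb0 hb0 hp, hbl x y ((hg0 x).trans hp)]; ring
    · intro x y h1 h2 h3 h4
      exact absurd (show 0 < y by linarith) h2
    · intro x y h1 h3 h4
      have := hbd x y h3
      simpa [hq, fbComb] using this
    · refine ENNReal.ofReal_le_ofReal ?_
      have q2 : κ * (2 * B * s) ^ 2 * (1 / (1 / 2 - 1 / 4) + 1 / (5 / 4 - 1)) =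
          κ * B ^ 2 * (32 * ε) := by
        rw [mul_pow, mul_pow, hss]
        norm_num
        ring
      rw [q2]
      have : 0 ≤ κ * B ^ 2 * (1 - ε) * L := by
        have : 0 ≤ 1 - ε := by linarith
        positivity
      simp only [abs_zero, mul_zero, zero_mul, zero_add]
      nlinarith
  -- the error function
  set w : ℝ → ℝ → ℝ := fun x y => u x y - uFull1 C ε c β x y with hw
  have hwp : ∀ x y, 0 ≤ y → w x y = W x y := fun x y hy => by
    simp only [hw, uFull1, u01, if_pos hy, hW, fbComb, hb, fbScale, ← ha]; ring
  have hwn : ∀ x y, y < 0 → w x y = v x y := fun x y hy => by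
    simp only [hw, uFull1, u01, if_neg (not_le.2 hy), hv, fbComb, hb, fbScale, ← ha]; ring
  have hgp' : ∀ x y, 0 < y → gradSq w x y = gradSq W x y := fun x y hy => by
    have h1 : pd1 w x y = pd1 W x y := by
      unfold pd1; simp only [hwp _ _ hy.le]
    have h2 : pd2 w x y = pd2 W x y := by
      unfold pd2
      refine Filter.EventuallyEq.deriv_eq ?_
      filter_upwards [lt_mem_nhds hy] with t ht
      exact hwp x t ht.le
    unfold gradSq; rw [h1, h2]
  have hgn' : ∀ x y, y < 0 → gradSq w x y = gradSq v x y := fun x y hy => by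
    have h1 : pd1 w x y = pd1 v x y := by
      unfold pd1; simp only [hwn _ _ hy]
    have h2 : pd2 w x y = pd2 v x y := by
      unfold pd2
      refine Filter.EventuallyEq.deriv_eq ?_
      filter_upwards [gt_mem_nhds hy] with t ht
      exact hwn x t ht
    unfold gradSq; rw [h1, h2]
  have hgWv : ∀ x y, (x, y) ∈ RoughStrip f ε →
      gradSq W x y ≤ 2 * gradSq v x y + 2 * C ^ 2 * y ^ 2 := fun x y hp => by
    unfold gradSq
    rw [hW, hv, fb_comb_pd1 _ _ _ _ hU hu.smooth hbU hp, fb_comb_pd2 _ _ _ _ hU hu.smooth hbU hp,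
      fb_comb_pd1 _ _ _ _ hU hu.smooth hbU hp, fb_comb_pd2 _ _ _ _ hU hu.smooth hbU hp]
    nlinarith [sq_nonneg (pd1 u x y - a * pd1 b x y),
      sq_nonneg (pd2 u x y - a * pd2 b x y - (C / 2 - a * c) - C * y)]
  have hgWz : ∀ x y, (x, y) ∈ RoughStrip f ε →
      gradSq W x y ≤ 2 * gradSq z x y + 2 * a ^ 2 * gradSq b x y := fun x y hp => by
    unfold gradSq
    rw [hW, hz, fb_comb_pd1 _ _ _ _ hU hu.smooth hbU hp, fb_comb_pd2 _ _ _ _ hU hu.smooth hbU hp,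
      fb_comb_pd1 _ _ _ _ hU hu.smooth hbU hp, fb_comb_pd2 _ _ _ _ hU hu.smooth hbU hp]
    nlinarith [sq_nonneg (pd1 u x y + a * pd1 b x y),
      sq_nonneg (pd2 u x y + a * pd2 b x y - (C / 2 - a * c) + C * y)]
  have hwbd : ∀ x y, (x, y) ∈ RoughStrip f ε → w x y ^ 2 ≤ m ^ 2 * ε ^ 2 := by
    intro x y hp
    have h1 : |w x y| ≤ m * (ε * s) := by
      rcases le_or_gt 0 y with h | h
      · rw [hwp x y h]
        refine (hWbd x y hp.1.le hp.2.le).trans ?_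
        gcongr
        rw [hm]; linarith
      · rw [hwn x y h]
        exact hvbd x y hp.1.le (by linarith)
    rw [← sq_abs]
    calc |w x y| ^ 2 ≤ (m * (ε * s)) ^ 2 := by gcongr
      _ ≤ (m * (ε * 1)) ^ 2 := by gcongr
      _ = _ := by ring
  have hOU : OmegaEps f L ε ⊆ RoughStrip f ε := fun p hp => ⟨hp.2.2.1, hp.2.2.2⟩
  have hOm : MeasurableSet (OmegaEps f L ε) := by
    have o1 : IsOpen {p : ℝ × ℝ | 0 < p.1} := isOpen_lt (by fun_prop) (by fun_prop)
    have o2 : IsOpen {p : ℝ × ℝ | p.1 < L} := isOpen_lt (by fun_prop) (by fun_prop)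
    exact (o1.inter (o2.inter hU)).measurableSet
  have hvol : volume (OmegaEps f L ε) ≤ ENNReal.ofReal (2 * L) := by
    calc volume (OmegaEps f L ε) ≤ volume (Ioo (0:ℝ) L ×ˢ Ioo (-1:ℝ) 1) := by
          refine measure_mono ?_
          intro p hp
          have := hgl p.1
          have h3 := hp.2.2.1
          exact ⟨⟨hp.1, hp.2.1⟩, by linarith, hp.2.2.2⟩
      _ = ENNReal.ofReal (2 * L) := by
          rw [Measure.volume_eq_prod, Measure.prod_prod, Real.volume_Ioo, Real.volume_Ioo,
            ← ENNReal.ofReal_mul (by linarith)]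
          congr 1; ring
  set F : ℝ × ℝ → ℝ := fun p => w p.1 p.2 ^ 2 + gradSq w p.1 p.2 with hF
  have hF0 : ∀ p, 0 ≤ F p := fun p => add_nonneg (sq_nonneg _) (fb_gradSq_nonneg w p)
  set k := m ^ 2 * ε ^ 2 + 2 * C ^ 2 * ε ^ 2 with hk
  have hk0 : 0 ≤ k := by positivity
  have hm1 : MeasurableSet {p : ℝ × ℝ | p.2 ≤ ε / 4} := measurableSet_le (by fun_prop) (by fun_prop)
  have hm2 : MeasurableSet {p : ℝ × ℝ | ε / 4 ≤ p.2 ∧ p.2 ≤ 1 / 2} :=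
    (fb_closed_and (isClosed_le (by fun_prop) (by fun_prop))
      (isClosed_le (by fun_prop) (by fun_prop))).measurableSet
  have hm3 : MeasurableSet {p : ℝ × ℝ | 1 / 2 ≤ p.2} := measurableSet_le (by fun_prop) (by fun_prop)
  set A1 := OmegaEps f L ε ∩ {p : ℝ × ℝ | p.2 ≤ ε / 4} with hA1
  set A2 := OmegaEps f L ε ∩ {p : ℝ × ℝ | ε / 4 ≤ p.2 ∧ p.2 ≤ 1 / 2} with hA2
  set A3 := OmegaEps f L ε ∩ {p : ℝ × ℝ | 1 / 2 ≤ p.2} with hA3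
  have I1 : ∫⁻ p in A1, ENNReal.ofReal (F p) ≤ ENNReal.ofReal
      (k * (2 * L) + 2 * (L * (7 * C * m + 5 * κ * m ^ 2) * ε ^ 2)) := by
    refine fb_piece (H := fun p => 2 * gradSq v p.1 p.2) hk0 (by positivity) (by positivity)
      (fun p => mul_nonneg zero_le_two (fb_gradSq_nonneg v p)) ?_
      ((measure_mono inter_subset_left).trans hvol)
      (fb_lint_mul zero_le_two ((lintegral_mono_set ?_).trans e1))
    · filter_upwards [ae_restrict_mem (hOm.inter hm1), ae_restrict_of_ae fb_ae_ne] with p hp hp0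
      have hpU := hOU hp.1
      have hle : p.2 ≤ ε / 4 := hp.2
      have i1 := hwbd p.1 p.2 hpU
      have i3 := fb_gradSq_nonneg v p
      simp only [hF, hk]
      rcases lt_or_gt_of_ne hp0 with h | h
      · rw [hgn' _ _ h]
        have : 0 ≤ C ^ 2 * ε ^ 2 := by positivity
        linarith
      · rw [hgp' _ _ h]
        have i2 := hgWv p.1 p.2 hpU
        have : 2 * C ^ 2 * p.2 ^ 2 ≤ 2 * C ^ 2 * ε ^ 2 := by
          gcongr; linarith
        linarith
    · rintro p ⟨hp, hp2⟩
      refine ⟨hOU hp, hp.1, hp.2.1, ?_, hp2⟩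
      have := hgl p.1
      have := hp.2.2.1
      linarith
  have I2 : ∫⁻ p in A2, ENNReal.ofReal (F p) ≤ ENNReal.ofReal
      (k * (2 * L) + 12 * L * κ * M1 ^ 2 * ε ^ 2) := by
    refine fb_piece (H := fun p => gradSq W p.1 p.2) hk0 (by positivity) (by positivity)
      (fun p => (fb_gradSq_nonneg W p)) ?_
      ((measure_mono inter_subset_left).trans hvol) ((lintegral_mono_set ?_).trans e2)
    · filter_upwards [ae_restrict_mem (hOm.inter hm2)] with p hp
      have hpU := hOU hp.1
      have i1 := hwbd p.1 p.2 hpU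
      have h0 : 0 < p.2 := by have := hp.2.1; linarith
      simp only [hF, hk]
      rw [hgp' _ _ h0]
      have : 0 ≤ C ^ 2 * ε ^ 2 := by positivity
      linarith
    · rintro p ⟨hp, hp2⟩
      exact ⟨hOU hp, hp.1, hp.2.1, hp2.1, hp2.2⟩
  have I3 : ∫⁻ p in A3, ENNReal.ofReal (F p) ≤ ENNReal.ofReal
      (k * (2 * L) + (2 * (20 * L * κ * M1 ^ 2 * ε ^ 2) + 2 * a ^ 2 * (32 * L * κ * B ^ 2))) := by
    refine fb_piece (H := fun p => 2 * gradSq z p.1 p.2 + 2 * a ^ 2 * gradSq b p.1 p.2)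
      hk0 (by positivity) (by positivity)
      (fun p => add_nonneg (mul_nonneg zero_le_two (fb_gradSq_nonneg z p))
        (mul_nonneg (by positivity) (fb_gradSq_nonneg b p))) ?_
      ((measure_mono inter_subset_left).trans hvol)
      (fb_lint_add (hOm.inter hm3) (fun p => mul_nonneg zero_le_two (fb_gradSq_nonneg z p))
        (fun p => mul_nonneg (by positivity) (fb_gradSq_nonneg b p)) (by positivity) (by positivity)
        ((((fb_gradSq_cont hU hzs).mono hOU).mono inter_subset_left).const_mul 2)
        (fb_lint_mul zero_le_two ((lintegral_mono_set ?_).trans e3))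
        (fb_lint_mul (by positivity) (le_trans ?_ e4)))
    · filter_upwards [ae_restrict_mem (hOm.inter hm3)] with p hp
      have hpU := hOU hp.1
      have i1 := hwbd p.1 p.2 hpU
      have h0 : 0 < p.2 := by have : 1 / 2 ≤ p.2 := hp.2; linarith
      simp only [hF, hk]
      rw [hgp' _ _ h0]
      have i2 := hgWz p.1 p.2 hpU
      have : 0 ≤ C ^ 2 * ε ^ 2 := by positivity
      linarith
    · rintro p ⟨hp, hp2⟩
      exact ⟨hOU hp, hp.1, hp.2.1, hp2, by have := hp.2.2.2; linarith⟩
    · refine le_trans (le_of_eq (setLIntegral_congr_fun (hOm.inter hm3) ?_)) (lintegral_mono_set ?_)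
        (b := ∫⁻ p in A3, ENNReal.ofReal (gradSq q p.1 p.2))
      · intro p hp
        have h0 : 0 < p.2 := by have : 1 / 2 ≤ p.2 := hp.2; linarith
        simp only [hqb p h0]
      · rintro p ⟨hp, hp2⟩
        have hp3 : 1 / 2 ≤ p.2 := hp2
        exact ⟨show 0 < p.2 by linarith, hp.1, hp.2.1, hp2, hp.2.2.2.le⟩
  constructor
  · refine fb_integral_le hF0 (by positivity) ?_
    have hsub : OmegaEps f L ε ⊆ A1 ∪ (A2 ∪ A3) := by
      intro p hp
      rcases le_or_gt p.2 (ε / 4) with h | h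
      · exact Or.inl ⟨hp, h⟩
      · rcases le_or_gt p.2 (1 / 2) with h' | h'
        · exact Or.inr (Or.inl ⟨hp, h.le, h'⟩)
        · exact Or.inr (Or.inr ⟨hp, h'.le⟩)
    calc ∫⁻ p in OmegaEps f L ε, ENNReal.ofReal (F p)
        ≤ ∫⁻ p in A1 ∪ (A2 ∪ A3), ENNReal.ofReal (F p) := lintegral_mono_set hsub
      _ ≤ (∫⁻ p in A1, ENNReal.ofReal (F p)) + ((∫⁻ p in A2, ENNReal.ofReal (F p)) +
          ∫⁻ p in A3, ENNReal.ofReal (F p)) :=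
          (lintegral_union_le _ _ _).trans (by gcongr; exact lintegral_union_le _ _ _)
      _ ≤ _ := add_le_add I1 (add_le_add I2 I3)
      _ ≤ _ := by
          rw [← ENNReal.ofReal_add (by positivity) (by positivity),
            ← ENNReal.ofReal_add (by positivity) (by positivity)]
          refine ENNReal.ofReal_le_ofReal ?_
          have ha2 : a ^ 2 ≤ (C / 2 * ε) ^ 2 := by gcongr
          have : 2 * a ^ 2 * (32 * L * κ * B ^ 2) ≤ 2 * (C / 2 * ε) ^ 2 * (32 * L * κ * B ^ 2) := by
            gcongr
          rw [hk]
          nlinarith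
  · refine fb_integral_le (fun p => sq_nonneg _) (by positivity) ?_
    have h0 : volume (Omega0 L) ≤ ENNReal.ofReal L := by
      rw [Omega0, Measure.volume_eq_prod, Measure.prod_prod, Real.volume_Ioo, Real.volume_Ioo,
        ← ENNReal.ofReal_mul (by linarith)]
      simp
    have hmO : MeasurableSet (Omega0 L) := measurableSet_Ioo.prod measurableSet_Ioo
    have := fb_piece (A := Omega0 L) (F := fun p => w p.1 p.2 ^ 2) (H := fun _ => 0)
      (k := (M1 * (ε * s)) ^ 2) (V := L) (r := 0) (by positivity) hL.le le_rfl (fun _ => le_rfl) ?_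
      h0 (by simp)
    · refine this.trans (ENNReal.ofReal_le_ofReal (le_of_eq ?_))
      ring
    · filter_upwards [ae_restrict_mem hmO] with p hp
      rw [hwp _ _ hp.2.1.le, add_zero, ← sq_abs]
      have := hWbd p.1 p.2 ((hg0 p.1).le.trans hp.2.1.le) hp.2.2.le
      gcongr

end

end

/-- First order full boundary-layer error estimates (Proposition 3.4). -/
theorem first_order_full_boundary_layer_error
    (f : ℝ → ℝ) (K : NNReal) (δ L C : ℝ)
    (hf : LipschitzWith K f) (hper : Function.Periodic f (2 * π))
    (hδ0 : 0 < δ) (hδ1 : δ < 1) (hfb : ∀ t, -1 ≤ f t ∧ f t ≤ -δ)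
    (hL : 0 < L) (hC : 0 < C)
    (β : ℝ → ℝ → ℝ) (hβ : CellSolution f (fun t => -f t) β)
    (hβbar : 0 < interfaceAvg β) :
    ∃ c₈ > (0 : ℝ), ∃ c₉ > (0 : ℝ), ∀ ε : ℝ, 0 < ε → ε ≤ 1 →
      (∃ N : ℕ, 0 < N ∧ L = 2 * π * ε * N) →
      ∀ u : ℝ → ℝ → ℝ, RoughSolution f L C ε u →
        Real.sqrt (∫ p in OmegaEps f L ε,
            ((u p.1 p.2 - uFull1 C ε (interfaceAvg β) β p.1 p.2) ^ 2
              + gradSq (fun x y => u x y - uFull1 C ε (interfaceAvg β) β x y) p.1 p.2))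
          ≤ c₈ * ε ∧
        Real.sqrt (∫ p in Omega0 L,
            (u p.1 p.2 - uFull1 C ε (interfaceAvg β) β p.1 p.2) ^ 2)
          ≤ c₉ * ε ^ ((3 : ℝ) / 2) := by
  obtain ⟨κ, hκ, cacc⟩ := fb_cacc
  obtain ⟨B, hB, -, hdec⟩ := fb_cell hf.continuous hper hδ0 hfb hβ
  set c := interfaceAvg β with hc
  have hQ : 0 < 6 * L * ((C / 2 * (1 + 2 * B) + C / 2) ^ 2 + 2 * C ^ 2) +
        2 * L * (7 * C * (C / 2 * (1 + 2 * B) + C / 2) + 5 * κ * (C / 2 * (1 + 2 * B) + C / 2) ^ 2)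
        + 52 * L * κ * (C / 2 * (1 + 2 * B)) ^ 2 + 16 * L * κ * B ^ 2 * C ^ 2 := by positivity
  refine ⟨_, Real.sqrt_pos.2 hQ, √L * (C / 2 * (1 + 2 * B)), by positivity, ?_⟩
  rintro ε hε hε1 ⟨N, -, hN⟩ u hu
  obtain ⟨h1, h2⟩ := fb_main hκ cacc hf.continuous hper hδ0 hfb hL hC hβ hβbar hB hdec hε hε1 hN hu
  constructor
  · refine (Real.sqrt_le_sqrt h1).trans (le_of_eq ?_)
    rw [Real.sqrt_mul hQ.le, Real.sqrt_sq hε.le]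
  · refine (Real.sqrt_le_sqrt h2).trans (le_of_eq ?_)
    have e : ε ^ ((3 : ℝ) / 2) = ε * √ε := by
      rw [show (3 : ℝ) / 2 = 1 + 1 / 2 by norm_num, Real.rpow_add hε, Real.rpow_one,
        Real.sqrt_eq_rpow]
    rw [Real.sqrt_mul hL.le, Real.sqrt_sq (by positivity), e]
    ring

end
end

section
/- Assume β̄ > 0. There exists a constant K > 0 independent of ε such that for every ε ∈ (0,1] with L/(2πε) a positive integer and every classical solution u^ε of the rough problem, both averaged wall-laws have the same (at most 3/2) order of accuracy: ‖u^ε − u¹‖_{L²(Ω⁰)} ≤ K ε^{3/2} and ‖u^ε − u²‖_{L²(Ω⁰)} ≤ K ε^{3/2}, where u¹(x) = −(C/2)(x₂² − x₂/(1+εβ̄) − εβ̄/(1+εβ̄)) and u²(x) = −(C/2)(x₂² − x₂(1+ε²γ̄)/(1+εβ̄) − ε(β̄−εγ̄)/(1+εβ̄)). -/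
open MeasureTheory Real Set

noncomputable section

/-- The explicit first-order averaged wall-law solution. -/
def wallLaw1 (C ε βbar : ℝ) (x₁ x₂ : ℝ) : ℝ :=
  -(C / 2) * (x₂ ^ 2 - x₂ / (1 + ε * βbar) - ε * βbar / (1 + ε * βbar))

/-- The explicit second-order averaged wall-law solution. -/
def wallLaw2 (C ε βbar γbar : ℝ) (x₁ x₂ : ℝ) : ℝ :=
  -(C / 2) * (x₂ ^ 2 - x₂ * (1 + ε ^ 2 * γbar) / (1 + ε * βbar)
    - ε * (βbar - ε * γbar) / (1 + ε * βbar))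

open Filter Topology in
lemma reg1 {u : ℝ → ℝ → ℝ} {S : Set (ℝ × ℝ)} (hS : IsOpen S) {n m : WithTop ℕ∞} (hnm : n + 1 ≤ m)
    (h : ContDiffOn ℝ m (fun p : ℝ × ℝ => u p.1 p.2) S) :
    (∀ x y, (x, y) ∈ S → HasDerivAt (fun t => u t y) (pd1 u x y) x) ∧
    ContDiffOn ℝ n (fun p : ℝ × ℝ => pd1 u p.1 p.2) S := by
  have key : ∀ x y, (x, y) ∈ S → HasDerivAt (fun t => u t y)
      (fderiv ℝ (fun p : ℝ × ℝ => u p.1 p.2) (x, y) (1, 0)) x := by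
    intro x y hxy
    have hd : DifferentiableAt ℝ (fun p : ℝ × ℝ => u p.1 p.2) (x, y) :=
      (h.contDiffAt (hS.mem_nhds hxy)).differentiableAt (by
        intro h0; rw [h0] at hnm; simp at hnm)
    have h1 : HasDerivAt (fun t : ℝ => (t, y)) ((1 : ℝ), (0 : ℝ)) x :=
      (hasDerivAt_id x).prodMk (hasDerivAt_const x y)
    exact HasFDerivAt.comp_hasDerivAt (f := fun t : ℝ => (t, y)) x hd.hasFDerivAt h1
  have key2 : ∀ x y, (x, y) ∈ S → pd1 u x y = fderiv ℝ (fun p : ℝ × ℝ => u p.1 p.2) (x, y) (1, 0) :=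
    fun x y hxy => (key x y hxy).deriv
  refine ⟨fun x y hxy => by rw [key2 x y hxy]; exact key x y hxy, ?_⟩
  have := (h.fderiv_of_isOpen hS hnm).clm_apply (contDiffOn_const (c := ((1 : ℝ), (0 : ℝ))))
  exact this.congr (fun p hp => key2 p.1 p.2 hp)

open Filter Topology in
lemma reg2 {u : ℝ → ℝ → ℝ} {S : Set (ℝ × ℝ)} (hS : IsOpen S) {n m : WithTop ℕ∞} (hnm : n + 1 ≤ m)
    (h : ContDiffOn ℝ m (fun p : ℝ × ℝ => u p.1 p.2) S) :
    (∀ x y, (x, y) ∈ S → HasDerivAt (fun t => u x t) (pd2 u x y) y) ∧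
    ContDiffOn ℝ n (fun p : ℝ × ℝ => pd2 u p.1 p.2) S := by
  have key : ∀ x y, (x, y) ∈ S → HasDerivAt (fun t => u x t)
      (fderiv ℝ (fun p : ℝ × ℝ => u p.1 p.2) (x, y) (0, 1)) y := by
    intro x y hxy
    have hd : DifferentiableAt ℝ (fun p : ℝ × ℝ => u p.1 p.2) (x, y) :=
      (h.contDiffAt (hS.mem_nhds hxy)).differentiableAt (by
        intro h0; rw [h0] at hnm; simp at hnm)
    have h1 : HasDerivAt (fun t : ℝ => (x, t)) ((0 : ℝ), (1 : ℝ)) y :=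
      (hasDerivAt_const y x).prodMk (hasDerivAt_id y)
    exact HasFDerivAt.comp_hasDerivAt (f := fun t : ℝ => (x, t)) y hd.hasFDerivAt h1
  have key2 : ∀ x y, (x, y) ∈ S → pd2 u x y = fderiv ℝ (fun p : ℝ × ℝ => u p.1 p.2) (x, y) (0, 1) :=
    fun x y hxy => (key x y hxy).deriv
  refine ⟨fun x y hxy => by rw [key2 x y hxy]; exact key x y hxy, ?_⟩
  have := (h.fderiv_of_isOpen hS hnm).clm_apply (contDiffOn_const (c := ((0 : ℝ), (1 : ℝ))))
  exact this.congr (fun p hp => key2 p.1 p.2 hp)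

/-- All regularity facts used for a `C²` function on an open set. -/
structure Reg (S : Set (ℝ × ℝ)) (u : ℝ → ℝ → ℝ) : Prop where
  d1 : ∀ x y, (x, y) ∈ S → HasDerivAt (fun t => u t y) (pd1 u x y) x
  d2 : ∀ x y, (x, y) ∈ S → HasDerivAt (fun t => u x t) (pd2 u x y) y
  d11 : ∀ x y, (x, y) ∈ S → HasDerivAt (fun t => pd1 u t y) (pd1 (pd1 u) x y) x
  d22 : ∀ x y, (x, y) ∈ S → HasDerivAt (fun t => pd2 u x t) (pd2 (pd2 u) x y) y
  c0 : ContinuousOn (fun p : ℝ × ℝ => u p.1 p.2) S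
  c1 : ContinuousOn (fun p : ℝ × ℝ => pd1 u p.1 p.2) S
  c2 : ContinuousOn (fun p : ℝ × ℝ => pd2 u p.1 p.2) S
  c11 : ContinuousOn (fun p : ℝ × ℝ => pd1 (pd1 u) p.1 p.2) S
  c22 : ContinuousOn (fun p : ℝ × ℝ => pd2 (pd2 u) p.1 p.2) S

lemma reg_of {u : ℝ → ℝ → ℝ} {S : Set (ℝ × ℝ)} (hS : IsOpen S)
    (h : ContDiffOn ℝ 2 (fun p : ℝ × ℝ => u p.1 p.2) S) : Reg S u := by
  have a1 := reg1 (n := 1) (m := 2) hS (by norm_num) h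
  have a2 := reg2 (n := 1) (m := 2) hS (by norm_num) h
  have b1 := reg1 (n := 0) (m := 1) hS (by norm_num) a1.2
  have b2 := reg2 (n := 0) (m := 1) hS (by norm_num) a2.2
  exact ⟨a1.1, a2.1, b1.1, b2.1, h.continuousOn, a1.2.continuousOn, a2.2.continuousOn,
    b1.2.continuousOn, b2.2.continuousOn⟩

open Filter Topology in
lemma second_deriv_nonpos {g g' : ℝ → ℝ} {g'' x : ℝ} (hmax : IsLocalMax g x)
    (h1 : ∀ᶠ t in 𝓝 x, HasDerivAt g (g' t) t) (h2 : HasDerivAt g' g'' x) : g'' ≤ 0 := by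
  by_contra hpos
  push Not at hpos
  have e1 : deriv g =ᶠ[𝓝 x] g' := h1.mono fun t ht => ht.deriv
  have e2 : deriv (deriv g) x = g'' := by rw [e1.deriv_eq]; exact h2.deriv
  have hmin : IsLocalMin g x := isLocalMin_of_deriv_deriv_pos (by rw [e2]; exact hpos)
    hmax.deriv_eq_zero h1.self_of_nhds.continuousAt
  have hc : g =ᶠ[𝓝 x] fun _ => g x := by
    filter_upwards [hmax, hmin] with t a b using le_antisymm a b
  have h3 : deriv g =ᶠ[𝓝 x] deriv (fun _ => g x) := hc.deriv
  have h4 : deriv (deriv g) x = 0 := by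
    rw [h3.deriv_eq]; simp
  linarith

open Filter Topology in
/-- Maximum principle in the periodic strip above a graph. -/
lemma max_principle {φ : ℝ → ℝ} {L : ℝ} (hL : 0 < L) (hφ : Continuous φ)
    (hφL : ∀ x, φ (x + L) = φ x) (hφ0 : ∀ x, -1 ≤ φ x)
    {h h1 h2 h11 h22 : ℝ → ℝ → ℝ}
    (hc : ContinuousOn (fun p : ℝ × ℝ => h p.1 p.2) {p | 0 ≤ p.1 ∧ p.1 ≤ L ∧ φ p.1 ≤ p.2 ∧ p.2 ≤ 1})
    (hp : ∀ x y, h (x + L) y = h x y)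
    (d1 : ∀ x y, φ x < y → y < 1 → HasDerivAt (fun t => h t y) (h1 x y) x)
    (d2 : ∀ x y, φ x < y → y < 1 → HasDerivAt (fun t => h x t) (h2 x y) y)
    (d11 : ∀ x y, φ x < y → y < 1 → HasDerivAt (fun t => h1 t y) (h11 x y) x)
    (d22 : ∀ x y, φ x < y → y < 1 → HasDerivAt (fun t => h2 x t) (h22 x y) y)
    (hl : ∀ x y, 0 ≤ x → x ≤ L → φ x < y → y < 1 → h11 x y + h22 x y = 0)
    {M : ℝ} (hb : ∀ x, h x (φ x) ≤ M) (ht : ∀ x, h x 1 ≤ M)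
    {x y : ℝ} (hx0 : 0 ≤ x) (hxL : x ≤ L) (hy0 : φ x ≤ y) (hy1 : y ≤ 1) : h x y ≤ M := by
  set K : Set (ℝ × ℝ) := {p | 0 ≤ p.1 ∧ p.1 ≤ L ∧ φ p.1 ≤ p.2 ∧ p.2 ≤ 1} with hK
  have hKc : IsCompact K := by
    refine IsCompact.of_isClosed_subset (isCompact_Icc.prod isCompact_Icc : IsCompact (Icc 0 L ×ˢ Icc (-1 : ℝ) 1)) ?_ ?_
    · exact (isClosed_le continuous_const continuous_fst).inter
        ((isClosed_le continuous_fst continuous_const).inter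
        ((isClosed_le (hφ.comp continuous_fst) continuous_snd).inter
          (isClosed_le continuous_snd continuous_const)))
    · rintro ⟨a, b⟩ ⟨h1, h2, h3, h4⟩
      exact ⟨⟨h1, h2⟩, (hφ0 a).trans h3, h4⟩
  by_contra hcon
  push Not at hcon
  set η := (h x y - M) / 2 with hη
  have hη0 : 0 < η := by rw [hη]; linarith
  obtain ⟨⟨a, b⟩, ⟨ha0, haL, hb0, hb1⟩, hmax⟩ := hKc.exists_isMaxOn ⟨(x, y), hx0, hxL, hy0, hy1⟩
    (hc.add (by fun_prop : ContinuousOn (fun p : ℝ × ℝ => η * p.2 ^ 2) K))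
  simp only at ha0 haL hb0 hb1
  have hm : ∀ s t, 0 ≤ s → s ≤ L → φ s ≤ t → t ≤ 1 → h s t + η * t ^ 2 ≤ h a b + η * b ^ 2 :=
    fun s t q1 q2 q3 q4 => hmax (show (s, t) ∈ K from ⟨q1, q2, q3, q4⟩)
  have hm' : ∀ s t, φ s ≤ t → t ≤ 1 → h s t + η * t ^ 2 ≤ h a b + η * b ^ 2 := by
    intro s t q1 q2
    obtain ⟨s', hs', e⟩ := Function.Periodic.exists_mem_Ico₀
      (f := fun s => (φ s, h s t)) (c := L) (fun s => by simp [hφL, hp]) hL s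
    simp only [Prod.mk.injEq] at e
    rw [e.2]
    exact hm s' t hs'.1 hs'.2.le (e.1 ▸ q1) q2
  have hxy := hm x y hx0 hxL hy0 hy1
  have hb2 : b ^ 2 ≤ 1 := by
    have := hφ0 a
    nlinarith
  have hbig : M < h a b := by nlinarith [sq_nonneg y]
  have hlt0 : φ a < b := lt_of_le_of_ne hb0 (fun e => by
    have := hb a; rw [e] at this; linarith)
  have hlt1 : b < 1 := lt_of_le_of_ne hb1 (fun e => by
    have := ht a; rw [← e] at this; linarith)
  have e1 : ∀ᶠ t in 𝓝 a, φ t < b := hφ.continuousAt.eventually_lt continuousAt_const hlt0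
  have e2 : ∀ᶠ t in 𝓝 b, φ a < t := eventually_gt_nhds hlt0
  have e3 : ∀ᶠ t in 𝓝 b, t < 1 := eventually_lt_nhds hlt1
  have A1 : h11 a b ≤ 0 := by
    refine second_deriv_nonpos (g := fun t => h t b) (g' := fun t => h1 t b) (x := a) ?_ ?_
      (d11 a b hlt0 hlt1)
    · filter_upwards [e1] with t ht
      have := hm' t b ht.le hb1
      linarith
    · filter_upwards [e1] with t ht using d1 t b ht hlt1
  have A2 : h22 a b + η * 2 ≤ 0 := by
    refine second_deriv_nonpos (g := fun t => h a t + η * t ^ 2)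
      (g' := fun t => h2 a t + η * (2 * t)) (x := b) ?_ ?_ ?_
    · filter_upwards [e2, e3] with t ht1 ht2
      exact hm' a t ht1.le ht2.le
    · filter_upwards [e2, e3] with t ht1 ht2
      refine (d2 a t ht1 ht2).add (HasDerivAt.const_mul η ?_)
      simpa using hasDerivAt_pow 2 t
    · refine (d22 a b hlt0 hlt1).add (HasDerivAt.const_mul η ?_)
      simpa using (hasDerivAt_id b).const_mul 2
  have := hl a b ha0 haL hlt0 hlt1
  linarith

open Filter Topology in
/-- Differentiation under the integral sign. -/
lemma deriv_integral {δ : ℝ} {F F' : ℝ → ℝ → ℝ}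
    (hF : ContinuousOn (fun p : ℝ × ℝ => F p.1 p.2) {p | -δ < p.2})
    (hF' : ContinuousOn (fun p : ℝ × ℝ => F' p.1 p.2) {p | -δ < p.2})
    (hd : ∀ t Y, -δ < Y → HasDerivAt (fun s => F t s) (F' t Y) Y) {Y : ℝ} (hY : -δ < Y) :
    HasDerivAt (fun s => ∫ t in (0 : ℝ)..(2 * π), F t s) (∫ t in (0 : ℝ)..(2 * π), F' t Y) Y := by
  have slice : ∀ G : ℝ → ℝ → ℝ, ContinuousOn (fun p : ℝ × ℝ => G p.1 p.2) {p | -δ < p.2} →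
      ∀ s, -δ < s → Continuous (fun t => G t s) := by
    intro G hG s hs
    have : ContinuousOn (fun t => G t s) univ :=
      ContinuousOn.comp (g := fun p : ℝ × ℝ => G p.1 p.2) (f := fun t : ℝ => (t, s)) hG
        (by fun_prop) (fun t _ => hs)
    exact continuousOn_univ.1 this
  obtain ⟨r, hr0, hr⟩ : ∃ r > 0, -δ < Y - r := ⟨(Y + δ) / 2, by linarith, by linarith⟩
  have hcomp : IsCompact (uIcc (0 : ℝ) (2 * π) ×ˢ Icc (Y - r) (Y + r)) :=
    isCompact_uIcc.prod isCompact_Icc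
  obtain ⟨B, hB⟩ := hcomp.exists_bound_of_continuousOn (hF'.mono (by
    rintro ⟨a, b⟩ ⟨_, hb⟩; exact lt_of_lt_of_le hr hb.1))
  refine (intervalIntegral.hasDerivAt_integral_of_dominated_loc_of_deriv_le
    (F := fun s t => F t s) (F' := fun s t => F' t s) (bound := fun _ => B)
    (s := Icc (Y - r) (Y + r)) (Icc_mem_nhds (by linarith) (by linarith)) ?_ ?_ ?_ ?_ ?_ ?_).2
  · filter_upwards [eventually_gt_nhds hY] with s hs
    exact (slice F hF s hs).aestronglyMeasurable
  · exact (slice F hF Y hY).intervalIntegrable _ _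
  · exact (slice F' hF' Y hY).aestronglyMeasurable
  · refine Eventually.of_forall fun t ht s hs => hB (t, s) ⟨uIoc_subset_uIcc ht, hs⟩
  · exact intervalIntegrable_const
  · exact Eventually.of_forall fun t _ s hs => hd t s (lt_of_lt_of_le hr hs.1)

lemma const_of_deriv_zero {g : ℝ → ℝ} (h : ∀ Y, 0 ≤ Y → HasDerivAt g 0 Y) {Y : ℝ} (hY : 0 ≤ Y) :
    g Y = g 0 :=
  constant_of_has_deriv_right_zero (a := 0) (b := Y)
    (fun s hs => (h s hs.1).continuousAt.continuousWithinAt)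
    (fun s hs => (h s hs.1).hasDerivWithinAt) Y ⟨hY, le_rfl⟩

/-- ODE for the Fourier modes, with the growing solution excluded. -/
lemma ode_decay {b w : ℝ → ℝ} {k : ℝ} (hk : 0 ≤ k)
    (hb : ∀ Y, 0 ≤ Y → HasDerivAt b (w Y) Y)
    (hw : ∀ Y, 0 ≤ Y → HasDerivAt w (k ^ 2 * b Y) Y)
    (hsmall : ∀ c > 0, ∀ Y₀, ∃ Y, 0 ≤ Y ∧ Y₀ ≤ Y ∧ |w Y| < c) {Y : ℝ} (hY : 0 ≤ Y) :
    b Y = b 0 * Real.exp (-k * Y) := by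
  rcases hk.eq_or_lt with rfl | hk
  · have hwc : ∀ Y, 0 ≤ Y → w Y = w 0 := fun Y hY =>
      const_of_deriv_zero (fun Y hY => by simpa using hw Y hY) hY
    have hw0 : w 0 = 0 := by
      by_contra hne
      obtain ⟨Y, hY, -, h⟩ := hsmall |w 0| (abs_pos.2 hne) 0
      rw [hwc Y hY] at h
      exact lt_irrefl _ h
    have := const_of_deriv_zero (g := b) (fun Y hY => by
      have := hb Y hY; rwa [hwc Y hY, hw0] at this) hY
    simpa using this
  · have hexp : ∀ c Y : ℝ, HasDerivAt (fun s => Real.exp (c * s)) (c * Real.exp (c * Y)) Y := by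
      intro c Y
      have := ((hasDerivAt_id Y).const_mul c).exp
      simpa [mul_comm] using this
    have hD : ∀ Y, 0 ≤ Y → (w Y + k * b Y) * Real.exp (-k * Y) = w 0 + k * b 0 := by
      intro Y hY
      have := const_of_deriv_zero (g := fun Y => (w Y + k * b Y) * Real.exp (-k * Y))
        (fun Y hY => by
          have := ((hw Y hY).add ((hb Y hY).const_mul k)).mul (hexp (-k) Y)
          refine HasDerivAt.congr_deriv this ?_
          simp only [Pi.add_apply]; ring) hY
      simpa using this
    have hE : ∀ Y, 0 ≤ Y → (w Y - k * b Y) * Real.exp (k * Y) = w 0 - k * b 0 := by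
      intro Y hY
      have := const_of_deriv_zero (g := fun Y => (w Y - k * b Y) * Real.exp (k * Y))
        (fun Y hY => by
          have := ((hw Y hY).sub ((hb Y hY).const_mul k)).mul (hexp k Y)
          refine HasDerivAt.congr_deriv this ?_
          simp only [Pi.sub_apply]; ring) hY
      simpa using this
    have hinv : ∀ Y, Real.exp (-k * Y) * Real.exp (k * Y) = 1 := by
      intro Y; rw [← Real.exp_add]; simp
    have hD' : ∀ Y, 0 ≤ Y → w Y + k * b Y = (w 0 + k * b 0) * Real.exp (k * Y) := by
      intro Y hY; rw [← hD Y hY, mul_assoc, hinv, mul_one]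
    have hE' : ∀ Y, 0 ≤ Y → w Y - k * b Y = (w 0 - k * b 0) * Real.exp (-k * Y) := by
      intro Y hY; rw [← hE Y hY, mul_assoc, mul_comm (Real.exp _), hinv, mul_one]
    have hD0 : w 0 + k * b 0 = 0 := by
      by_contra hne
      have hpos := abs_pos.2 hne
      set D := w 0 + k * b 0
      set E := w 0 - k * b 0
      obtain ⟨Y, hY, hY0, h⟩ := hsmall 1 one_pos ((2 + |E|) / (|D| * k))
      rw [div_le_iff₀ (by positivity)] at hY0
      have e1 : 2 * w Y = D * Real.exp (k * Y) + E * Real.exp (-k * Y) := by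
        rw [← hD' Y hY, ← hE' Y hY]; ring
      have e2 : |D * Real.exp (k * Y)| ≤ |2 * w Y| + |E * Real.exp (-k * Y)| := by
        have : D * Real.exp (k * Y) = 2 * w Y - E * Real.exp (-k * Y) := by rw [e1]; ring
        rw [this]; exact abs_sub _ _
      rw [abs_mul, abs_mul, abs_mul, Real.abs_exp, Real.abs_exp, abs_two] at e2
      have e3 : Real.exp (-k * Y) ≤ 1 := by
        rw [Real.exp_le_one_iff]; nlinarith
      have e4 : k * Y + 1 ≤ Real.exp (k * Y) := Real.add_one_le_exp _
      nlinarith [abs_nonneg E, mul_le_mul_of_nonneg_left e3 (abs_nonneg E),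
        mul_le_mul_of_nonneg_left e4 (abs_nonneg D)]
    have h1 := hD' Y hY
    have h2 := hE' Y hY
    rw [hD0] at h1
    have h3 : k * (b Y - b 0 * Real.exp (-k * Y)) = 0 := by
      have h4 : w 0 = - (k * b 0) := by linarith
      rw [h4] at h2
      linear_combination (h1 - h2) / 2
    rcases mul_eq_zero.1 h3 with h | h
    · exact absurd h hk.ne'
    · linarith

open Filter Topology in
/-- Exponential decay of a Fourier mode of a finite energy periodic harmonic function. -/
lemma mode_decay {δ : ℝ} (hδ : 0 < δ) {β : ℝ → ℝ → ℝ} (hR : Reg {p | -δ < p.2} β)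
    (hper : ∀ x y, β (x + 2 * π) y = β x y)
    (hlap : ∀ x y, -δ < y → lap β x y = 0)
    (hen : IntegrableOn (fun p : ℝ × ℝ => gradSq β p.1 p.2) (Ioo 0 (2 * π) ×ˢ Ioi 0))
    {k : ℝ} (hk : 0 ≤ k) {φ φ' : ℝ → ℝ} (h1 : ∀ t, HasDerivAt φ (φ' t) t)
    (h2 : ∀ t, HasDerivAt φ' (-(k ^ 2) * φ t) t) (hφ1 : ∀ t, |φ t| ≤ 1)
    (p0 : φ (2 * π) = φ 0) (p1 : φ' (2 * π) = φ' 0) {Y : ℝ} (hY : 0 ≤ Y) :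
    ∫ t in (0 : ℝ)..(2 * π), β t Y * φ t =
      (∫ t in (0 : ℝ)..(2 * π), β t 0 * φ t) * Real.exp (-k * Y) := by
  have hφc : Continuous φ := continuous_iff_continuousAt.2 fun t => (h1 t).continuousAt
  have hφc' : Continuous φ' := continuous_iff_continuousAt.2 fun t => (h2 t).continuousAt
  have slice : ∀ G : ℝ → ℝ → ℝ, ContinuousOn (fun p : ℝ × ℝ => G p.1 p.2) {p | -δ < p.2} →
      ∀ s, 0 ≤ s → Continuous (fun t => G t s) := by
    intro G hG s hs
    have : ContinuousOn (fun t => G t s) univ :=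
      ContinuousOn.comp (g := fun p : ℝ × ℝ => G p.1 p.2) (f := fun t : ℝ => (t, s)) hG
        (by fun_prop) (fun t _ => show -δ < s by linarith)
    exact continuousOn_univ.1 this
  have cw : ContinuousOn (fun p : ℝ × ℝ => φ p.1) {p : ℝ × ℝ | -δ < p.2} := by fun_prop
  have hb : ∀ Y, 0 ≤ Y → HasDerivAt (fun s => ∫ t in (0 : ℝ)..(2 * π), β t s * φ t)
      (∫ t in (0 : ℝ)..(2 * π), pd2 β t Y * φ t) Y := fun Y hY =>
    deriv_integral (δ := δ) (F := fun t s => β t s * φ t) (F' := fun t s => pd2 β t s * φ t)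
      (hR.c0.mul cw) (hR.c2.mul cw) (fun t Y hY => (hR.d2 t Y hY).mul_const _) (by linarith)
  have hw : ∀ Y, 0 ≤ Y → HasDerivAt (fun s => ∫ t in (0 : ℝ)..(2 * π), pd2 β t s * φ t)
      (∫ t in (0 : ℝ)..(2 * π), pd2 (pd2 β) t Y * φ t) Y := fun Y hY =>
    deriv_integral (δ := δ) (F := fun t s => pd2 β t s * φ t)
      (F' := fun t s => pd2 (pd2 β) t s * φ t)
      (hR.c2.mul cw) (hR.c22.mul cw) (fun t Y hY => (hR.d22 t Y hY).mul_const _) (by linarith)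
  have hper1 : ∀ x y, pd1 β (x + 2 * π) y = pd1 β x y := by
    intro x y
    unfold pd1
    rw [← deriv_comp_add_const]
    congr 1
    funext t
    exact hper t y
  have hode : ∀ Y, 0 ≤ Y → ∫ t in (0 : ℝ)..(2 * π), pd2 (pd2 β) t Y * φ t =
      k ^ 2 * ∫ t in (0 : ℝ)..(2 * π), β t Y * φ t := by
    intro Y hY
    have c11 := slice _ hR.c11 Y hY
    have c22 := slice _ hR.c22 Y hY
    have c0 := slice _ hR.c0 Y hY
    have hI : ∫ t in (0 : ℝ)..(2 * π), (pd1 (pd1 β) t Y * φ t + k ^ 2 * (β t Y * φ t)) = 0 := by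
      rw [intervalIntegral.integral_eq_sub_of_hasDerivAt
        (f := fun t => pd1 β t Y * φ t - β t Y * φ' t)]
      · have e1 := hper 0 Y
        have e2 := hper1 0 Y
        rw [zero_add] at e1 e2
        rw [e1, e2, p0, p1]; ring
      · intro t _
        have := ((hR.d11 t Y (show -δ < Y by linarith)).mul (h1 t)).sub
          ((hR.d1 t Y (show -δ < Y by linarith)).mul (h2 t))
        refine HasDerivAt.congr_deriv this ?_
        ring
      · exact Continuous.intervalIntegrable (by fun_prop) _ _
    rw [intervalIntegral.integral_add (Continuous.intervalIntegrable (by fun_prop) _ _)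
      (Continuous.intervalIntegrable (by fun_prop) _ _), intervalIntegral.integral_const_mul] at hI
    have hneg : ∫ t in (0 : ℝ)..(2 * π), pd2 (pd2 β) t Y * φ t =
        - ∫ t in (0 : ℝ)..(2 * π), pd1 (pd1 β) t Y * φ t := by
      rw [← intervalIntegral.integral_neg]
      congr 1
      funext t
      have := hlap t Y (by linarith)
      unfold lap at this
      have e : pd2 (pd2 β) t Y = - pd1 (pd1 β) t Y := by linarith
      rw [e]; ring
    rw [hneg]; linarith
  refine ode_decay (b := fun s => ∫ t in (0 : ℝ)..(2 * π), β t s * φ t)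
    (w := fun s => ∫ t in (0 : ℝ)..(2 * π), pd2 β t s * φ t) hk hb
    (fun Y hY => by rw [← hode Y hY]; exact hw Y hY) ?_ hY
  -- smallness of the derivative along a sequence, from the finite energy
  intro c hc Y₀
  by_contra hcon
  push Not at hcon
  have hG : IntegrableOn (fun s => ∫ t in Ioo 0 (2 * π), gradSq β t s) (Ioi (0 : ℝ)) := by
    have h : Integrable (fun p : ℝ × ℝ => gradSq β p.1 p.2)
        ((volume.restrict (Ioo 0 (2 * π))).prod (volume.restrict (Ioi (0 : ℝ)))) := by
      rw [Measure.prod_restrict]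
      exact hen
    exact h.integral_prod_right
  have hlow : ∀ s, 0 ≤ s → Y₀ ≤ s → c ^ 2 / (2 * π) ≤ ∫ t in Ioo 0 (2 * π), gradSq β t s := by
    intro s hs hs'
    have hcs := hcon s hs hs'
    have c1 := slice _ hR.c1 s hs
    have c2 := slice _ hR.c2 s hs
    have hpi := Real.pi_pos
    set G := ∫ t in Ioo 0 (2 * π), gradSq β t s with hGdef
    have hG' : G = ∫ t in (0 : ℝ)..(2 * π), gradSq β t s := by
      rw [intervalIntegral.integral_of_le (by positivity), integral_Ioc_eq_integral_Ioo]
    set η := c / (2 * π) with hη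
    have hη0 : 0 < η := by positivity
    have hle : |∫ t in (0 : ℝ)..(2 * π), pd2 β t s * φ t| ≤
        ∫ t in (0 : ℝ)..(2 * π), (η / 2 + gradSq β t s * (1 / (2 * η))) := by
      rw [← Real.norm_eq_abs]
      refine intervalIntegral.norm_integral_le_of_norm_le (by positivity) ?_ ?_
      · refine Eventually.of_forall fun t _ => ?_
        rw [Real.norm_eq_abs, abs_mul]
        have : |pd2 β t s| * |φ t| ≤ |pd2 β t s| :=
          mul_le_of_le_one_right (abs_nonneg _) (hφ1 t)
        refine this.trans ?_
        have e : |pd2 β t s| ≤ η / 2 + (pd2 β t s) ^ 2 * (1 / (2 * η)) := by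
          have h0 : η / 2 + (pd2 β t s) ^ 2 * (1 / (2 * η)) - |pd2 β t s| =
              (|pd2 β t s| - η) ^ 2 / (2 * η) := by
            rw [← sq_abs (pd2 β t s)]
            field_simp; ring
          have : 0 ≤ (|pd2 β t s| - η) ^ 2 / (2 * η) := by positivity
          linarith
        refine e.trans ?_
        have : (pd2 β t s) ^ 2 ≤ gradSq β t s := by
          unfold gradSq; nlinarith [sq_nonneg (pd1 β t s)]
        gcongr
      · unfold gradSq
        exact Continuous.intervalIntegrable (by fun_prop) _ _
    rw [intervalIntegral.integral_add intervalIntegrable_const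
      (by unfold gradSq; exact Continuous.intervalIntegrable (by fun_prop) _ _),
      intervalIntegral.integral_mul_const, ← hG', intervalIntegral.integral_const] at hle
    simp only [sub_zero, smul_eq_mul] at hle
    have e1 : 2 * π * (η / 2) = c / 2 := by rw [hη]; field_simp
    have e2 : G * (1 / (2 * η)) = G * π / c := by rw [hη]; field_simp
    rw [e1, e2] at hle
    have h3 : c / 2 ≤ G * π / c := by linarith
    rw [le_div_iff₀ hc] at h3
    rw [div_le_iff₀ (by positivity)]
    nlinarith
  have hint : IntegrableOn (fun _ : ℝ => c ^ 2 / (2 * π)) (Ioi (max Y₀ 0)) := by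
    have hG2 := hG.mono_set (Ioi_subset_Ioi (le_max_right Y₀ 0))
    refine Integrable.mono' hG2 aestronglyMeasurable_const ?_
    refine (ae_restrict_iff' measurableSet_Ioi).2 (Eventually.of_forall fun s hs => ?_)
    have hs' : max Y₀ 0 < s := hs
    rw [Real.norm_of_nonneg (by positivity)]
    exact hlow s (le_trans (le_max_right _ _) hs'.le) (le_trans (le_max_left _ _) hs'.le)
  rw [integrableOn_const_iff (by simp)] at hint
  rcases hint with h | h
  · simp [hc.ne', Real.pi_pos.ne'] at h
  · simp at h

lemma summable_exp_int : Summable (fun n : ℤ => Real.exp (1 - |(n : ℝ)|)) := by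
  have h : Summable (fun n : ℕ => Real.exp (1 - (n : ℝ))) := by
    have := (Real.summable_exp_nat_mul_iff (a := -1)).2 (by norm_num)
    refine (this.mul_left (Real.exp 1)).congr fun n => ?_
    rw [← Real.exp_add]; congr 1; ring
  refine Summable.of_nat_of_neg ?_ ?_ <;> simpa using h

open Filter Topology in
/-- A finite energy periodic harmonic function converges exponentially to its mean. -/
lemma exp_decay {δ : ℝ} (hδ : 0 < δ) {β : ℝ → ℝ → ℝ} (hR : Reg {p | -δ < p.2} β)
    (hper : ∀ x y, β (x + 2 * π) y = β x y)
    (hlap : ∀ x y, -δ < y → lap β x y = 0)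
    (hen : IntegrableOn (fun p : ℝ × ℝ => gradSq β p.1 p.2) (Ioo 0 (2 * π) ×ˢ Ioi 0)) :
    ∃ M > 0, ∀ x y, 0 ≤ y → |β x y - interfaceAvg β| ≤ M * Real.exp (-y) := by
  have hpi := Real.pi_pos
  obtain ⟨S, hS⟩ : ∃ S, ∀ x y, 0 ≤ y → y ≤ 1 → |β x y| ≤ S := by
    have hcomp : IsCompact (Icc (0 : ℝ) (2 * π) ×ˢ Icc (0 : ℝ) 1) :=
      isCompact_Icc.prod isCompact_Icc
    obtain ⟨B, hB⟩ := hcomp.exists_bound_of_continuousOn (hR.c0.mono (by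
      rintro ⟨a, b⟩ ⟨_, hb⟩; exact lt_of_lt_of_le (by linarith : -δ < 0) hb.1))
    refine ⟨B, fun x y h0 h1 => ?_⟩
    obtain ⟨x', hx', e⟩ := Function.Periodic.exists_mem_Ico₀
      (f := fun s => β s y) (c := 2 * π) (fun s => hper s y) (by positivity) x
    rw [show β x y = β x' y from e]
    exact hB (x', y) ⟨⟨hx'.1, hx'.2.le⟩, h0, h1⟩
  have hS0 : 0 ≤ S := (abs_nonneg _).trans (hS 0 0 le_rfl zero_le_one)
  have slice : ∀ s, 0 ≤ s → Continuous (fun t => β t s) := by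
    intro s hs
    have : ContinuousOn (fun t => β t s) univ :=
      ContinuousOn.comp (g := fun p : ℝ × ℝ => β p.1 p.2) (f := fun t : ℝ => (t, s)) hR.c0
        (by fun_prop) (fun t _ => show -δ < s by linarith)
    exact continuousOn_univ.1 this
  -- the two families of modes
  have hcos : ∀ n : ℤ, ∀ Y, 0 ≤ Y → ∫ t in (0 : ℝ)..(2 * π), β t Y * Real.cos (n * t) =
      (∫ t in (0 : ℝ)..(2 * π), β t 0 * Real.cos (n * t)) * Real.exp (-|(n : ℝ)| * Y) := by
    intro n Y hY
    have hl : ∀ t : ℝ, HasDerivAt (fun t : ℝ => (n : ℝ) * t) n t := fun t => by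
      simpa using (hasDerivAt_id t).const_mul (n : ℝ)
    refine mode_decay hδ hR hper hlap hen (abs_nonneg _)
      (φ := fun t => Real.cos (n * t)) (φ' := fun t => -(n * Real.sin (n * t))) ?_ ?_ ?_ ?_ ?_ hY
    · intro t
      refine HasDerivAt.congr_deriv (hl t).cos ?_
      ring
    · intro t
      refine HasDerivAt.congr_deriv ((hl t).sin.const_mul (n : ℝ)).neg ?_
      rw [sq_abs]; ring
    · intro t; exact Real.abs_cos_le_one _
    · simp [Real.cos_int_mul_two_pi]
    · have : Real.sin (n * (2 * π)) = 0 := by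
        have := Real.sin_int_mul_pi (2 * n); push_cast at this; rw [← this]; congr 1; ring
      simp [this]
  have hsin : ∀ n : ℤ, ∀ Y, 0 ≤ Y → ∫ t in (0 : ℝ)..(2 * π), β t Y * Real.sin (n * t) =
      (∫ t in (0 : ℝ)..(2 * π), β t 0 * Real.sin (n * t)) * Real.exp (-|(n : ℝ)| * Y) := by
    intro n Y hY
    have hl : ∀ t : ℝ, HasDerivAt (fun t : ℝ => (n : ℝ) * t) n t := fun t => by
      simpa using (hasDerivAt_id t).const_mul (n : ℝ)
    refine mode_decay hδ hR hper hlap hen (abs_nonneg _)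
      (φ := fun t => Real.sin (n * t)) (φ' := fun t => n * Real.cos (n * t)) ?_ ?_ ?_ ?_ ?_ hY
    · intro t
      refine HasDerivAt.congr_deriv (hl t).sin ?_
      ring
    · intro t
      refine HasDerivAt.congr_deriv ((hl t).cos.const_mul (n : ℝ)) ?_
      rw [sq_abs]; ring
    · intro t; exact Real.abs_sin_le_one _
    · have : Real.sin (n * (2 * π)) = 0 := by
        have := Real.sin_int_mul_pi (2 * n); push_cast at this; rw [← this]; congr 1; ring
      simp [this]
    · simp [Real.cos_int_mul_two_pi]
  have hbd : ∀ ψ : ℝ → ℝ, (∀ t, |ψ t| ≤ 1) →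
      |∫ t in (0 : ℝ)..(2 * π), β t 0 * ψ t| ≤ S * (2 * π) := by
    intro ψ hψ
    have := intervalIntegral.norm_integral_le_of_norm_le_const (a := 0) (b := 2 * π) (C := S)
      (f := fun t => β t 0 * ψ t) (fun t _ => by
        rw [Real.norm_eq_abs, abs_mul]
        exact (mul_le_of_le_one_right (abs_nonneg _) (hψ t)).trans (hS t 0 le_rfl zero_le_one))
    rw [Real.norm_eq_abs, sub_zero, abs_of_pos (by positivity : 0 < 2 * π)] at this
    exact this
  have hmean : |interfaceAvg β| ≤ S := by
    unfold interfaceAvg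
    have := hbd (fun _ => 1) (by simp)
    simp only [mul_one] at this
    rw [abs_mul, abs_of_pos (by positivity), one_div, inv_mul_le_iff₀ (by positivity)]
    linarith
  have : Fact (0 < 2 * π) := ⟨by positivity⟩
  set Q := ∑' n : ℤ, 2 * S * Real.exp (1 - |(n : ℝ)|) with hQ
  have hQ0 : 0 ≤ Q := tsum_nonneg fun n => by positivity
  have hfar : ∀ x y, 1 ≤ y → |β x y - interfaceAvg β| ≤ Q * Real.exp (-y) := by
    intro x Y hY
    have hY0 : 0 ≤ Y := by linarith
    have hpc : Function.Periodic (fun t => (β t Y : ℂ)) (2 * π) := fun t => by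
      simp [hper]
    let F : C(AddCircle (2 * π), ℂ) := ⟨hpc.lift, by
      refine continuous_coinduced_dom.mpr ?_
      exact Complex.continuous_ofReal.comp (slice Y hY0)⟩
    have hFx : ∀ t : ℝ, F (t : AddCircle (2 * π)) = (β t Y : ℂ) := fun t => rfl
    have hcoef : ∀ n : ℤ, fourierCoeff F n = (1 / (2 * π) : ℝ) *
        (((∫ t in (0 : ℝ)..(2 * π), β t Y * Real.cos (n * t) : ℝ) : ℂ) -
          Complex.I * ((∫ t in (0 : ℝ)..(2 * π), β t Y * Real.sin (n * t) : ℝ) : ℂ)) := by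
      intro n
      rw [fourierCoeff_eq_intervalIntegral F n 0, zero_add, Complex.real_smul]
      congr 1
      rw [← intervalIntegral.integral_ofReal, ← intervalIntegral.integral_ofReal,
        ← intervalIntegral.integral_const_mul, ← intervalIntegral.integral_sub]
      · refine intervalIntegral.integral_congr fun t _ => ?_
        rw [hFx, fourier_coe_apply, smul_eq_mul]
        have : (2 * (π : ℂ) * Complex.I * ((-n : ℤ) : ℂ) * (t : ℂ) / ((2 * π : ℝ) : ℂ)) =
            ((-(n * t) : ℝ) : ℂ) * Complex.I := by
          have : (π : ℂ) ≠ 0 := by exact_mod_cast hpi.ne'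
          push_cast
          field_simp
        rw [this, Complex.exp_mul_I, ← Complex.ofReal_cos, ← Complex.ofReal_sin, Real.cos_neg,
          Real.sin_neg]
        push_cast
        ring
      · have := slice Y hY0
        exact Continuous.intervalIntegrable (by fun_prop) _ _
      · have := slice Y hY0
        exact Continuous.intervalIntegrable (by fun_prop) _ _
    have hcb : ∀ n : ℤ, ‖fourierCoeff F n‖ ≤ 2 * S * Real.exp (-|(n : ℝ)| * Y) := by
      intro n
      rw [hcoef, hcos n Y hY0, hsin n Y hY0, norm_mul, Complex.norm_real, Real.norm_eq_abs,
        abs_of_pos (by positivity)]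
      have a1 := hbd (fun t => Real.cos (n * t)) (fun t => Real.abs_cos_le_one _)
      have a2 := hbd (fun t => Real.sin (n * t)) (fun t => Real.abs_sin_le_one _)
      set A := ∫ t in (0 : ℝ)..(2 * π), β t 0 * Real.cos (n * t)
      set B := ∫ t in (0 : ℝ)..(2 * π), β t 0 * Real.sin (n * t)
      set E := Real.exp (-|(n : ℝ)| * Y) with hE
      have hE0 : 0 < E := Real.exp_pos _
      have : ‖((A * E : ℝ) : ℂ) - Complex.I * ((B * E : ℝ) : ℂ)‖ ≤ |A| * E + |B| * E := by
        refine (norm_sub_le _ _).trans ?_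
        rw [norm_mul, Complex.norm_I, one_mul, Complex.norm_real, Complex.norm_real,
          Real.norm_eq_abs, Real.norm_eq_abs, abs_mul, abs_mul, abs_of_pos hE0]
      rw [one_div, inv_mul_le_iff₀ (by positivity)]
      refine this.trans ?_
      nlinarith
    have hexp : ∀ n : ℤ, n ≠ 0 → Real.exp (-|(n : ℝ)| * Y) ≤
        Real.exp (1 - |(n : ℝ)|) * Real.exp (-Y) := by
      intro n hn
      rw [← Real.exp_add, Real.exp_le_exp]
      have : (1 : ℝ) ≤ |(n : ℝ)| := by exact_mod_cast Int.one_le_abs hn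
      nlinarith
    have hsum : Summable (fourierCoeff F) := by
      refine Summable.of_norm_bounded (summable_exp_int.mul_left (2 * S)) fun n => ?_
      refine (hcb n).trans ?_
      have : Real.exp (-|(n : ℝ)| * Y) ≤ Real.exp (1 - |(n : ℝ)|) := by
        rw [Real.exp_le_exp]
        nlinarith [abs_nonneg (n : ℝ)]
      gcongr
    have hs := hasSum_ite_sub_hasSum
      (has_pointwise_sum_fourier_series_of_summable hsum (x : AddCircle (2 * π))) 0
    have h0 : fourierCoeff F 0 = (interfaceAvg β : ℂ) := by
      rw [hcoef, hcos 0 Y hY0, hsin 0 Y hY0]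
      unfold interfaceAvg
      simp
    rw [h0, hFx] at hs
    have hg : HasSum (fun n : ℤ => 2 * S * Real.exp (1 - |(n : ℝ)|) * Real.exp (-Y))
        (Q * Real.exp (-Y)) :=
      (summable_exp_int.mul_left (2 * S)).hasSum.mul_right _
    have := hs.norm_le_of_bounded hg (fun n => by
      by_cases hn : n = 0
      · simp only [hn, if_true, norm_zero]; positivity
      · simp only [hn, if_false]
        rw [norm_smul, fourier_apply, Circle.norm_coe, mul_one]
        refine (hcb n).trans ?_
        rw [mul_assoc (2 * S)]
        exact mul_le_mul_of_nonneg_left (hexp n hn) (by positivity))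
    simp only [fourier_zero, smul_eq_mul, mul_one] at this
    rw [← Complex.ofReal_sub, Complex.norm_real, Real.norm_eq_abs] at this
    exact this
  refine ⟨Q + 2 * S * Real.exp 1 + 1, by positivity, fun x y hy => ?_⟩
  have he := Real.exp_pos (-y)
  rcases le_total 1 y with h | h
  · refine (hfar x y h).trans ?_
    gcongr
    have := Real.exp_pos 1
    nlinarith
  · have h1 : |β x y - interfaceAvg β| ≤ 2 * S := by
      refine (abs_sub _ _).trans ?_
      have := hS x y hy h
      linarith
    have h2 : 1 ≤ Real.exp 1 * Real.exp (-y) := by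
      rw [← Real.exp_add, Real.one_le_exp_iff]; linarith
    nlinarith [mul_nonneg hQ0 he.le]

open Filter Topology in
/-- The equation holds up to the lateral sides of the periodicity cell. -/
lemma eqn_closed {f : ℝ → ℝ} {L C ε : ℝ} {u : ℝ → ℝ → ℝ} (hL : 0 < L) (hf : Continuous f)
    (hR : Reg (RoughStrip f ε) u) (hS : IsOpen (RoughStrip f ε)) (hu : RoughSolution f L C ε u)
    {x y : ℝ} (hx0 : 0 ≤ x) (hxL : x ≤ L) (hy0 : ε * f (x / ε) < y) (hy1 : y < 1) :
    lap u x y = -C := by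
  have hmem : (x, y) ∈ RoughStrip f ε := ⟨hy0, hy1⟩
  have hc : ContinuousAt (fun s => lap u s y) x := by
    have h : ContinuousAt (fun p : ℝ × ℝ => lap u p.1 p.2) (x, y) :=
      (hR.c11.add hR.c22).continuousAt (hS.mem_nhds hmem)
    exact ContinuousAt.comp (f := fun s : ℝ => (s, y)) (x := x) h (by fun_prop)
  have hcl : x ∈ closure (Ioo 0 L) := by rw [closure_Ioo hL.ne]; exact ⟨hx0, hxL⟩
  have hne : (𝓝[Ioo 0 L] x).NeBot := mem_closure_iff_nhdsWithin_neBot.1 hcl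
  have hcf : Continuous (fun s : ℝ => ε * f (s / ε)) := by fun_prop
  have hev : ∀ᶠ s in 𝓝[Ioo 0 L] x, lap u s y = -C := by
    have e1 : ∀ᶠ s in 𝓝[Ioo 0 L] x, ε * f (s / ε) < y :=
      nhdsWithin_le_nhds (hcf.continuousAt.eventually_lt continuousAt_const hy0)
    filter_upwards [e1, self_mem_nhdsWithin] with s hs1 hs2
    have := hu.eqn (s, y) ⟨hs2.1, hs2.2, hs1, hy1⟩
    simp only at this
    linarith
  have t1 : Tendsto (fun s => lap u s y) (𝓝[Ioo 0 L] x) (𝓝 (lap u x y)) :=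
    hc.tendsto.mono_left nhdsWithin_le_nhds
  exact tendsto_nhds_unique t1 ((tendsto_congr' hev).2 tendsto_const_nhds)

lemma cell_subset_closure {f : ℝ → ℝ} {L ε : ℝ} (hL : 0 < L) (hf : Continuous f)
    (hlt : ∀ x, ε * f (x / ε) < 1) :
    {p : ℝ × ℝ | 0 ≤ p.1 ∧ p.1 ≤ L ∧ ε * f (p.1 / ε) ≤ p.2 ∧ p.2 ≤ 1} ⊆
      closure (OmegaEps f L ε) := by
  let Φ : ℝ × ℝ → ℝ × ℝ := fun q => (q.1, (1 - q.2) * (ε * f (q.1 / ε)) + q.2)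
  have hΦ : Continuous Φ := by fun_prop
  have himg : Φ '' (Ioo 0 L ×ˢ Ioo (0 : ℝ) 1) ⊆ OmegaEps f L ε := by
    rintro _ ⟨⟨a, s⟩, ⟨ha, hs⟩, rfl⟩
    simp only [mem_Ioo] at ha hs
    have := hlt a
    refine ⟨ha.1, ha.2, ?_, ?_⟩ <;> simp only [Φ] <;> nlinarith
  rintro ⟨x, y⟩ ⟨h1, h2, h3, h4⟩
  simp only at h1 h2 h3 h4
  have hb := hlt x
  refine closure_mono himg (image_closure_subset_closure_image hΦ ?_)
  refine ⟨(x, (y - ε * f (x / ε)) / (1 - ε * f (x / ε))), ?_, ?_⟩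
  · rw [closure_prod_eq, closure_Ioo hL.ne, closure_Ioo zero_ne_one]
    refine ⟨⟨h1, h2⟩, div_nonneg (by linarith) (by linarith), ?_⟩
    simp only
    rw [div_le_one (by linarith)]; linarith
  · have : 1 - ε * f (x / ε) ≠ 0 := by linarith
    simp only [Φ, Prod.mk.injEq, true_and]
    field_simp
    ring

/-- Pointwise estimate by the maximum principle. -/
lemma pointwise_bound {f : ℝ → ℝ} {δ L C : ℝ} (hf : Continuous f)
    (hper : Function.Periodic f (2 * π))
    (hδ0 : 0 < δ) (hfb : ∀ t, -1 ≤ f t ∧ f t ≤ -δ) (hL : 0 < L) (hC : 0 < C)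
    {β : ℝ → ℝ → ℝ} (hβ : CellSolution f (fun t => -f t) β) (hβbar : 0 < interfaceAvg β)
    {M : ℝ} (hM0 : 0 < M)
    (hM : ∀ x y, 0 ≤ y → |β x y - interfaceAvg β| ≤ M * Real.exp (-y))
    {ε : ℝ} (hε0 : 0 < ε) (hε1 : ε ≤ 1) (hN : ∃ N : ℕ, 0 < N ∧ L = 2 * π * ε * N)
    {u : ℝ → ℝ → ℝ} (hu : RoughSolution f L C ε u) {x y : ℝ}
    (hx0 : 0 ≤ x) (hxL : x ≤ L) (hy0 : 0 ≤ y) (hy1 : y ≤ 1) :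
    |u x y - wallLaw1 C ε (interfaceAvg β) x y| ≤
      C / 2 * (1 + M) * (ε ^ 2 + ε * Real.exp (-(y / ε))) := by
  set b := interfaceAvg β with hb
  set A := 1 / (1 + ε * b) with hA
  have hden : 0 < 1 + ε * b := by positivity
  have hA0 : 0 < A := by positivity
  have hA1 : A ≤ 1 := by rw [hA, div_le_one hden]; nlinarith
  have hAb : A * (1 + ε * b) = 1 := by rw [hA]; field_simp
  obtain ⟨N, hN0, hLN⟩ := hN
  have hshift : ∀ x : ℝ, (x + L) / ε = x / ε + N * (2 * π) := by
    intro x; rw [hLN]; field_simp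
  have hφL : ∀ x, ε * f ((x + L) / ε) = ε * f (x / ε) := by
    intro x; rw [hshift, hper.nat_mul N]
  have hβL : ∀ x y, β ((x + L) / ε) y = β (x / ε) y := by
    intro x y
    rw [hshift]
    exact (show Function.Periodic (fun t => β t y) (2 * π) from fun t => hβ.periodic t y).nat_mul N _
  have hφneg : ∀ x, ε * f (x / ε) < 0 := fun x => by
    have := (hfb (x / ε)).2; nlinarith
  have hφ0 : ∀ x, -1 ≤ ε * f (x / ε) := fun x => by
    have := (hfb (x / ε)).1; nlinarith
  have hcf : Continuous (fun s : ℝ => ε * f (s / ε)) := by fun_prop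
  have hS : IsOpen (RoughStrip f ε) :=
    (isOpen_lt (hcf.comp continuous_fst) continuous_snd).inter
      (isOpen_lt continuous_snd continuous_const)
  have hU : IsOpen {p : ℝ × ℝ | f p.1 < p.2} := isOpen_lt (hf.comp continuous_fst) continuous_snd
  have Ru := reg_of hS hu.smooth
  have Rβ := reg_of hU hβ.smooth
  have hscale : ∀ x y, ε * f (x / ε) < y → (x / ε, y / ε) ∈ {p : ℝ × ℝ | f p.1 < p.2} := by
    intro x y h
    simp only [Set.mem_ofPred_eq]
    rw [lt_div_iff₀ hε0]; linarith
  have hdiv : ∀ s : ℝ, HasDerivAt (fun t : ℝ => t / ε) (1 / ε) s := fun s =>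
    (hasDerivAt_id s).div_const ε
  set h : ℝ → ℝ → ℝ := fun x y =>
    u x y - C / 2 * (-y ^ 2 + A * y + A * ε * β (x / ε) (y / ε)) with hh
  set h1 : ℝ → ℝ → ℝ := fun x y => pd1 u x y - C / 2 * (A * pd1 β (x / ε) (y / ε)) with hh1
  set h2 : ℝ → ℝ → ℝ := fun x y =>
    pd2 u x y - C / 2 * (-(2 * y) + A + A * pd2 β (x / ε) (y / ε)) with hh2
  set h11 : ℝ → ℝ → ℝ := fun x y =>
    pd1 (pd1 u) x y - C / 2 * (A / ε * pd1 (pd1 β) (x / ε) (y / ε)) with hh11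
  set h22 : ℝ → ℝ → ℝ := fun x y =>
    pd2 (pd2 u) x y - C / 2 * (-2 + A / ε * pd2 (pd2 β) (x / ε) (y / ε)) with hh22
  have d1 : ∀ x y, ε * f (x / ε) < y → y < 1 → HasDerivAt (fun t => h t y) (h1 x y) x := by
    intro x y q1 q2
    have e := HasDerivAt.comp x (Rβ.d1 _ _ (hscale x y q1)) (hdiv x)
    have := (Ru.d1 x y ⟨q1, q2⟩).sub
      (((e.const_mul (A * ε)).const_add (-y ^ 2 + A * y)).const_mul (C / 2))
    refine HasDerivAt.congr_deriv this ?_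
    simp only [hh1]; field_simp
  have d11 : ∀ x y, ε * f (x / ε) < y → y < 1 → HasDerivAt (fun t => h1 t y) (h11 x y) x := by
    intro x y q1 q2
    have e := HasDerivAt.comp x (Rβ.d11 _ _ (hscale x y q1)) (hdiv x)
    have := (Ru.d11 x y ⟨q1, q2⟩).sub ((e.const_mul A).const_mul (C / 2))
    refine HasDerivAt.congr_deriv this ?_
    simp only [hh11]; field_simp
  have d2 : ∀ x y, ε * f (x / ε) < y → y < 1 → HasDerivAt (fun t => h x t) (h2 x y) y := by
    intro x y q1 q2
    have e := HasDerivAt.comp y (Rβ.d2 _ _ (hscale x y q1)) (hdiv y)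
    have := (Ru.d2 x y ⟨q1, q2⟩).sub
      ((((hasDerivAt_pow 2 y).neg.add ((hasDerivAt_id y).const_mul A)).add
        (e.const_mul (A * ε))).const_mul (C / 2))
    refine HasDerivAt.congr_deriv this ?_
    simp only [hh2]; field_simp; norm_num
  have d22 : ∀ x y, ε * f (x / ε) < y → y < 1 → HasDerivAt (fun t => h2 x t) (h22 x y) y := by
    intro x y q1 q2
    have e := HasDerivAt.comp y (Rβ.d22 _ _ (hscale x y q1)) (hdiv y)
    have := (Ru.d22 x y ⟨q1, q2⟩).sub
      (((((hasDerivAt_id y).const_mul 2).neg.add_const A).add (e.const_mul A)).const_mul (C / 2))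
    refine HasDerivAt.congr_deriv this ?_
    simp only [hh22]; field_simp
  have hl : ∀ x y, 0 ≤ x → x ≤ L → ε * f (x / ε) < y → y < 1 → h11 x y + h22 x y = 0 := by
    intro x y q1 q2 q3 q4
    have e1 := eqn_closed hL hf Ru hS hu q1 q2 q3 q4
    have e2 := hβ.harmonic (x / ε, y / ε) (hscale x y q3)
    simp only [lap] at e1 e2
    simp only [hh11, hh22]
    linear_combination e1 - C / 2 * (A / ε) * e2
  have hc : ContinuousOn (fun p : ℝ × ℝ => h p.1 p.2)
      {p | 0 ≤ p.1 ∧ p.1 ≤ L ∧ ε * f (p.1 / ε) ≤ p.2 ∧ p.2 ≤ 1} := by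
    have c1 := hu.cont.mono (cell_subset_closure hL hf (fun x => (hφneg x).trans one_pos))
    have c2 : ContinuousOn (fun p : ℝ × ℝ => β (p.1 / ε) (p.2 / ε))
        {p | 0 ≤ p.1 ∧ p.1 ≤ L ∧ ε * f (p.1 / ε) ≤ p.2 ∧ p.2 ≤ 1} := by
      refine ContinuousOn.comp (g := fun p : ℝ × ℝ => β p.1 p.2)
        (f := fun p : ℝ × ℝ => (p.1 / ε, p.2 / ε)) hβ.cont (by fun_prop) ?_
      rintro ⟨a, c⟩ ⟨_, _, q, _⟩
      simp only [Set.mem_ofPred_eq] at q ⊢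
      rw [le_div_iff₀ hε0]; linarith
    have c3 : ContinuousOn (fun p : ℝ × ℝ => -p.2 ^ 2 + A * p.2)
        {p | 0 ≤ p.1 ∧ p.1 ≤ L ∧ ε * f (p.1 / ε) ≤ p.2 ∧ p.2 ≤ 1} := by fun_prop
    exact c1.sub (continuousOn_const.mul (c3.add (continuousOn_const.mul c2)))
  have hp : ∀ x y, h (x + L) y = h x y := by
    intro x y; simp only [hh, hu.periodic, hβL]
  have hexp : Real.exp (-(1 / ε)) ≤ ε := by
    have e1 := Real.add_one_le_exp (1 / ε)
    rw [Real.exp_neg, inv_le_comm₀ (Real.exp_pos _) hε0]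
    rw [one_div] at e1 ⊢
    linarith
  have hbot : ∀ x, |h x (ε * f (x / ε))| ≤ C / 2 * (1 + M) * ε ^ 2 := by
    intro x
    have e0 : ε * f (x / ε) / ε = f (x / ε) := by field_simp
    have e1 : h x (ε * f (x / ε)) = C / 2 * (ε ^ 2 * f (x / ε) ^ 2) := by
      simp only [hh, hu.bc_rough, e0, hβ.bc]; ring
    have e2 : f (x / ε) ^ 2 ≤ 1 := by
      have := hfb (x / ε); nlinarith
    rw [e1, abs_of_nonneg (by positivity), mul_assoc]
    refine mul_le_mul_of_nonneg_left ?_ (by positivity)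
    nlinarith [sq_nonneg ε]
  have htop : ∀ x, |h x 1| ≤ C / 2 * (1 + M) * ε ^ 2 := by
    intro x
    have e1 : h x 1 = -(C / 2 * A * ε * (β (x / ε) (1 / ε) - b)) := by
      simp only [hh, hu.bc_top]; linear_combination (-(C / 2)) * hAb
    have e2 := hM (x / ε) (1 / ε) (by positivity)
    rw [e1, abs_neg, abs_mul, abs_of_pos (by positivity : 0 < C / 2 * A * ε)]
    have e3 : |β (x / ε) (1 / ε) - b| ≤ M * ε := e2.trans (by gcongr)
    calc C / 2 * A * ε * |β (x / ε) (1 / ε) - b| ≤ C / 2 * 1 * ε * (M * ε) := by gcongr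
      _ ≤ C / 2 * (1 + M) * ε ^ 2 := by nlinarith [mul_pos hC (pow_pos hε0 2)]
  have hφy : ε * f (x / ε) ≤ y := (hφneg x).le.trans hy0
  have up : h x y ≤ C / 2 * (1 + M) * ε ^ 2 :=
    max_principle hL hcf hφL hφ0 hc hp d1 d2 d11 d22 hl
      (fun x => (abs_le.1 (hbot x)).2) (fun x => (abs_le.1 (htop x)).2) hx0 hxL hφy hy1
  have low : -h x y ≤ C / 2 * (1 + M) * ε ^ 2 :=
    max_principle (h := fun x y => -h x y) (h1 := fun x y => -h1 x y) (h2 := fun x y => -h2 x y)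
      (h11 := fun x y => -h11 x y) (h22 := fun x y => -h22 x y) hL hcf hφL hφ0 hc.neg
      (fun x y => by simp only [hp]) (fun x y q1 q2 => (d1 x y q1 q2).neg)
      (fun x y q1 q2 => (d2 x y q1 q2).neg)
      (fun x y q1 q2 => (d11 x y q1 q2).neg) (fun x y q1 q2 => (d22 x y q1 q2).neg)
      (fun x y q1 q2 q3 q4 => by have := hl x y q1 q2 q3 q4; linarith)
      (fun x => by have := (abs_le.1 (hbot x)).1; linarith)
      (fun x => by have := (abs_le.1 (htop x)).1; linarith) hx0 hxL hφy hy1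
  have hdec : u x y - wallLaw1 C ε b x y = h x y + C / 2 * A * ε * (β (x / ε) (y / ε) - b) := by
    have e1 : y / (1 + ε * b) = A * y := by rw [hA]; ring
    have e2 : ε * b / (1 + ε * b) = A * (ε * b) := by rw [hA]; ring
    simp only [hh, wallLaw1, e1, e2]; ring
  have hlay : |C / 2 * A * ε * (β (x / ε) (y / ε) - b)| ≤
      C / 2 * (1 + M) * (ε * Real.exp (-(y / ε))) := by
    rw [abs_mul, abs_of_pos (by positivity : 0 < C / 2 * A * ε)]
    have e2 := hM (x / ε) (y / ε) (by positivity)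
    calc C / 2 * A * ε * |β (x / ε) (y / ε) - b|
        ≤ C / 2 * 1 * ε * (M * Real.exp (-(y / ε))) := by gcongr
      _ ≤ C / 2 * 1 * ε * ((1 + M) * Real.exp (-(y / ε))) := by gcongr; linarith
      _ = _ := by ring
  rw [hdec]
  refine (abs_add_le _ _).trans ?_
  have : |h x y| ≤ C / 2 * (1 + M) * ε ^ 2 := abs_le.2 ⟨by linarith, up⟩
  linarith

/-- From the pointwise boundary layer bound to the `L²` bound. -/
lemma l2_bound {L K ε : ℝ} (hL : 0 < L) (hK : 0 ≤ K) (hε0 : 0 < ε) (hε1 : ε ≤ 1)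
    {v : ℝ × ℝ → ℝ}
    (hv : ∀ p ∈ Omega0 L, |v p| ≤ K * (ε ^ 2 + ε * Real.exp (-(p.2 / ε)))) :
    Real.sqrt (∫ p in Omega0 L, (v p) ^ 2) ≤ Real.sqrt (3 * L) * K * ε ^ ((3 : ℝ) / 2) := by
  have hcont : Continuous (fun p : ℝ × ℝ => 2 * K ^ 2 * (ε ^ 4 + ε ^ 2 * Real.exp (-(2 / ε) * p.2))) := by
    fun_prop
  have hmeas : MeasurableSet (Omega0 L) := measurableSet_Ioo.prod measurableSet_Ioo
  have hint : IntegrableOn (fun p : ℝ × ℝ => 2 * K ^ 2 * (ε ^ 4 + ε ^ 2 * Real.exp (-(2 / ε) * p.2)))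
      (Omega0 L) := by
    refine (hcont.continuousOn.integrableOn_compact
      (isCompact_Icc.prod isCompact_Icc : IsCompact (Icc 0 L ×ˢ Icc (0 : ℝ) 1))).mono_set ?_
    exact prod_mono Ioo_subset_Icc_self Ioo_subset_Icc_self
  have h1 : ∫ p in Omega0 L, (v p) ^ 2 ≤
      ∫ p in Omega0 L, 2 * K ^ 2 * (ε ^ 4 + ε ^ 2 * Real.exp (-(2 / ε) * p.2)) := by
    refine integral_mono_of_nonneg (Filter.Eventually.of_forall fun p => sq_nonneg _) hint ?_
    refine (ae_restrict_iff' hmeas).2 (Filter.Eventually.of_forall fun p hp => ?_)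
    have e := hv p hp
    have e1 : (v p) ^ 2 ≤ (K * (ε ^ 2 + ε * Real.exp (-(p.2 / ε)))) ^ 2 := by
      rw [← sq_abs]; gcongr
    have e2 : Real.exp (-(2 / ε) * p.2) = Real.exp (-(p.2 / ε)) ^ 2 := by
      rw [← Real.exp_nat_mul]; congr 1; push_cast; ring
    simp only [e2]
    refine e1.trans ?_
    nlinarith [mul_nonneg (sq_nonneg K) (sq_nonneg (ε ^ 2 - ε * Real.exp (-(p.2 / ε))))]
  have h2 : ∫ p in Omega0 L, 2 * K ^ 2 * (ε ^ 4 + ε ^ 2 * Real.exp (-(2 / ε) * p.2)) ≤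
      3 * L * K ^ 2 * ε ^ 3 := by
    unfold Omega0
    rw [Measure.volume_eq_prod, ← Measure.prod_restrict]
    have hprod := integral_prod_mul (μ := volume.restrict (Ioo (0 : ℝ) L))
      (ν := volume.restrict (Ioo (0 : ℝ) 1)) (fun _ : ℝ => (1 : ℝ))
      (fun y : ℝ => 2 * K ^ 2 * (ε ^ 4 + ε ^ 2 * Real.exp (-(2 / ε) * y)))
    simp only [one_mul] at hprod
    rw [hprod]
    have i1 : ∫ _ in Ioo (0 : ℝ) L, (1 : ℝ) = L := by simp [hL.le]
    have i2 : ∫ y in Ioo (0 : ℝ) 1, 2 * K ^ 2 * (ε ^ 4 + ε ^ 2 * Real.exp (-(2 / ε) * y)) =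
        2 * K ^ 2 * (ε ^ 4 + ε ^ 3 / 2 * (1 - Real.exp (-(2 / ε)))) := by
      rw [← integral_Ioc_eq_integral_Ioo, ← intervalIntegral.integral_of_le zero_le_one]
      rw [intervalIntegral.integral_eq_sub_of_hasDerivAt
        (f := fun y => 2 * K ^ 2 * (ε ^ 4 * y + -(ε ^ 3 / 2) * Real.exp (-(2 / ε) * y)))]
      · simp; ring
      · intro y _
        have e : HasDerivAt (fun s : ℝ => Real.exp (-(2 / ε) * s))
            (Real.exp (-(2 / ε) * y) * (-(2 / ε) * 1)) y :=
          ((hasDerivAt_id y).const_mul (-(2 / ε))).exp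
        have := (((hasDerivAt_id y).const_mul (ε ^ 4)).add
          (e.const_mul (-(ε ^ 3 / 2)))).const_mul (2 * K ^ 2)
        refine HasDerivAt.congr_deriv this ?_
        field_simp
      · exact Continuous.intervalIntegrable (by fun_prop) _ _
    rw [i1, i2]
    have e1 : ε ^ 4 ≤ ε ^ 3 := pow_le_pow_of_le_one hε0.le hε1 (by norm_num)
    have e2 : ε ^ 3 / 2 * (1 - Real.exp (-(2 / ε))) ≤ ε ^ 3 / 2 := by
      have := Real.exp_pos (-(2 / ε))
      have : 0 < ε ^ 3 := by positivity
      nlinarith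
    have e3 : ε ^ 4 + ε ^ 3 / 2 * (1 - Real.exp (-(2 / ε))) ≤ 3 / 2 * ε ^ 3 := by linarith
    calc L * (2 * K ^ 2 * (ε ^ 4 + ε ^ 3 / 2 * (1 - Real.exp (-(2 / ε)))))
        ≤ L * (2 * K ^ 2 * (3 / 2 * ε ^ 3)) := by gcongr
      _ = _ := by ring
  refine (Real.sqrt_le_sqrt (h1.trans h2)).trans (le_of_eq ?_)
  have e : ε ^ 3 = (ε ^ ((3 : ℝ) / 2)) ^ 2 := by
    rw [← Real.rpow_natCast, ← Real.rpow_natCast, ← Real.rpow_mul hε0.le]; norm_num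
  rw [e, Real.sqrt_mul (by positivity), Real.sqrt_mul (by positivity),
    Real.sqrt_sq hK, Real.sqrt_sq (by positivity)]

/-- Macroscopic error estimates (Proposition 4.2): both averaged wall-laws `u¹` and `u²`
approximate `u^ε` in `L²(Ω⁰)` at the same rate `ε^{3/2}`. -/
theorem averaged_wall_laws_error_estimates
    (f : ℝ → ℝ) (K₀ : NNReal) (δ L C : ℝ)
    (hf : LipschitzWith K₀ f) (hper : Function.Periodic f (2 * π))
    (hδ0 : 0 < δ) (hδ1 : δ < 1) (hfb : ∀ t, -1 ≤ f t ∧ f t ≤ -δ)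
    (hL : 0 < L) (hC : 0 < C)
    (β : ℝ → ℝ → ℝ) (hβ : CellSolution f (fun t => -f t) β)
    (γ : ℝ → ℝ → ℝ) (hγ : CellSolution f (fun t => -(f t) ^ 2) γ)
    (hβbar : 0 < interfaceAvg β) :
    ∃ K > (0 : ℝ), ∀ ε : ℝ, 0 < ε → ε ≤ 1 →
      (∃ N : ℕ, 0 < N ∧ L = 2 * π * ε * N) →
      ∀ u : ℝ → ℝ → ℝ, RoughSolution f L C ε u →
        Real.sqrt (∫ p in Omega0 L,
            (u p.1 p.2 - wallLaw1 C ε (interfaceAvg β) p.1 p.2) ^ 2)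
          ≤ K * ε ^ ((3 : ℝ) / 2) ∧
        Real.sqrt (∫ p in Omega0 L,
            (u p.1 p.2 - wallLaw2 C ε (interfaceAvg β) (interfaceAvg γ) p.1 p.2) ^ 2)
          ≤ K * ε ^ ((3 : ℝ) / 2) := by
  have hpi := Real.pi_pos
  have hfc := hf.continuous
  have hU : IsOpen {p : ℝ × ℝ | f p.1 < p.2} := isOpen_lt (hfc.comp continuous_fst) continuous_snd
  have hsub : {p : ℝ × ℝ | -δ < p.2} ⊆ {p : ℝ × ℝ | f p.1 < p.2} :=
    fun p hp => lt_of_le_of_lt (hfb p.1).2 hp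
  have hH : IsOpen {p : ℝ × ℝ | -δ < p.2} := isOpen_lt continuous_const continuous_snd
  obtain ⟨M, hM0, hM⟩ := exp_decay hδ0 (reg_of hH (hβ.smooth.mono hsub)) hβ.periodic
    (fun x y hy => hβ.harmonic (x, y) (hsub (show (x, y) ∈ {p : ℝ × ℝ | -δ < p.2} from hy)))
    (hβ.energy.mono_set (by
      rintro ⟨a, b⟩ ⟨ha, hb⟩
      have hb' : (0 : ℝ) < b := hb
      exact ⟨ha.1, ha.2, lt_of_le_of_lt (hfb a).2 (by linarith)⟩))
  set G := |interfaceAvg γ| with hG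
  have hG0 : 0 ≤ G := abs_nonneg _
  have hs0 : 0 < Real.sqrt (3 * L) := Real.sqrt_pos.2 (by positivity)
  refine ⟨Real.sqrt (3 * L) * (C / 2 * (1 + M) + C / 2 * G), by positivity, ?_⟩
  intro ε hε0 hε1 hN u hu
  have hpt : ∀ p ∈ Omega0 L, |u p.1 p.2 - wallLaw1 C ε (interfaceAvg β) p.1 p.2| ≤
      C / 2 * (1 + M) * (ε ^ 2 + ε * Real.exp (-(p.2 / ε))) := by
    rintro ⟨x, y⟩ ⟨hx, hy⟩
    exact pointwise_bound hfc hper hδ0 hfb hL hC hβ hβbar hM0 hM hε0 hε1 hN hu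
      hx.1.le hx.2.le hy.1.le hy.2.le
  have hdiff : ∀ p ∈ Omega0 L, |wallLaw1 C ε (interfaceAvg β) p.1 p.2 -
      wallLaw2 C ε (interfaceAvg β) (interfaceAvg γ) p.1 p.2| ≤ C / 2 * G * ε ^ 2 := by
    rintro ⟨x, y⟩ ⟨hx, hy⟩
    have hy0 : 0 < y := hy.1
    have hy1 : y < 1 := hy.2
    have hden : 1 ≤ 1 + ε * interfaceAvg β := by nlinarith
    have e : wallLaw1 C ε (interfaceAvg β) x y -
        wallLaw2 C ε (interfaceAvg β) (interfaceAvg γ) x y =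
        C / 2 * interfaceAvg γ * ε ^ 2 * ((1 - y) / (1 + ε * interfaceAvg β)) := by
      unfold wallLaw1 wallLaw2
      have : 1 + ε * interfaceAvg β ≠ 0 := by linarith
      field_simp
      ring
    simp only
    rw [e, abs_mul, abs_mul, abs_mul, abs_of_pos (by positivity : 0 < C / 2),
      abs_of_pos (by positivity : 0 < ε ^ 2)]
    refine mul_le_of_le_one_right (by positivity) ?_
    rw [abs_of_nonneg (div_nonneg (by linarith) (by linarith)), div_le_one (by linarith)]
    linarith
  constructor
  · refine l2_bound hL (by positivity) hε0 hε1
      (v := fun p => u p.1 p.2 - wallLaw1 C ε (interfaceAvg β) p.1 p.2) (fun p hp => ?_)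
    refine (hpt p hp).trans ?_
    gcongr
    have : 0 ≤ C / 2 * G := by positivity
    linarith
  · refine l2_bound hL (by positivity) hε0 hε1
      (v := fun p => u p.1 p.2 - wallLaw2 C ε (interfaceAvg β) (interfaceAvg γ) p.1 p.2)
      (fun p hp => ?_)
    have a1 := hpt p hp
    have a2 := hdiff p hp
    have a3 := abs_sub_le (u p.1 p.2) (wallLaw1 C ε (interfaceAvg β) p.1 p.2)
      (wallLaw2 C ε (interfaceAvg β) (interfaceAvg γ) p.1 p.2)
    have a4 : 0 ≤ C / 2 * G * (ε * Real.exp (-(p.2 / ε))) := by positivity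
    refine a3.trans ?_
    nlinarith

end
end
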